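/- arXiv:2011.05899 — 4 statements merged into one kernel-verified Lean document; each statement's English description precedes it below -/
import Mathlib

section
/- Let L_0, L_1 and L_∞ be three distinct, equally spaced rays emanating from the origin, and let 0 ≤ r < R ≤ ∞. Let 𝓕 be the family of all functions meromorphic in the annulus A = {z ∈ ℂ : r < |z| < R} for which all zeros lie on L_0, all 1-points lie on L_1 and all poles lie on L_∞. Then 𝓕 is not normal in A; in fact 𝓕 fails to be normal at every point of A ∩ (L_0 ∪ L_1 ∪ L_∞). -/
open Complex Filter Set Topology

noncomputable section

/-- The open ray emanating from the origin with direction angle `θ`. -/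
def Ray (θ : ℝ) : Set ℂ :=
  {z : ℂ | ∃ t : ℝ, 0 < t ∧ z = (t : ℂ) * Complex.exp ((θ : ℂ) * Complex.I)}

/-- Three rays are equally spaced if their direction angles differ pairwise by `2π/3` mod `2π`. -/
def EquallySpaced (L₀ L₁ L₂ : Set ℂ) : Prop :=
  ∃ θ : ℝ, ({L₀, L₁, L₂} : Set (Set ℂ)) =
    {Ray θ, Ray (θ + 2 * Real.pi / 3), Ray (θ + 4 * Real.pi / 3)}

/-- `f` is meromorphic on the open set `U` with pole set `P`. -/
def MeromOn (f : ℂ → ℂ) (P : Set ℂ) (U : Set ℂ) : Prop :=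
  P ⊆ U ∧ AnalyticOnNhd ℂ f (U \ P) ∧
    (∀ p ∈ P, Tendsto (fun z => ‖f z‖) (𝓝[≠] p) atTop) ∧
    ∀ z ∈ U, ¬ AccPt z (𝓟 P)

-- The Riemann-sphere valued map associated with a meromorphic function with pole set `P`:
-- poles are sent to the point at infinity (`Option.none`).
open Classical in
def toSphere (f : ℂ → ℂ) (P : Set ℂ) (z : ℂ) : Option ℂ :=
  if z ∈ P then Option.none else Option.some (f z)

/-- The chordal (spherical) distance on the Riemann sphere `ℂ ∪ {∞} = Option ℂ`. -/
def sphDist : Option ℂ → Option ℂ → ℝ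
  | Option.some z, Option.some w =>
      2 * dist z w / (Real.sqrt (1 + ‖z‖ ^ 2) * Real.sqrt (1 + ‖w‖ ^ 2))
  | Option.some z, Option.none => 2 / Real.sqrt (1 + ‖z‖ ^ 2)
  | Option.none, Option.some w => 2 / Real.sqrt (1 + ‖w‖ ^ 2)
  | Option.none, Option.none => 0

/-- Local uniform convergence (uniform convergence on compact subsets of `V`) with respect to
the spherical metric. -/
def SphConvOn (F : ℕ → ℂ → Option ℂ) (g : ℂ → Option ℂ) (V : Set ℂ) : Prop :=
  ∀ K : Set ℂ, K ⊆ V → IsCompact K → ∀ ε > (0 : ℝ),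
    ∀ᶠ k in atTop, ∀ z ∈ K, sphDist (F k z) (g z) < ε

/-- The family of meromorphic functions (with pole sets) satisfying the membership predicate
`mem` is normal on `V`: every sequence has a subsequence converging locally uniformly on `V`
with respect to the spherical metric. -/
def NormalOn (mem : (ℂ → ℂ) → Set ℂ → Prop) (V : Set ℂ) : Prop :=
  ∀ (f : ℕ → ℂ → ℂ) (P : ℕ → Set ℂ), (∀ k, mem (f k) (P k)) →
    ∃ φ : ℕ → ℕ, StrictMono φ ∧ ∃ g : ℂ → Option ℂ,
      SphConvOn (fun k => toSphere (f (φ k)) (P (φ k))) g V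

namespace AiryRays

/-- moments of the incomplete Airy integral -/
def Fn (n : ℕ) (z : ℂ) : ℂ :=
  ∫ s in Ioi (0:ℝ), (s:ℂ) ^ n * Complex.exp (z * s - (s:ℂ) ^ 3 / 3)

lemma norm_integrand (n : ℕ) (z : ℂ) (s : ℝ) (hs : 0 < s) :
    ‖(s:ℂ) ^ n * Complex.exp (z * s - (s:ℂ) ^ 3 / 3)‖
      = s ^ n * Real.exp (z.re * s - s ^ 3 / 3) := by
  rw [norm_mul, norm_pow, Complex.norm_exp, Complex.norm_real, Real.norm_of_nonneg hs.le]
  congr 2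
  have : z * s - (s:ℂ) ^ 3 / 3 = z * (s:ℂ) - ((s ^ 3 / 3 : ℝ) : ℂ) := by push_cast; ring
  rw [this, Complex.sub_re, Complex.ofReal_re, Complex.re_mul_ofReal]

lemma bound_integrable (n : ℕ) (M : ℝ) :
    MeasureTheory.IntegrableOn (fun s : ℝ => s ^ n * Real.exp (M * s - s ^ 3 / 3)) (Ioi 0) := by
  apply integrable_of_isBigO_exp_neg (b := 1) one_pos
  · fun_prop
  · set a : ℝ := |M + 2| + 1 with ha
    have ha1 : 1 ≤ a := by rw [ha]; linarith [abs_nonneg (M + 2)]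
    have ha2 : M + 2 ≤ a ^ 2 := by nlinarith [le_abs_self (M + 2)]
    apply Asymptotics.IsBigO.of_bound (n.factorial * Real.exp (2 * a ^ 3 / 3))
    filter_upwards [eventually_ge_atTop (0:ℝ)] with s hs
    rw [Real.norm_of_nonneg (by positivity), Real.norm_of_nonneg (by positivity)]
    have h1 : s ^ n ≤ n.factorial * Real.exp s := by
      have := Real.pow_div_factorial_le_exp s hs n
      rw [div_le_iff₀ (by positivity)] at this
      linarith
    have h2 : M * s - s ^ 3 / 3 ≤ 2 * a ^ 3 / 3 - 2 * s := by
      have : 0 ≤ (s - a) ^ 2 * (s + 2 * a) := by positivity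
      nlinarith
    calc s ^ n * Real.exp (M * s - s ^ 3 / 3)
        ≤ (n.factorial * Real.exp s) * Real.exp (2 * a ^ 3 / 3 - 2 * s) := by gcongr
      _ = n.factorial * Real.exp (2 * a ^ 3 / 3) * Real.exp (-1 * s) := by
          rw [mul_assoc, mul_assoc, ← Real.exp_add, ← Real.exp_add]; congr 2; ring

lemma integrand_integrable (n : ℕ) (z : ℂ) :
    MeasureTheory.IntegrableOn
      (fun s : ℝ => (s:ℂ) ^ n * Complex.exp (z * s - (s:ℂ) ^ 3 / 3)) (Ioi 0) := by
  refine MeasureTheory.Integrable.mono' (bound_integrable n z.re) ?_ ?_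
  · exact Continuous.aestronglyMeasurable (by fun_prop)
  · filter_upwards [MeasureTheory.ae_restrict_mem measurableSet_Ioi] with s hs
    exact (norm_integrand n z s hs).le

lemma hasDerivAt_Fn (n : ℕ) (z : ℂ) : HasDerivAt (Fn n) (Fn (n + 1) z) z := by
  refine (hasDerivAt_integral_of_dominated_loc_of_deriv_le
    (μ := MeasureTheory.volume.restrict (Ioi (0:ℝ)))
    (F := fun z (s : ℝ) => (s:ℂ) ^ n * Complex.exp (z * s - (s:ℂ) ^ 3 / 3))
    (F' := fun z (s : ℝ) => (s:ℂ) ^ (n + 1) * Complex.exp (z * s - (s:ℂ) ^ 3 / 3))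
    (bound := fun s : ℝ => s ^ (n + 1) * Real.exp ((z.re + 1) * s - s ^ 3 / 3))
    (s := Metric.ball z 1) (Metric.ball_mem_nhds z one_pos) ?_ ?_ ?_ ?_ ?_ ?_).2
  · exact Eventually.of_forall fun w => Continuous.aestronglyMeasurable (by fun_prop)
  · exact integrand_integrable n z
  · exact Continuous.aestronglyMeasurable (by fun_prop)
  · filter_upwards [MeasureTheory.ae_restrict_mem measurableSet_Ioi] with s hs w hw
    rw [norm_integrand _ _ _ hs]
    have : w.re ≤ z.re + 1 := by
      have h1 := Complex.abs_re_le_norm (w - z)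
      rw [Metric.mem_ball, dist_eq_norm] at hw
      have h2 := le_abs_self (w - z).re
      rw [Complex.sub_re] at h1 h2
      linarith
    have hs' : (0:ℝ) < s := hs
    gcongr
  · exact bound_integrable _ _
  · refine Eventually.of_forall fun s w _ => ?_
    have h : HasDerivAt (fun z : ℂ => z * (s:ℂ) - (s:ℂ) ^ 3 / 3) (1 * (s:ℂ)) w :=
      ((hasDerivAt_id w).mul_const _).sub_const _
    have := h.cexp.const_mul ((s:ℂ) ^ n)
    refine this.congr_deriv ?_
    rw [pow_succ]; ring

lemma tendsto_Fn (n : ℕ) (w : ℝ → ℂ) (hw : Tendsto (fun t => (w t).re) atTop atBot) :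
    Tendsto (fun t => Fn n (w t)) atTop (𝓝 0) := by
  have := MeasureTheory.tendsto_integral_filter_of_dominated_convergence
    (μ := MeasureTheory.volume.restrict (Ioi (0:ℝ))) (l := atTop)
    (F := fun (t : ℝ) (s : ℝ) => (s:ℂ) ^ n * Complex.exp (w t * s - (s:ℂ) ^ 3 / 3))
    (f := fun _ => (0:ℂ))
    (fun s : ℝ => s ^ n * Real.exp (0 * s - s ^ 3 / 3)) ?_ ?_ (bound_integrable n 0) ?_
  · simpa [Fn] using this
  · exact Eventually.of_forall fun w => Continuous.aestronglyMeasurable (by fun_prop)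
  · filter_upwards [hw.eventually_le_atBot 0] with t ht
    filter_upwards [MeasureTheory.ae_restrict_mem measurableSet_Ioi] with s hs
    rw [norm_integrand _ _ _ hs]
    have hs' : (0:ℝ) < s := hs
    gcongr
  · filter_upwards [MeasureTheory.ae_restrict_mem measurableSet_Ioi] with s hs
    have hs' : (0:ℝ) < s := hs
    rw [tendsto_zero_iff_norm_tendsto_zero]
    simp_rw [norm_integrand _ _ _ hs]
    have h1 : Tendsto (fun t => (w t).re * s - s ^ 3 / 3) atTop atBot :=
      tendsto_atBot_add_const_right _ _ (hw.atBot_mul_const hs')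
    simpa using (Real.tendsto_exp_atBot.comp h1).const_mul (s ^ n)

lemma Fn_two (z : ℂ) : Fn 2 z = z * Fn 0 z + 1 := by
  have hd : ∀ s ∈ Ici (0:ℝ), HasDerivAt (fun s : ℝ => Complex.exp (z * s - (s:ℂ) ^ 3 / 3))
      (z * ((s:ℂ) ^ 0 * Complex.exp (z * s - (s:ℂ) ^ 3 / 3))
        - (s:ℂ) ^ 2 * Complex.exp (z * s - (s:ℂ) ^ 3 / 3)) s := by
    intro s _
    have h0 : HasDerivAt (fun s : ℂ => z * s - s ^ 3 / 3) (z * 1 - (3 * (s:ℂ) ^ 2) / 3) (s:ℂ) := by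
      have := ((hasDerivAt_id (s:ℂ)).const_mul z).sub ((hasDerivAt_pow 3 (s:ℂ)).div_const 3)
      refine this.congr_deriv ?_
      norm_num
    refine h0.cexp.comp_ofReal.congr_deriv ?_
    ring
  have hint := ((integrand_integrable 0 z).const_mul z).sub (integrand_integrable 2 z)
  have hlim : Tendsto (fun s : ℝ => Complex.exp (z * s - (s:ℂ) ^ 3 / 3)) atTop (𝓝 0) := by
    rw [tendsto_zero_iff_norm_tendsto_zero]
    have h1 : Tendsto (fun s : ℝ => s * (z.re - s ^ 2 / 3)) atTop atBot := by
      apply Tendsto.atTop_mul_atBot₀ tendsto_id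
      have : Tendsto (fun s : ℝ => s ^ 2 / 3) atTop atTop :=
        (tendsto_pow_atTop two_ne_zero).atTop_div_const (by norm_num)
      exact tendsto_atBot_add_const_left _ _ (tendsto_neg_atTop_atBot.comp this)
    refine (Real.tendsto_exp_atBot.comp h1).congr' ?_
    filter_upwards [eventually_gt_atTop 0] with s hs
    have := norm_integrand 0 z s hs
    simp only [pow_zero, one_mul] at this
    rw [this, Function.comp]
    congr 1; ring
  have h := MeasureTheory.integral_Ioi_of_hasDerivAt_of_tendsto' hd hint hlim
  rw [MeasureTheory.integral_sub ((integrand_integrable 0 z).const_mul z) (integrand_integrable 2 z),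
    MeasureTheory.integral_const_mul] at h
  change z * Fn 0 z - Fn 2 z = _ at h
  simp at h
  linear_combination -h

lemma conj_Fn (n : ℕ) (z : ℂ) : (starRingEnd ℂ) (Fn n z) = Fn n ((starRingEnd ℂ) z) := by
  unfold Fn
  rw [← integral_conj]
  congr 1
  ext s
  have h3 : (starRingEnd ℂ) 3 = 3 := Complex.conj_ofNat 3
  rw [map_mul, ← Complex.exp_conj]
  simp [h3]

lemma Fn_zero_ne : Fn 0 0 ≠ 0 := by
  have h : Fn 0 0 = ((∫ s in Ioi (0:ℝ), s ^ 0 * Real.exp (0 * s - s ^ 3 / 3) : ℝ) : ℂ) := by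
    unfold Fn
    rw [← integral_complex_ofReal]
    congr 1
    ext s
    push_cast
    rfl
  rw [h]
  have : 0 < ∫ s in Ioi (0:ℝ), s ^ 0 * Real.exp (0 * s - s ^ 3 / 3) := by
    rw [MeasureTheory.setIntegral_pos_iff_support_of_nonneg_ae _ (bound_integrable 0 0)]
    · have : Function.support (fun s : ℝ => s ^ 0 * Real.exp (0 * s - s ^ 3 / 3)) = univ := by
        ext s; simp
      rw [this]; simp
    · exact Eventually.of_forall fun s => by simp; positivity
  exact_mod_cast this.ne'

/-- (a multiple of) the Airy function -/
def Y (ζ z : ℂ) : ℂ := ζ * Fn 0 (ζ * z) - ζ ^ 2 * Fn 0 (ζ ^ 2 * z)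

/-- its derivative -/
def Y1 (ζ z : ℂ) : ℂ := ζ ^ 2 * Fn 1 (ζ * z) - ζ * Fn 1 (ζ ^ 2 * z)

lemma zeta_cube {ζ : ℂ} (hζ : ζ ^ 2 + ζ + 1 = 0) : ζ ^ 3 = 1 := by
  linear_combination (ζ - 1) * hζ

lemma zeta_re_im {ζ : ℂ} (hζ : ζ ^ 2 + ζ + 1 = 0) : ζ.re = -1/2 ∧ ζ.im ^ 2 = 3/4 := by
  have h1 := congrArg Complex.re hζ
  have h2 := congrArg Complex.im hζ
  simp [pow_two] at h1 h2
  have h3 : ζ.im * (2 * ζ.re + 1) = 0 := by linear_combination h2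
  rcases mul_eq_zero.1 h3 with h | h
  · rw [h] at h1
    nlinarith [sq_nonneg (ζ.re + 1/2)]
  · have : ζ.re = -1/2 := by linarith
    refine ⟨this, ?_⟩
    rw [this] at h1
    linarith

lemma zeta_conj {ζ : ℂ} (hζ : ζ ^ 2 + ζ + 1 = 0) : (starRingEnd ℂ) ζ = ζ ^ 2 := by
  have h : ζ ^ 2 = - ζ - 1 := by linear_combination hζ
  obtain ⟨h1, h2⟩ := zeta_re_im hζ
  rw [h]
  apply Complex.ext
  · simp [h1]; norm_num
  · simp

lemma zeta_ne {ζ : ℂ} (hζ : ζ ^ 2 + ζ + 1 = 0) : ζ ≠ 0 := by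
  rintro rfl; simp at hζ

lemma hasDerivAt_Y {ζ : ℂ} (hζ : ζ ^ 2 + ζ + 1 = 0) (z : ℂ) : HasDerivAt (Y ζ) (Y1 ζ z) z := by
  have h := fun c : ℂ => (hasDerivAt_Fn 0 (c * z)).comp z ((hasDerivAt_id z).const_mul c)
  have := ((h ζ).const_mul ζ).sub ((h (ζ ^ 2)).const_mul (ζ ^ 2))
  refine this.congr_deriv ?_
  unfold Y1
  simp only [zero_add, mul_one]
  linear_combination (- ζ * Fn 1 (ζ ^ 2 * z)) * zeta_cube hζ

lemma hasDerivAt_Y1 {ζ : ℂ} (hζ : ζ ^ 2 + ζ + 1 = 0) (z : ℂ) :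
    HasDerivAt (Y1 ζ) (z * Y ζ z) z := by
  have h := fun c : ℂ => (hasDerivAt_Fn 1 (c * z)).comp z ((hasDerivAt_id z).const_mul c)
  have := ((h ζ).const_mul (ζ ^ 2)).sub ((h (ζ ^ 2)).const_mul ζ)
  refine this.congr_deriv ?_
  unfold Y
  simp only [mul_one, Nat.reduceAdd, Fn_two]
  linear_combination (z * ζ * Fn 0 (ζ * z) - z * ζ ^ 2 * Fn 0 (ζ ^ 2 * z)) * zeta_cube hζ

lemma Y_sum {ζ : ℂ} (hζ : ζ ^ 2 + ζ + 1 = 0) (z : ℂ) :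
    Y ζ z + ζ * Y ζ (ζ * z) + ζ ^ 2 * Y ζ (ζ ^ 2 * z) = 0 := by
  have h3 := zeta_cube hζ
  have e1 : ζ * (ζ * z) = ζ ^ 2 * z := by ring
  have e2 : ζ ^ 2 * (ζ * z) = z := by linear_combination z * h3
  have e3 : ζ * (ζ ^ 2 * z) = z := by linear_combination z * h3
  have e4 : ζ ^ 2 * (ζ ^ 2 * z) = ζ * z := by linear_combination z * ζ * h3
  unfold Y
  rw [e1, e2, e3, e4]
  linear_combination (-ζ * Fn 0 (ζ * z)) * h3

lemma conj_Y {ζ : ℂ} (hζ : ζ ^ 2 + ζ + 1 = 0) (z : ℂ) :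
    (starRingEnd ℂ) (Y ζ z) = - Y ζ ((starRingEnd ℂ) z) := by
  have h4 : (ζ ^ 2) ^ 2 = ζ := by linear_combination ζ * zeta_cube hζ
  unfold Y
  simp only [map_sub, map_mul, map_pow, conj_Fn, zeta_conj hζ, h4]
  ring

lemma Y_zero_ne {ζ : ℂ} (hζ : ζ ^ 2 + ζ + 1 = 0) : Y ζ 0 ≠ 0 := by
  have : Y ζ 0 = ζ * (1 - ζ) * Fn 0 0 := by simp [Y]; ring
  rw [this]
  refine mul_ne_zero (mul_ne_zero (zeta_ne hζ) ?_) Fn_zero_ne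
  intro h
  have : ζ = 1 := by linear_combination -h
  rw [this] at hζ; norm_num at hζ

lemma Y_differentiable {ζ : ℂ} (hζ : ζ ^ 2 + ζ + 1 = 0) : Differentiable ℂ (Y ζ) :=
  fun z => (hasDerivAt_Y hζ z).differentiableAt

lemma Y_analytic {ζ : ℂ} (hζ : ζ ^ 2 + ζ + 1 = 0) (z : ℂ) : AnalyticAt ℂ (Y ζ) z :=
  (Y_differentiable hζ).analyticAt z

lemma Y_isolated {ζ : ℂ} (hζ : ζ ^ 2 + ζ + 1 = 0) (z : ℂ) : ∀ᶠ w in 𝓝[≠] z, Y ζ w ≠ 0 := by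
  by_contra h
  have := AnalyticOnNhd.eqOn_zero_of_preconnected_of_frequently_eq_zero
    (fun z _ => Y_analytic hζ z) isPreconnected_univ (mem_univ z)
    (by simpa [Filter.not_eventually] using h)
  exact Y_zero_ne hζ (this (mem_univ 0))

lemma zeta_sq {ζ : ℂ} (hζ : ζ ^ 2 + ζ + 1 = 0) : (ζ ^ 2) ^ 2 + ζ ^ 2 + 1 = 0 := by
  linear_combination ζ * zeta_cube hζ + hζ

lemma tendsto_re_zeta {ζ : ℂ} (hζ : ζ ^ 2 + ζ + 1 = 0) (z : ℂ) :
    Tendsto (fun t : ℝ => (ζ * (z + t)).re) atTop atBot := by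
  have : (fun t : ℝ => (ζ * (z + t)).re) = fun t : ℝ => (ζ * z).re + (-1/2) * t := by
    ext t
    rw [mul_add, Complex.add_re, Complex.re_mul_ofReal, (zeta_re_im hζ).1]
  rw [this]
  exact tendsto_atBot_add_const_left _ _ (tendsto_id.const_mul_atTop_of_neg (by norm_num))

lemma tendsto_Y {ζ : ℂ} (hζ : ζ ^ 2 + ζ + 1 = 0) (z : ℂ) :
    Tendsto (fun t : ℝ => Y ζ (z + t)) atTop (𝓝 0) := by
  have h1 := (tendsto_Fn 0 _ (tendsto_re_zeta hζ z)).const_mul ζ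
  have h2 := (tendsto_Fn 0 _ (tendsto_re_zeta (zeta_sq hζ) z)).const_mul (ζ ^ 2)
  simpa [Y] using h1.sub h2

lemma tendsto_Y1 {ζ : ℂ} (hζ : ζ ^ 2 + ζ + 1 = 0) (z : ℂ) :
    Tendsto (fun t : ℝ => Y1 ζ (z + t)) atTop (𝓝 0) := by
  have h1 := (tendsto_Fn 1 _ (tendsto_re_zeta hζ z)).const_mul (ζ ^ 2)
  have h2 := (tendsto_Fn 1 _ (tendsto_re_zeta (zeta_sq hζ) z)).const_mul ζ
  simpa [Y1] using h1.sub h2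

/-- All zeros of `Y` are on the negative real axis. -/
lemma Y_zeros {ζ : ℂ} (hζ : ζ ^ 2 + ζ + 1 = 0) (z : ℂ) (hz : Y ζ z = 0) :
    z.im = 0 ∧ z.re < 0 := by
  by_contra hcon
  -- choose a multiplier
  obtain ⟨m, h0, hm⟩ : ∃ m : ℂ, 0 ≤ m.re ∧ ∀ t : ℝ, 0 < t → 0 < (m * (z + t)).re := by
    by_cases him : z.im = 0
    · refine ⟨1, by simp, fun t ht => ?_⟩
      have : 0 ≤ z.re := by
        by_contra h; exact hcon ⟨him, not_le.1 h⟩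
      simp; linarith
    · refine ⟨-(z.im : ℂ) * I, by simp, fun t ht => ?_⟩
      simp
      positivity
  set y : ℝ → ℂ := fun t => Y ζ (z + t) with hy
  set y1 : ℝ → ℂ := fun t => Y1 ζ (z + t) with hy1
  have haff : ∀ t : ℝ, HasDerivAt (fun t : ℝ => z + (t:ℂ)) 1 t := fun t =>
    (Complex.ofRealCLM.hasDerivAt (x := t)).const_add z
  have hdy : ∀ t : ℝ, HasDerivAt y (y1 t) t := fun t =>
    ((hasDerivAt_Y hζ (z + t)).comp_of_eq t (haff t) rfl).congr_deriv (by simp [hy1])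
  have hdy1 : ∀ t : ℝ, HasDerivAt y1 ((z + t) * y t) t := fun t =>
    ((hasDerivAt_Y1 hζ (z + t)).comp_of_eq t (haff t) rfl).congr_deriv (by simp [hy])
  set G : ℝ → ℝ := fun t => (m * (y1 t * (starRingEnd ℂ) (y t))).re with hG
  have hdG : ∀ t : ℝ, HasDerivAt G
      ((m * (z + t)).re * ‖y t‖ ^ 2 + m.re * ‖y1 t‖ ^ 2) t := fun t => by
    have h1 := ((hdy1 t).mul (hdy t).star).const_mul m
    have h2 := (Complex.reCLM.hasFDerivAt.comp_hasDerivAt t h1)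
    refine h2.congr_deriv ?_
    have e : m * ((z + t) * y t * star (y t) + y1 t * star (y1 t))
        = (m * (z + t)) * ((‖y t‖ ^ 2 : ℝ) : ℂ) + m * ((‖y1 t‖ ^ 2 : ℝ) : ℂ) := by
      have a1 := Complex.mul_conj' (y t)
      have a2 := Complex.mul_conj' (y1 t)
      push_cast
      rw [← a1, ← a2]
      simp only [starRingEnd_apply]
      ring
    rw [e]
    simp only [Complex.reCLM_apply, Complex.add_re, Complex.re_mul_ofReal]
  have hmon : MonotoneOn G (Ici 0) := by
    apply monotoneOn_of_deriv_nonneg (convex_Ici 0)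
    · exact fun t _ => (hdG t).continuousAt.continuousWithinAt
    · exact fun t _ => (hdG t).differentiableAt.differentiableWithinAt
    · intro t ht
      rw [interior_Ici] at ht
      rw [(hdG t).deriv]
      have := hm t ht
      positivity
  have hG0 : G 0 = 0 := by simp [hG, hy, hz]
  have hGlim : Tendsto G atTop (𝓝 0) := by
    have h1 := ((tendsto_Y1 hζ z).mul ((Complex.continuous_conj.tendsto _).comp
      (tendsto_Y hζ z))).const_mul m
    have h2 := (Complex.continuous_re.tendsto _).comp h1
    simp only [map_zero, mul_zero, Complex.zero_re] at h2
    exact h2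
  have hGz : ∀ t ≥ 0, G t = 0 := by
    intro t ht
    apply le_antisymm
    · refine ge_of_tendsto hGlim ?_
      filter_upwards [eventually_ge_atTop t] with s hs
      exact hmon ht (le_trans ht hs) hs
    · rw [← hG0]; exact hmon self_mem_Ici ht ht
  have hyz : ∀ t > 0, y t = 0 := by
    intro t ht
    have h1 : HasDerivAt G 0 t := by
      refine (hasDerivAt_const t (0:ℝ)).congr_of_eventuallyEq ?_
      filter_upwards [Ioi_mem_nhds ht] with s hs
      exact hGz s (le_of_lt hs)
    have h2 := (hdG t).unique h1
    have h3 := hm t ht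
    have h4 : 0 ≤ m.re * ‖y1 t‖ ^ 2 := by positivity
    have h5 : (m * (z + t)).re * ‖y t‖ ^ 2 ≤ 0 := by linarith
    have h6 : ‖y t‖ ^ 2 ≤ 0 := by
      by_contra h; push Not at h; nlinarith
    have : ‖y t‖ = 0 := by nlinarith [norm_nonneg (y t)]
    simpa using this
  have hiso := Y_isolated hζ (z + (1:ℝ))
  have htend : Tendsto (fun t : ℝ => z + (t:ℂ)) (𝓝[≠] 1) (𝓝[≠] (z + (1:ℝ))) := by
    apply tendsto_nhdsWithin_of_tendsto_nhds_of_eventually_within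
    · exact (Continuous.tendsto (by fun_prop) 1).mono_left nhdsWithin_le_nhds
    · filter_upwards [self_mem_nhdsWithin] with t ht
      simpa using ht
  have h1 := htend.eventually hiso
  have h2 : ∀ᶠ t : ℝ in 𝓝[≠] 1, 0 < t := nhdsWithin_le_nhds (Ioi_mem_nhds one_pos)
  obtain ⟨t, ht1, ht2⟩ := (h1.and h2).exists
  exact ht1 (hyz t ht2)

lemma Y_no_common {ζ : ℂ} (hζ : ζ ^ 2 + ζ + 1 = 0) (z : ℂ) (h : Y ζ z = 0) :
    Y ζ (ζ * z) ≠ 0 := by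
  intro h2
  obtain ⟨a1, a2⟩ := Y_zeros hζ _ h
  obtain ⟨b1, b2⟩ := Y_zeros hζ _ h2
  rw [Complex.mul_re, a1, (zeta_re_im hζ).1] at b2
  linarith

lemma sturm (v v' : ℝ → ℝ) (h1 : ∀ x, HasDerivAt v (v' x) x)
    (h2 : ∀ x, HasDerivAt v' (-x * v x) x) (a : ℝ) (ha : 0 < a) :
    ∃ x ∈ Icc a (a + Real.pi / √a), v x = 0 := by
  -- positive case
  have key : ∀ (v v' : ℝ → ℝ), (∀ x, HasDerivAt v (v' x) x) →
      (∀ x, HasDerivAt v' (-x * v x) x) → ¬ ∀ x ∈ Icc a (a + Real.pi / √a), 0 < v x := by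
    intro v v' h1 h2 hpos
    have hb : 0 < √a := Real.sqrt_pos.2 ha
    have hb2 : √a * √a = a := Real.mul_self_sqrt ha.le
    set b := √a with hbdef
    have hle : a ≤ a + Real.pi / b := by
      have : 0 < Real.pi / b := div_pos Real.pi_pos hb
      linarith
    have hlin : ∀ x, HasDerivAt (fun x => b * (x - a)) b x := fun x => by
      simpa using ((hasDerivAt_id x).sub_const a).const_mul b
    set w : ℝ → ℝ := fun x => v' x * Real.sin (b * (x - a)) - v x * (b * Real.cos (b * (x - a)))
      with hw
    have hdw : ∀ x, HasDerivAt w ((a - x) * v x * Real.sin (b * (x - a))) x := fun x => by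
      have := ((h2 x).mul (hlin x).sin).sub ((h1 x).mul ((hlin x).cos.const_mul b))
      refine this.congr_deriv ?_
      linear_combination (v x * Real.sin (b * (x - a))) * hb2
    have hanti : AntitoneOn w (Icc a (a + Real.pi / b)) := by
      apply antitoneOn_of_deriv_nonpos (convex_Icc _ _)
      · exact fun t _ => (hdw t).continuousAt.continuousWithinAt
      · exact fun t _ => (hdw t).differentiableAt.differentiableWithinAt
      · intro x hx
        rw [interior_Icc] at hx
        rw [(hdw x).deriv]
        have hv := hpos x ⟨hx.1.le, hx.2.le⟩
        have hs : 0 ≤ Real.sin (b * (x - a)) := by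
          apply Real.sin_nonneg_of_nonneg_of_le_pi
          · exact mul_nonneg hb.le (by linarith [hx.1])
          · have : x - a ≤ Real.pi / b := by linarith [hx.2]
            rw [le_div_iff₀ hb] at this
            linarith
        have : 0 ≤ (x - a) * v x * Real.sin (b * (x - a)) :=
          mul_nonneg (mul_nonneg (by linarith [hx.1]) hv.le) hs
        linarith
    have := hanti (left_mem_Icc.2 hle) (right_mem_Icc.2 hle) hle
    have e : b * (a + Real.pi / b - a) = Real.pi := by field_simp; ring
    simp only [hw, e, sub_self, mul_zero, Real.sin_zero, Real.cos_zero, Real.sin_pi,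
      Real.cos_pi] at this
    have p1 := mul_pos (hpos _ (left_mem_Icc.2 hle)) hb
    have p2 := mul_pos (hpos _ (right_mem_Icc.2 hle)) hb
    nlinarith
  by_contra! hne
  have hcont : Continuous v := continuous_iff_continuousAt.2 fun x => (h1 x).continuousAt
  have hpre : IsPreconnected (Icc a (a + Real.pi / √a)) := isPreconnected_Icc
  by_cases hp : ∀ x ∈ Icc a (a + Real.pi / √a), 0 < v x
  · exact key v v' h1 h2 hp
  · apply key (fun x => - v x) (fun x => - v' x) (fun x => (h1 x).neg)
      (fun x => (h2 x).neg.congr_deriv (by ring))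
    push Not at hp
    obtain ⟨p, hp, hpv⟩ := hp
    intro x hx
    by_contra hx'
    simp only [Left.neg_pos_iff, not_lt] at hx'
    obtain ⟨y, hy, hy0⟩ := hpre.intermediate_value hp hx hcont.continuousOn ⟨hpv, hx'⟩
    exact hne y hy hy0

/-- the sphere -/
abbrev Sp := WithLp 2 (ℂ × ℝ)

/-- stereographic projection in homogeneous coordinates -/
def S (a b : ℂ) : Sp :=
  WithLp.toLp 2 (2 * a * (starRingEnd ℂ) b / ((‖a‖ ^ 2 + ‖b‖ ^ 2 : ℝ) : ℂ),
    (‖a‖ ^ 2 - ‖b‖ ^ 2) / (‖a‖ ^ 2 + ‖b‖ ^ 2))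

/-- stereographic projection -/
def stereo : Option ℂ → Sp
  | Option.some z => S z 1
  | Option.none => S 1 0

lemma S_smul (k a b : ℂ) (hk : k ≠ 0) : S (k * a) (k * b) = S a b := by
  have hk' : (‖k‖ : ℝ) ^ 2 ≠ 0 := by simpa using hk
  have hk2 : ((‖k‖ ^ 2 : ℝ) : ℂ) ≠ 0 := by exact_mod_cast hk'
  unfold S
  congr 2
  · have h1 : ((‖k * a‖ ^ 2 + ‖k * b‖ ^ 2 : ℝ) : ℂ)
        = ((‖k‖ ^ 2 : ℝ) : ℂ) * ((‖a‖ ^ 2 + ‖b‖ ^ 2 : ℝ) : ℂ) := by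
      rw [← Complex.ofReal_mul]; congr 1; rw [norm_mul, norm_mul]; ring
    have h2 : 2 * (k * a) * (starRingEnd ℂ) (k * b)
        = ((‖k‖ ^ 2 : ℝ) : ℂ) * (2 * a * (starRingEnd ℂ) b) := by
      have := Complex.mul_conj' k
      push_cast
      rw [← this, map_mul]; ring
    rw [h1, h2, mul_div_mul_left _ _ hk2]
  · rw [norm_mul, norm_mul, mul_pow, mul_pow, ← mul_sub, ← mul_add, mul_div_mul_left _ _ hk']

lemma S_continuousAt (N D : ℂ → ℂ) (z : ℂ) (hN : ContinuousAt N z) (hD : ContinuousAt D z)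
    (h : D z = 0 → N z ≠ 0) : ContinuousAt (fun z => S (N z) (D z)) z := by
  have hne : ‖N z‖ ^ 2 + ‖D z‖ ^ 2 ≠ 0 := by
    by_cases hd : D z = 0
    · have := norm_pos_iff.2 (h hd); positivity
    · have := norm_pos_iff.2 hd; positivity
  have hne' : ((‖N z‖ ^ 2 + ‖D z‖ ^ 2 : ℝ) : ℂ) ≠ 0 := by exact_mod_cast hne
  have hs : ContinuousAt (fun z => ‖N z‖ ^ 2 + ‖D z‖ ^ 2) z := (hN.norm.pow 2).add (hD.norm.pow 2)
  have hc : ContinuousAt (fun z => (starRingEnd ℂ) (D z)) z :=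
    Complex.continuous_conj.continuousAt.comp hD
  have hs' : ContinuousAt (fun z => ((‖N z‖ ^ 2 + ‖D z‖ ^ 2 : ℝ) : ℂ)) z :=
    Complex.continuous_ofReal.continuousAt.comp hs
  have h1 := (((continuousAt_const (y := (2:ℂ))).mul hN).mul hc).div hs' hne'
  have h2 := ((hN.norm.pow 2).sub (hD.norm.pow 2)).div hs hne
  exact (WithLp.prod_continuous_toLp 2 ℂ ℝ).continuousAt.comp (h1.prodMk h2)

lemma dist_S_sq (a b c d : ℂ) (h1 : a ≠ 0 ∨ b ≠ 0) (h2 : c ≠ 0 ∨ d ≠ 0) :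
    dist (S a b) (S c d) ^ 2
      = 4 * ‖a * d - b * c‖ ^ 2 / ((‖a‖ ^ 2 + ‖b‖ ^ 2) * (‖c‖ ^ 2 + ‖d‖ ^ 2)) := by
  have hn1 : ‖a‖ ^ 2 + ‖b‖ ^ 2 ≠ 0 := by
    rcases h1 with h | h <;> (have := norm_pos_iff.2 h; positivity)
  have hn2 : ‖c‖ ^ 2 + ‖d‖ ^ 2 ≠ 0 := by
    rcases h2 with h | h <;> (have := norm_pos_iff.2 h; positivity)
  rw [dist_eq_norm, WithLp.prod_norm_sq_eq_of_L2]
  simp only [S, WithLp.sub_fst, WithLp.sub_snd, Real.norm_eq_abs, sq_abs]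
  have e : ∀ z : ℂ, ‖z‖ ^ 2 = z.re ^ 2 + z.im ^ 2 := fun z => by
    rw [← Complex.normSq_eq_norm_sq, Complex.normSq_apply]; ring
  change ‖2 * a * (starRingEnd ℂ) b / ((‖a‖ ^ 2 + ‖b‖ ^ 2 : ℝ) : ℂ)
      - 2 * c * (starRingEnd ℂ) d / ((‖c‖ ^ 2 + ‖d‖ ^ 2 : ℝ) : ℂ)‖ ^ 2
    + ((‖a‖ ^ 2 - ‖b‖ ^ 2) / (‖a‖ ^ 2 + ‖b‖ ^ 2)
      - (‖c‖ ^ 2 - ‖d‖ ^ 2) / (‖c‖ ^ 2 + ‖d‖ ^ 2)) ^ 2 = _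
  rw [e (2 * a * _ / _ - _), Complex.sub_re, Complex.sub_im, Complex.div_ofReal_re,
    Complex.div_ofReal_re, Complex.div_ofReal_im, Complex.div_ofReal_im]
  field_simp
  simp only [e, Complex.mul_re, Complex.mul_im, Complex.sub_re, Complex.sub_im, Complex.conj_re,
    Complex.conj_im, Complex.re_ofNat, Complex.im_ofNat]
  ring

lemma sphDist_eq (p q : Option ℂ) : sphDist p q = dist (stereo p) (stereo q) := by
  have key : ∀ x : ℝ, 0 ≤ x → x ^ 2 = dist (stereo p) (stereo q) ^ 2 →
      x = dist (stereo p) (stereo q) := fun x hx h =>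
    (pow_left_inj₀ hx dist_nonneg two_ne_zero).1 h
  rcases p with _ | z <;> rcases q with _ | w
  · simp [sphDist]
  · apply key _ (by unfold sphDist; positivity)
    simp only [sphDist, stereo]
    rw [dist_S_sq _ _ _ _ (by simp) (by simp), div_pow, Real.sq_sqrt (by positivity)]
    simp; norm_num; ring
  · apply key _ (by unfold sphDist; positivity)
    simp only [sphDist, stereo]
    rw [dist_S_sq _ _ _ _ (by simp) (by simp), div_pow, Real.sq_sqrt (by positivity)]
    simp; norm_num; ring
  · apply key _ (by unfold sphDist; positivity)
    simp only [sphDist, stereo]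
    rw [dist_S_sq _ _ _ _ (by simp) (by simp), div_pow, mul_pow, mul_pow,
      Real.sq_sqrt (by positivity), Real.sq_sqrt (by positivity), dist_eq_norm]
    simp; norm_num; ring

lemma no_conv (F : ℕ → ℂ → Option ℂ) (g : ℂ → Option ℂ) (V : Set ℂ) (hV : IsOpen V)
    (z₀ : ℂ) (hz : z₀ ∈ V) (hF : SphConvOn F g V)
    (hc : ∀ k, ∀ z ∈ V, ContinuousAt (fun z => stereo (F k z)) z) (p : ℕ → ℂ)
    (hp : Tendsto p atTop (𝓝 z₀)) (a : Sp) (ha : ∀ᶠ k in atTop, stereo (F k (p k)) = a) :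
    a = stereo (g z₀) := by
  obtain ⟨ε, hε, hb⟩ := Metric.nhds_basis_closedBall.mem_iff.1 (hV.mem_nhds hz)
  set K := Metric.closedBall z₀ ε with hK
  have hKn : K ∈ 𝓝 z₀ := Metric.closedBall_mem_nhds z₀ hε
  have hunif : TendstoUniformlyOn (fun k z => stereo (F k z)) (fun z => stereo (g z)) atTop K := by
    rw [Metric.tendstoUniformlyOn_iff]
    intro δ hδ
    filter_upwards [hF K hb (isCompact_closedBall z₀ ε) δ hδ] with k hk z hz
    rw [dist_comm, ← sphDist_eq]
    exact hk z hz
  have hcont : ContinuousOn (fun z => stereo (g z)) K :=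
    hunif.continuousOn (Eventually.of_forall fun k z hz =>
      (hc k z (hb hz)).continuousWithinAt).frequently
  have h1 := hunif.tendsto_comp (hcont z₀ (mem_of_mem_nhds hKn)) 
    (tendsto_nhdsWithin_iff.2 ⟨hp, hp.eventually hKn⟩)
  exact tendsto_nhds_unique (tendsto_const_nhds.congr' (ha.mono fun k hk => hk.symm)) h1

lemma Y_zero_in {ζ : ℂ} (hζ : ζ ^ 2 + ζ + 1 = 0) (a : ℝ) (ha : 0 < a) :
    ∃ x ∈ Icc a (a + Real.pi / √a), Y ζ (-(x:ℂ)) = 0 := by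
  have hneg : ∀ t : ℝ, HasDerivAt (fun t : ℝ => -(t:ℂ)) (-1) t := fun t =>
    (Complex.ofRealCLM.hasDerivAt (x := t)).neg
  obtain ⟨x, hx, h⟩ := sturm (fun t => (Y ζ (-(t:ℂ))).im) (fun t => (-Y1 ζ (-(t:ℂ))).im)
    (fun t => by
      have h1 := (hasDerivAt_Y hζ (-(t:ℂ))).comp_of_eq t (hneg t) rfl
      have h2 := (Complex.imCLM.hasFDerivAt.comp_hasDerivAt t h1)
      exact h2.congr_deriv (by simp))
    (fun t => by
      have h1 := ((hasDerivAt_Y1 hζ (-(t:ℂ))).comp_of_eq t (hneg t) rfl).neg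
      have h2 := (Complex.imCLM.hasFDerivAt.comp_hasDerivAt t h1)
      exact h2.congr_deriv (by simp)) a ha
  refine ⟨x, hx, Complex.ext ?_ h⟩
  have := congrArg Complex.re (conj_Y hζ (-(x:ℂ)))
  simp at this
  simp; linarith

lemma B_zero_in {ζ : ℂ} (hζ : ζ ^ 2 + ζ + 1 = 0) (a : ℝ) (ha : 0 < a) :
    ∃ x ∈ Icc a (a + Real.pi / √a), (ζ * Y ζ (ζ * -(x:ℂ))).re = 0 := by
  have h3 := zeta_cube hζ
  have hneg : ∀ t : ℝ, HasDerivAt (fun t : ℝ => ζ * -(t:ℂ)) (-ζ) t := fun t =>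
    ((Complex.ofRealCLM.hasDerivAt (x := t)).neg.const_mul ζ).congr_deriv (by simp)
  obtain ⟨x, hx, h⟩ := sturm (fun t => (ζ * Y ζ (ζ * -(t:ℂ))).re)
    (fun t => (-ζ ^ 2 * Y1 ζ (ζ * -(t:ℂ))).re)
    (fun t => by
      have h1 := ((hasDerivAt_Y hζ (ζ * -(t:ℂ))).comp_of_eq t (hneg t) rfl).const_mul ζ
      have h2 := (Complex.reCLM.hasFDerivAt.comp_hasDerivAt t h1)
      refine h2.congr_deriv ?_
      change (ζ * (Y1 ζ (ζ * -(t:ℂ)) * -ζ)).re = _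
      congr 1; ring)
    (fun t => by
      have h1 := ((hasDerivAt_Y1 hζ (ζ * -(t:ℂ))).comp_of_eq t (hneg t) rfl).const_mul (-ζ ^ 2)
      have h2 := (Complex.reCLM.hasFDerivAt.comp_hasDerivAt t h1)
      refine h2.congr_deriv ?_
      change (-ζ ^ 2 * ((ζ * -(t:ℂ)) * Y ζ (ζ * -(t:ℂ)) * -ζ)).re = _
      have : -ζ ^ 2 * ((ζ * -(t:ℂ)) * Y ζ (ζ * -(t:ℂ)) * -ζ)
          = ((-t : ℝ) : ℂ) * (ζ * Y ζ (ζ * -(t:ℂ))) := by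
        push_cast
        linear_combination (-(t:ℂ) * ζ * Y ζ (ζ * -(t:ℂ))) * h3
      rw [this, Complex.re_ofReal_mul]) a ha
  exact ⟨x, hx, h⟩

/-- numerator -/
def Nu (ζ c : ℂ) (k : ℕ) (z : ℂ) : ℂ := -ζ * Y ζ (ζ * (-((k:ℂ) + 1) * z / c))
/-- denominator -/
def De (ζ c : ℂ) (k : ℕ) (z : ℂ) : ℂ := Y ζ (-((k:ℂ) + 1) * z / c)

lemma Nu_ne {ζ : ℂ} (hζ : ζ ^ 2 + ζ + 1 = 0) (c : ℂ) (k : ℕ) (z : ℂ) (h : De ζ c k z = 0) :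
    Nu ζ c k z ≠ 0 :=
  mul_ne_zero (neg_ne_zero.2 (zeta_ne hζ)) (Y_no_common hζ _ h)

lemma De_analytic {ζ : ℂ} (hζ : ζ ^ 2 + ζ + 1 = 0) (c : ℂ) (k : ℕ) (z : ℂ) :
    AnalyticAt ℂ (De ζ c k) z := by
  have : Differentiable ℂ (De ζ c k) := (Y_differentiable hζ).comp (by fun_prop)
  exact this.analyticAt z

lemma Nu_analytic {ζ : ℂ} (hζ : ζ ^ 2 + ζ + 1 = 0) (c : ℂ) (k : ℕ) (z : ℂ) :
    AnalyticAt ℂ (Nu ζ c k) z := by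
  have : Differentiable ℂ (Nu ζ c k) :=
    ((Y_differentiable hζ).comp (f := fun z => ζ * (-((k:ℂ) + 1) * z / c)) (by fun_prop)).const_mul _
  exact this.analyticAt z

lemma De_isolated {ζ : ℂ} (hζ : ζ ^ 2 + ζ + 1 = 0) (c : ℂ) (hc : c ≠ 0) (k : ℕ) (z : ℂ) :
    ∀ᶠ w in 𝓝[≠] z, De ζ c k w ≠ 0 := by
  have htend : Tendsto (fun w : ℂ => -((k:ℂ) + 1) * w / c) (𝓝[≠] z)
      (𝓝[≠] (-((k:ℂ) + 1) * z / c)) := by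
    apply tendsto_nhdsWithin_of_tendsto_nhds_of_eventually_within
    · exact (Continuous.tendsto (by fun_prop) z).mono_left nhdsWithin_le_nhds
    · filter_upwards [self_mem_nhdsWithin] with t ht
      have hk : (k:ℂ) + 1 ≠ 0 := Nat.cast_add_one_ne_zero k
      intro h
      apply ht
      have h' : -((k:ℂ) + 1) * t / c = -((k:ℂ) + 1) * z / c := h
      field_simp at h'
      exact neg_injective h'
  exact htend.eventually (Y_isolated hζ _)

/-- the real points -/
lemma neg_real_of_zero {ζ : ℂ} (hζ : ζ ^ 2 + ζ + 1 = 0) (z : ℂ) (h : Y ζ z = 0) :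
    ∃ s : ℝ, 0 < s ∧ z = -(s:ℂ) := by
  obtain ⟨h1, h2⟩ := Y_zeros hζ z h
  exact ⟨-z.re, by linarith, Complex.ext (by simp) (by simp [h1])⟩

lemma ray_of {ζ c : ℂ} (hc : c ≠ 0) (k : ℕ) (z η : ℂ) (s : ℝ) (hs : 0 < s)
    (h : -((k:ℂ) + 1) * z / c = -(s:ℂ) * η) : ∃ t : ℝ, 0 < t ∧ z = (t:ℂ) * (η * c) := by
  have hk : (k:ℂ) + 1 ≠ 0 := Nat.cast_add_one_ne_zero k
  refine ⟨s / (k + 1), by positivity, ?_⟩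
  push_cast
  field_simp at h ⊢
  linear_combination -h

lemma mem_fam {ζ c : ℂ} (hζ : ζ ^ 2 + ζ + 1 = 0) (hc : c ≠ 0) (k : ℕ) (A L₀ L₁ L₂ : Set ℂ)
    (h0 : ∀ z, z ∈ L₀ ↔ ∃ t : ℝ, 0 < t ∧ z = (t:ℂ) * (ζ ^ 2 * c))
    (h1 : ∀ z, z ∈ L₁ ↔ ∃ t : ℝ, 0 < t ∧ z = (t:ℂ) * (ζ * c))
    (h2 : ∀ z, z ∈ L₂ ↔ ∃ t : ℝ, 0 < t ∧ z = (t:ℂ) * (1 * c)) :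
    MeromOn (fun z => Nu ζ c k z / De ζ c k z) {z | z ∈ A ∧ De ζ c k z = 0} A ∧
      (∀ z ∈ A, z ∉ {z | z ∈ A ∧ De ζ c k z = 0} → Nu ζ c k z / De ζ c k z = 0 → z ∈ L₀) ∧
      (∀ z ∈ A, z ∉ {z | z ∈ A ∧ De ζ c k z = 0} → Nu ζ c k z / De ζ c k z = 1 → z ∈ L₁) ∧
      {z | z ∈ A ∧ De ζ c k z = 0} ⊆ L₂ := by
  have h3 := zeta_cube hζ
  have hζ0 := zeta_ne hζ
  refine ⟨⟨fun z hz => hz.1, ?_, ?_, ?_⟩, ?_, ?_, ?_⟩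
  · intro z hz
    exact (Nu_analytic hζ c k z).div (De_analytic hζ c k z) (fun h => hz.2 ⟨hz.1, h⟩)
  · rintro p ⟨hpA, hp⟩
    have hN : Tendsto (fun z => ‖Nu ζ c k z‖) (𝓝[≠] p) (𝓝 ‖Nu ζ c k p‖) :=
      (Nu_analytic hζ c k p).continuousAt.norm.tendsto.mono_left nhdsWithin_le_nhds
    have hD : Tendsto (fun z => ‖De ζ c k z‖) (𝓝[≠] p) (𝓝[>] 0) := by
      apply tendsto_nhdsWithin_of_tendsto_nhds_of_eventually_within
      · have := (De_analytic hζ c k p).continuousAt.norm.tendsto.mono_left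
          (nhdsWithin_le_nhds (s := {p}ᶜ))
        simpa [hp] using this
      · filter_upwards [De_isolated hζ c hc k p] with z hz
        exact norm_pos_iff.2 hz
    have := hN.pos_mul_atTop (norm_pos_iff.2 (Nu_ne hζ c k p hp)) hD.inv_tendsto_nhdsGT_zero
    refine this.congr fun z => ?_
    simp [div_eq_mul_inv]
  · intro z hz hacc
    rw [accPt_iff_frequently_nhdsNE] at hacc
    exact hacc ((De_isolated hζ c hc k z).mono fun w hw h => hw h.2)
  · intro z hz hzP h
    have hD : De ζ c k z ≠ 0 := fun h => hzP ⟨hz, h⟩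
    rw [div_eq_zero_iff, or_iff_left hD] at h
    have h' : Y ζ (ζ * (-((k:ℂ) + 1) * z / c)) = 0 := by
      simpa [Nu, hζ0] using h
    obtain ⟨s, hs, e⟩ := neg_real_of_zero hζ _ h'
    rw [h0]
    refine ray_of (ζ := ζ) hc k z _ s hs ?_
    linear_combination ζ ^ 2 * e - (-((k:ℂ) + 1) * z / c) * h3
  · intro z hz hzP h
    have hD : De ζ c k z ≠ 0 := fun h => hzP ⟨hz, h⟩
    rw [div_eq_one_iff_eq hD] at h
    have hs := Y_sum hζ (-((k:ℂ) + 1) * z / c)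
    have h' : Y ζ (ζ ^ 2 * (-((k:ℂ) + 1) * z / c)) = 0 := by
      have : ζ ^ 2 * Y ζ (ζ ^ 2 * (-((k:ℂ) + 1) * z / c)) = 0 := by
        unfold Nu De at h
        linear_combination hs + h
      simpa [hζ0] using this
    obtain ⟨s, hs, e⟩ := neg_real_of_zero hζ _ h'
    rw [h1]
    refine ray_of (ζ := ζ) hc k z _ s hs ?_
    linear_combination ζ * e - (-((k:ℂ) + 1) * z / c) * h3
  · rintro z ⟨hz, h⟩
    obtain ⟨s, hs, e⟩ := neg_real_of_zero hζ _ h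
    rw [h2]
    refine ray_of (ζ := ζ) hc k z _ s hs ?_
    linear_combination e

lemma stereo_eq {ζ c : ℂ} (hζ : ζ ^ 2 + ζ + 1 = 0) (k : ℕ) (A : Set ℂ) (z : ℂ) (hz : z ∈ A) :
    stereo (toSphere (fun z => Nu ζ c k z / De ζ c k z) {z | z ∈ A ∧ De ζ c k z = 0} z)
      = S (Nu ζ c k z) (De ζ c k z) := by
  unfold toSphere
  by_cases h : De ζ c k z = 0
  · rw [if_pos ⟨hz, h⟩, h]
    have := S_smul (Nu ζ c k z) 1 0 (Nu_ne hζ c k z h)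
    simpa [stereo] using this.symm
  · rw [if_neg (fun h' => h h'.2)]
    have := S_smul (De ζ c k z) (Nu ζ c k z / De ζ c k z) 1 h
    rw [mul_div_cancel₀ _ h, mul_one] at this
    exact this.symm

/-- value of the function on the three rays -/
lemma values {ζ c : ℂ} (hζ : ζ ^ 2 + ζ + 1 = 0) (hc : c ≠ 0) (η : ℂ)
    (hη : η = ζ ^ 2 ∨ η = ζ ∨ η = 1) : ∃ a b : Sp, a ≠ b ∧ ∀ (k : ℕ) (x : ℝ),
      (Y ζ (-(x:ℂ)) = 0 → S (Nu ζ c k (((x / (k + 1) : ℝ) : ℂ) * (η * c)))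
        (De ζ c k (((x / (k + 1) : ℝ) : ℂ) * (η * c))) = a) ∧
      ((ζ * Y ζ (ζ * -(x:ℂ))).re = 0 → S (Nu ζ c k (((x / (k + 1) : ℝ) : ℂ) * (η * c)))
        (De ζ c k (((x / (k + 1) : ℝ) : ℂ) * (η * c))) = b) := by
  have h3 := zeta_cube hζ
  have hζ0 := zeta_ne hζ
  have harg : ∀ (k : ℕ) (x : ℝ), -((k:ℂ) + 1) * (((x / (k + 1) : ℝ) : ℂ) * (η * c)) / c
      = η * -(x:ℂ) := by
    intro k x
    have hk : (k:ℂ) + 1 ≠ 0 := Nat.cast_add_one_ne_zero k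
    push_cast
    field_simp
  have hA : ∀ x : ℝ, Y ζ (-(x:ℂ)) = 0 → ∃ q : ℂ, q ≠ 0 ∧ Y ζ (ζ * -(x:ℂ)) = ζ ^ 2 * q ∧
      Y ζ (ζ ^ 2 * -(x:ℂ)) = - ζ * q := by
    intro x hx
    refine ⟨ζ * Y ζ (ζ * -(x:ℂ)), mul_ne_zero hζ0 (Y_no_common hζ _ hx), ?_, ?_⟩
    · linear_combination (- Y ζ (ζ * -(x:ℂ))) * h3
    · have := Y_sum hζ (-(x:ℂ))
      rw [hx] at this
      linear_combination ζ * this - Y ζ (ζ ^ 2 * -(x:ℂ)) * h3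
  have hB : ∀ x : ℝ, (ζ * Y ζ (ζ * -(x:ℂ))).re = 0 → ∃ q : ℂ, q ≠ 0 ∧ Y ζ (-(x:ℂ)) = -2 * q ∧
      Y ζ (ζ * -(x:ℂ)) = ζ ^ 2 * q ∧ Y ζ (ζ ^ 2 * -(x:ℂ)) = ζ * q := by
    intro x hx
    set q := ζ * Y ζ (ζ * -(x:ℂ)) with hq
    have hcq : (starRingEnd ℂ) q = - q := Complex.ext (by simp [hx]) (by simp)
    have hcq' : (starRingEnd ℂ) q = - (ζ ^ 2 * Y ζ (ζ ^ 2 * -(x:ℂ))) := by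
      rw [hq, map_mul, conj_Y hζ, map_mul, zeta_conj hζ]
      simp
    have e1 : ζ ^ 2 * Y ζ (ζ ^ 2 * -(x:ℂ)) = q := by
      rw [hcq] at hcq'; linear_combination hcq'
    have e0 : Y ζ (-(x:ℂ)) = -2 * q := by
      have := Y_sum hζ (-(x:ℂ))
      linear_combination this - e1 + hq
    have e2 : Y ζ (ζ * -(x:ℂ)) = ζ ^ 2 * q := by
      linear_combination (- Y ζ (ζ * -(x:ℂ))) * h3 - ζ ^ 2 * hq
    refine ⟨q, ?_, e0, e2, ?_⟩
    · intro h
      rw [h, mul_zero] at e0 e2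
      exact Y_no_common hζ _ e0 e2
    · linear_combination ζ * e1 - Y ζ (ζ ^ 2 * -(x:ℂ)) * h3
  simp only [Nu, De, harg]
  rcases hη with rfl | rfl | rfl
  · have e : ∀ x : ℝ, ζ * (ζ ^ 2 * -(x:ℂ)) = -(x:ℂ) := fun x => by
      linear_combination (-(x:ℂ)) * h3
    refine ⟨S 0 1, S 2 1, ?_, fun k x => ⟨fun hx => ?_, fun hx => ?_⟩⟩
    · intro h
      have := congrArg (fun p : Sp => p.snd) h
      norm_num [S] at this
    · obtain ⟨q, hq, h1, h2⟩ := hA x hx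
      rw [e, hx, h2, ← S_smul (-ζ * q) 0 1 (by simp [hζ0, hq])]
      simp
    · obtain ⟨q, hq, h0, h1, h2⟩ := hB x hx
      rw [e, h0, h2, ← S_smul (ζ * q) 2 1 (by simp [hζ0, hq])]
      congr 1 <;> ring
  · have e : ∀ x : ℝ, η * (η * -(x:ℂ)) = η ^ 2 * -(x:ℂ) := fun x => by ring
    refine ⟨S 1 1, S (-1) 1, ?_, fun k x => ⟨fun hx => ?_, fun hx => ?_⟩⟩
    · intro h
      have := congrArg (fun p : Sp => p.fst.re) h
      norm_num [S] at this
    · obtain ⟨q, hq, h1, h2⟩ := hA x hx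
      rw [e, h1, h2, ← S_smul (η ^ 2 * q) 1 1 (by simp [hζ0, hq])]
      congr 1 <;> ring
    · obtain ⟨q, hq, h0, h1, h2⟩ := hB x hx
      rw [e, h1, h2, ← S_smul (η ^ 2 * q) (-1) 1 (by simp [hζ0, hq])]
      congr 1 <;> ring
  · simp only [one_mul]
    refine ⟨S 1 0, S 1 2, ?_, fun k x => ⟨fun hx => ?_, fun hx => ?_⟩⟩
    · intro h
      have := congrArg (fun p : Sp => p.snd) h
      norm_num [S] at this
    · obtain ⟨q, hq, h1, h2⟩ := hA x hx
      rw [hx, h1, ← S_smul (-q) 1 0 (by simp [hq])]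
      congr 1
      · linear_combination (-q) * h3
      · ring
    · obtain ⟨q, hq, h0, h1, h2⟩ := hB x hx
      rw [h0, h1, ← S_smul (-q) 1 2 (by simp [hq])]
      congr 1
      · linear_combination (-q) * h3
      · ring

lemma tendsto_pts (t₀ : ℝ) (ht : 0 < t₀) (x : ℕ → ℝ)
    (hx : ∀ k : ℕ, x k ∈ Icc (((k:ℝ) + 1) * t₀)
      (((k:ℝ) + 1) * t₀ + Real.pi / √(((k:ℝ) + 1) * t₀))) (d : ℂ) :
    Tendsto (fun k : ℕ => ((x k / (k + 1) : ℝ) : ℂ) * d) atTop (𝓝 ((t₀ : ℂ) * d)) := by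
  have h : Tendsto (fun k : ℕ => x k / ((k:ℝ) + 1)) atTop (𝓝 t₀) := by
    have hk : Tendsto (fun k : ℕ => (k:ℝ) + 1) atTop atTop :=
      tendsto_atTop_add_const_right _ _ tendsto_natCast_atTop_atTop
    have hup : Tendsto (fun k : ℕ => t₀ + Real.pi / √t₀ / ((k:ℝ) + 1)) atTop (𝓝 (t₀ + 0)) :=
      tendsto_const_nhds.add (tendsto_const_nhds.div_atTop hk)
    rw [add_zero] at hup
    refine tendsto_of_tendsto_of_tendsto_of_le_of_le tendsto_const_nhds hup ?_ ?_
    · intro k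
      have := (hx k).1
      change t₀ ≤ x k / ((k:ℝ) + 1)
      rw [le_div_iff₀ (by positivity)]
      linarith
    · intro k
      have h2 := (hx k).2
      change x k / ((k:ℝ) + 1) ≤ t₀ + Real.pi / √t₀ / ((k:ℝ) + 1)
      have h4 : t₀ ≤ ((k:ℝ) + 1) * t₀ := by
        have : (0:ℝ) ≤ k := by positivity
        nlinarith
      have h3 : Real.pi / √(((k:ℝ) + 1) * t₀) ≤ Real.pi / √t₀ := by
        have := Real.sqrt_pos.2 ht
        have := Real.sqrt_le_sqrt h4
        have := Real.pi_pos
        gcongr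
      rw [div_le_iff₀ (by positivity), add_mul, div_mul_cancel₀ _ (by positivity)]
      linarith
  exact ((Complex.continuous_ofReal.tendsto _).comp h).mul_const d

lemma core {ζ c : ℂ} (hζ : ζ ^ 2 + ζ + 1 = 0) (hc : c ≠ 0) (A L₀ L₁ L₂ : Set ℂ)
    (hA : IsOpen A)
    (h0 : ∀ z, z ∈ L₀ ↔ ∃ t : ℝ, 0 < t ∧ z = (t:ℂ) * (ζ ^ 2 * c))
    (h1 : ∀ z, z ∈ L₁ ↔ ∃ t : ℝ, 0 < t ∧ z = (t:ℂ) * (ζ * c))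
    (h2 : ∀ z, z ∈ L₂ ↔ ∃ t : ℝ, 0 < t ∧ z = (t:ℂ) * (1 * c))
    (z₀ : ℂ) (hz₀ : z₀ ∈ A ∩ (L₀ ∪ L₁ ∪ L₂)) (U : Set ℂ) (hU : IsOpen U) (hzU : z₀ ∈ U) :
    ¬ NormalOn (fun f P => MeromOn f P A ∧
      (∀ z ∈ A, z ∉ P → f z = 0 → z ∈ L₀) ∧
      (∀ z ∈ A, z ∉ P → f z = 1 → z ∈ L₁) ∧
      P ⊆ L₂) (U ∩ A) := by
  intro hN
  obtain ⟨φ, hφ, g, hg⟩ := hN (fun k z => Nu ζ c k z / De ζ c k z)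
    (fun k => {z | z ∈ A ∧ De ζ c k z = 0}) (fun k => mem_fam hζ hc k A L₀ L₁ L₂ h0 h1 h2)
  obtain ⟨η, hη, t₀, ht₀, hzt⟩ : ∃ η : ℂ, (η = ζ ^ 2 ∨ η = ζ ∨ η = 1) ∧
      ∃ t : ℝ, 0 < t ∧ z₀ = (t:ℂ) * (η * c) := by
    rcases hz₀.2 with (h | h) | h
    · exact ⟨_, Or.inl rfl, (h0 _).1 h⟩
    · exact ⟨_, Or.inr (Or.inl rfl), (h1 _).1 h⟩
    · exact ⟨_, Or.inr (Or.inr rfl), (h2 _).1 h⟩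
  obtain ⟨a, b, hab, hval⟩ := values hζ hc η hη
  have hpos : ∀ k : ℕ, 0 < ((k:ℝ) + 1) * t₀ := fun k => by positivity
  choose x hx hxY using fun k : ℕ => Y_zero_in hζ (((k:ℝ) + 1) * t₀) (hpos k)
  choose y hy hyB using fun k : ℕ => B_zero_in hζ (((k:ℝ) + 1) * t₀) (hpos k)
  have hV : IsOpen (U ∩ A) := hU.inter hA
  have hzV : z₀ ∈ U ∩ A := ⟨hzU, hz₀.1⟩
  have hcont : ∀ k, ∀ z ∈ U ∩ A, ContinuousAt (fun z => stereo (toSphere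
      (fun z => Nu ζ c (φ k) z / De ζ c (φ k) z) {z | z ∈ A ∧ De ζ c (φ k) z = 0} z)) z := by
    intro k z hz
    refine (S_continuousAt (Nu ζ c (φ k)) (De ζ c (φ k)) z (Nu_analytic hζ c _ z).continuousAt
      (De_analytic hζ c _ z).continuousAt (Nu_ne hζ c _ z)).congr ?_
    filter_upwards [hA.mem_nhds hz.2] with w hw
    exact (stereo_eq hζ (φ k) A w hw).symm
  have fin : ∀ (x : ℕ → ℝ) (a : Sp), (∀ k : ℕ, x k ∈ Icc (((k:ℝ) + 1) * t₀)
      (((k:ℝ) + 1) * t₀ + Real.pi / √(((k:ℝ) + 1) * t₀))) →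
      (∀ k, S (Nu ζ c k (((x k / (k + 1) : ℝ) : ℂ) * (η * c)))
        (De ζ c k (((x k / (k + 1) : ℝ) : ℂ) * (η * c))) = a) → a = stereo (g z₀) := by
    intro x a hx hxa
    have ht := (tendsto_pts t₀ ht₀ x hx (η * c)).comp hφ.tendsto_atTop
    rw [← hzt] at ht
    refine no_conv _ g (U ∩ A) hV z₀ hzV hg hcont _ ht a ?_
    filter_upwards [ht.eventually (hA.mem_nhds hz₀.1)] with k hk
    rw [stereo_eq hζ (φ k) A _ hk]
    exact hxa (φ k)
  apply hab
  rw [fin x a hx (fun k => (hval k (x k)).1 (hxY k)),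
    fin y b hy (fun k => (hval k (y k)).2 (hyB k))]

lemma setup (θ₀ θ₁ θ₂ : ℝ)
    (hd01 : Ray θ₀ ≠ Ray θ₁) (hd02 : Ray θ₀ ≠ Ray θ₂) (hd12 : Ray θ₁ ≠ Ray θ₂)
    (hes : EquallySpaced (Ray θ₀) (Ray θ₁) (Ray θ₂)) :
    ∃ ζ c : ℂ, ζ ^ 2 + ζ + 1 = 0 ∧ c ≠ 0 ∧
      (∀ z, z ∈ Ray θ₀ ↔ ∃ t : ℝ, 0 < t ∧ z = (t:ℂ) * (ζ ^ 2 * c)) ∧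
      (∀ z, z ∈ Ray θ₁ ↔ ∃ t : ℝ, 0 < t ∧ z = (t:ℂ) * (ζ * c)) ∧
      (∀ z, z ∈ Ray θ₂ ↔ ∃ t : ℝ, 0 < t ∧ z = (t:ℂ) * (1 * c)) := by
  obtain ⟨θ, h⟩ := hes
  set ω : ℂ := Complex.exp (2 * Real.pi / 3 * I) with hω
  have hprim : IsPrimitiveRoot ω 3 := by
    have := Complex.isPrimitiveRoot_exp 3 (by norm_num)
    convert this using 2
    push_cast; ring
  have hω3 : ω ^ 3 = 1 := hprim.pow_eq_one
  have hω1 : ω ^ 2 + ω + 1 = 0 := by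
    have h1 : ω ≠ 1 := hprim.ne_one (by norm_num)
    have : (ω - 1) * (ω ^ 2 + ω + 1) = 0 := by linear_combination hω3
    exact (mul_eq_zero.1 this).resolve_left (sub_ne_zero.2 h1)
  have hω2 := zeta_sq hω1
  have hω0 := zeta_ne hω1
  set e : ℂ := Complex.exp (θ * I) with he
  have he0 : e ≠ 0 := Complex.exp_ne_zero _
  have r0 : ∀ z, z ∈ Ray θ ↔ ∃ t : ℝ, 0 < t ∧ z = (t:ℂ) * e := fun z => Iff.rfl
  have r1 : ∀ z, z ∈ Ray (θ + 2 * Real.pi / 3) ↔ ∃ t : ℝ, 0 < t ∧ z = (t:ℂ) * (ω * e) := by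
    intro z
    have : ω * e = Complex.exp (((θ + 2 * Real.pi / 3 : ℝ) : ℂ) * I) := by
      rw [hω, he, ← Complex.exp_add]; congr 1; push_cast; ring
    rw [this]; rfl
  have r2 : ∀ z, z ∈ Ray (θ + 4 * Real.pi / 3) ↔ ∃ t : ℝ, 0 < t ∧ z = (t:ℂ) * (ω ^ 2 * e) := by
    intro z
    have : ω ^ 2 * e = Complex.exp (((θ + 4 * Real.pi / 3 : ℝ) : ℂ) * I) := by
      rw [hω, he, ← Complex.exp_nat_mul, ← Complex.exp_add]; congr 1; push_cast; ring
    rw [this]; rfl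
  have m0 : Ray θ₀ ∈ ({Ray θ, Ray (θ + 2 * Real.pi / 3), Ray (θ + 4 * Real.pi / 3)} : Set (Set ℂ)) := by
    rw [← h]; simp
  have m1 : Ray θ₁ ∈ ({Ray θ, Ray (θ + 2 * Real.pi / 3), Ray (θ + 4 * Real.pi / 3)} : Set (Set ℂ)) := by
    rw [← h]; simp
  have m2 : Ray θ₂ ∈ ({Ray θ, Ray (θ + 2 * Real.pi / 3), Ray (θ + 4 * Real.pi / 3)} : Set (Set ℂ)) := by
    rw [← h]; simp
  simp only [mem_insert_iff, mem_singleton_iff] at m0 m1 m2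
  have p1 : ω * (ω ^ 2 * e) = e := by linear_combination e * hω3
  have p2 : ω ^ 2 * (ω * e) = e := by linear_combination e * hω3
  have p3 : ω ^ 2 * (ω ^ 2 * e) = ω * e := by linear_combination ω * e * hω3
  have p4 : (ω ^ 2) ^ 2 = ω := by linear_combination ω * hω3
  have p5 : ω * (ω * e) = ω ^ 2 * e := by ring
  rcases m0 with a | a | a <;> rcases m1 with b | b | b <;> rcases m2 with d | d | d <;>
    first
    | exact absurd (a.trans b.symm) hd01
    | exact absurd (a.trans d.symm) hd02
    | exact absurd (b.trans d.symm) hd12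
    | (rw [a, b, d]
       first
       | (refine ⟨ω, e, hω1, he0, ?_, ?_, ?_⟩ <;> (try simp only [one_mul, p1, p2, p3, p4, p5]) <;> assumption)
       | (refine ⟨ω, ω * e, hω1, mul_ne_zero hω0 he0, ?_, ?_, ?_⟩ <;>
            (try simp only [one_mul, p1, p2, p3, p4, p5]) <;> assumption)
       | (refine ⟨ω, ω ^ 2 * e, hω1, mul_ne_zero (pow_ne_zero 2 hω0) he0, ?_, ?_, ?_⟩ <;>
            (try simp only [one_mul, p1, p2, p3, p4, p5]) <;> assumption)
       | (refine ⟨ω ^ 2, e, hω2, he0, ?_, ?_, ?_⟩ <;>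
            (try simp only [one_mul, p1, p2, p3, p4, p5]) <;> assumption)
       | (refine ⟨ω ^ 2, ω * e, hω2, mul_ne_zero hω0 he0, ?_, ?_, ?_⟩ <;>
            (try simp only [one_mul, p1, p2, p3, p4, p5]) <;> assumption)
       | (refine ⟨ω ^ 2, ω ^ 2 * e, hω2, mul_ne_zero (pow_ne_zero 2 hω0) he0, ?_, ?_, ?_⟩ <;>
            (try simp only [one_mul, p1, p2, p3, p4, p5]) <;> assumption))

end AiryRays

/-- **Theorem 1 (non-normality direction).** If the three distinct rays are equally spaced,
then the family of all functions meromorphic in the annulus `A = {r < |z| < R}` with all zeros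
on `L₀`, all `1`-points on `L₁` and all poles on `L₂` is not normal in `A`; in fact it fails
to be normal at every point of `A ∩ (L₀ ∪ L₁ ∪ L₂)`. -/
theorem not_normal_family_three_rays_equally_spaced
    (θ₀ θ₁ θ₂ : ℝ)
    (hd01 : Ray θ₀ ≠ Ray θ₁) (hd02 : Ray θ₀ ≠ Ray θ₂) (hd12 : Ray θ₁ ≠ Ray θ₂)
    (hes : EquallySpaced (Ray θ₀) (Ray θ₁) (Ray θ₂))
    (r : ℝ) (R : EReal) (hr : 0 ≤ r) (hrR : (r : EReal) < R)
    (A : Set ℂ) (hA : A = {z : ℂ | r < ‖z‖ ∧ ((‖z‖ : ℝ) : EReal) < R})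
    (mem : (ℂ → ℂ) → Set ℂ → Prop)
    (hmem : mem = fun f P => MeromOn f P A ∧
      (∀ z ∈ A, z ∉ P → f z = 0 → z ∈ Ray θ₀) ∧
      (∀ z ∈ A, z ∉ P → f z = 1 → z ∈ Ray θ₁) ∧
      P ⊆ Ray θ₂) :
    ¬ NormalOn mem A ∧
      ∀ z₀ ∈ A ∩ (Ray θ₀ ∪ Ray θ₁ ∪ Ray θ₂), ∀ U : Set ℂ, IsOpen U → z₀ ∈ U →
        ¬ NormalOn mem (U ∩ A) := by
  obtain ⟨ζ, c, hζ, hc, h0, h1, h2⟩ := AiryRays.setup θ₀ θ₁ θ₂ hd01 hd02 hd12 hes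
  have hopen : IsOpen A := by
    rw [hA]
    refine IsOpen.inter (isOpen_lt continuous_const continuous_norm) ?_
    exact isOpen_lt (continuous_coe_real_ereal.comp continuous_norm) continuous_const
  have main : ∀ z₀ ∈ A ∩ (Ray θ₀ ∪ Ray θ₁ ∪ Ray θ₂), ∀ U : Set ℂ, IsOpen U → z₀ ∈ U →
        ¬ NormalOn mem (U ∩ A) := by
    intro z₀ hz₀ U hU hzU
    rw [hmem]
    exact AiryRays.core hζ hc A _ _ _ hopen h0 h1 h2 z₀ hz₀ U hU hzU
  refine ⟨?_, main⟩
  obtain ⟨t, ht1, ht2⟩ := EReal.lt_iff_exists_real_btwn.1 hrR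
  have ht1' : r < t := EReal.coe_lt_coe_iff.1 ht1
  have htpos : 0 < t := lt_of_le_of_lt hr ht1'
  set z₀ : ℂ := (t : ℂ) * Complex.exp ((θ₀ : ℂ) * Complex.I) with hz
  have hn : ‖z₀‖ = t := by
    rw [hz, norm_mul, Complex.norm_exp_ofReal_mul_I, mul_one, Complex.norm_real,
      Real.norm_of_nonneg htpos.le]
  have hzA : z₀ ∈ A := by
    rw [hA]
    change r < ‖z₀‖ ∧ ((‖z₀‖ : ℝ) : EReal) < R
    rw [hn]; exact ⟨ht1', ht2⟩
  have := main z₀ ⟨hzA, Or.inl (Or.inl ⟨t, htpos, hz⟩)⟩ univ isOpen_univ (mem_univ _)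
  rwa [univ_inter] at this
end
end

section
/- Let D ⊂ ℂ be a domain, let L ⊂ ℂ be a straight line, let ξ ∈ D \ L and let K ⊂ D be compact. Then there exists C > 0 such that for every holomorphic function f : D → ℂ with |f(ξ)| > 2, with no zeros in D, and all of whose 1-points lie on L, one has log|f(z)| ≤ C log|f(ξ)| for all z ∈ K. -/
open Complex Filter Set Topology


lemma aux_exists_log {f : ℂ → ℂ} {c : ℂ} {r : ℝ} (hr : 0 < r)
    (hf : DifferentiableOn ℂ f (Metric.ball c r)) (h0 : ∀ z ∈ Metric.ball c r, f z ≠ 0) :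
    ∃ h : ℂ → ℂ, DifferentiableOn ℂ h (Metric.ball c r) ∧
      ∀ z ∈ Metric.ball c r, exp (h z) = f z := by
  have hd : DifferentiableOn ℂ (fun z => deriv f z / f z) (Metric.ball c r) :=
    (hf.deriv Metric.isOpen_ball).div hf h0
  obtain ⟨h, hh⟩ := hd.isExactOn_ball.with_val_at c (log (f c))
  obtain ⟨hc, hh⟩ := hh
  have hhd : DifferentiableOn ℂ h (Metric.ball c r) := fun z hz =>
    (hh z hz).differentiableAt.differentiableWithinAt
  refine ⟨h, hhd, ?_⟩
  have hcm : c ∈ Metric.ball c r := Metric.mem_ball_self hr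
  have hconst : ∀ z ∈ Metric.ball c r, f z * exp (-h z) = f c * exp (-h c) := by
    intro z hz
    refine (convex_ball c r).is_const_of_fderivWithin_eq_zero (𝕜 := ℂ)
      (f := fun z => f z * exp (-h z)) ?_ ?_ hz hcm
    · exact hf.mul (hhd.neg.cexp)
    · intro w hw
      have h1 : HasDerivAt f (deriv f w) w :=
        (hf.differentiableAt (Metric.isOpen_ball.mem_nhds hw)).hasDerivAt
      have h2 := h1.mul ((hh w hw).neg.cexp)
      have h3 : HasDerivAt (fun z => f z * exp (-h z)) 0 w := by
        refine h2.congr_deriv ?_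
        have := h0 w hw
        simp only [Pi.neg_apply]
        field_simp
        ring
      rw [fderivWithin_of_isOpen Metric.isOpen_ball hw]
      ext
      simp [h3.hasFDerivAt.fderiv]
  intro z hz
  have := hconst z hz
  rw [hc, exp_neg, exp_neg, exp_log (h0 c hcm), mul_inv_cancel₀ (h0 c hcm)] at this
  have h3 := exp_ne_zero (h z)
  field_simp at this
  exact this.symm

lemma aux_bloch {g : ℂ → ℂ} {c : ℂ} {ρ : ℝ} (hρ : 0 < ρ)
    (hg : DifferentiableOn ℂ g (Metric.ball c ρ))
    (hom : ∀ w : ℂ, ∃ v ∈ Metric.ball w 2, ∀ z ∈ Metric.ball c ρ, g z ≠ v) :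
    ρ * ‖deriv g c‖ ≤ 192 := by
  by_cases hz0 : deriv g c = 0
  · simp [hz0]
  have hpos : 0 < ‖deriv g c‖ := norm_pos_iff.mpr hz0
  have hg' := hg.deriv Metric.isOpen_ball
  have hsub : Metric.closedBall c (ρ/2) ⊆ Metric.ball c ρ :=
    Metric.closedBall_subset_ball (by linarith)
  have hcont : ContinuousOn (fun z => (ρ/2 - dist z c) * ‖deriv g z‖) (Metric.closedBall c (ρ/2)) := by
    refine ContinuousOn.mul (by fun_prop) (hg'.continuousOn.mono hsub).norm
  have hcm : c ∈ Metric.closedBall c (ρ/2) := Metric.mem_closedBall_self (by linarith)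
  obtain ⟨a, ha, hmax⟩ := (isCompact_closedBall c (ρ/2)).exists_isMaxOn ⟨c, hcm⟩ hcont
  have hmax' : ∀ z ∈ Metric.closedBall c (ρ/2),
      (ρ/2 - dist z c) * ‖deriv g z‖ ≤ (ρ/2 - dist a c) * ‖deriv g a‖ := fun z hz => hmax hz
  have hac : dist a c ≤ ρ/2 := ha
  have h1 := hmax' c hcm
  simp only [dist_self, sub_zero] at h1
  have h2 : 0 < (ρ/2 - dist a c) * ‖deriv g a‖ := lt_of_lt_of_le (by positivity) h1
  set μ := ‖deriv g a‖ with hμ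
  have hμ0 : 0 ≤ μ := norm_nonneg _
  obtain ⟨r, hr⟩ : ∃ r, r = (ρ/2 - dist a c)/2 := ⟨_, rfl⟩
  have hrpos : 0 < r := by
    rcases lt_or_eq_of_le hac with h | h
    · rw [hr]; linarith
    · rw [h] at h2; simp at h2
  have hμpos : 0 < μ := by
    rcases lt_or_eq_of_le hμ0 with h | h
    · exact h
    · rw [← h] at h2; simp at h2
  have hin : Metric.ball a r ⊆ Metric.closedBall c (ρ/2) := by
    intro z hz
    rw [Metric.mem_ball] at hz
    rw [Metric.mem_closedBall]
    have := dist_triangle z a c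
    linarith
  have hb : ∀ z ∈ Metric.ball a r, ‖deriv g z‖ ≤ 2 * μ := by
    intro z hz
    have h3 := hmax' z (hin hz)
    rw [Metric.mem_ball] at hz
    have h4 := dist_triangle z a c
    have h5 : r * ‖deriv g z‖ ≤ (ρ/2 - dist z c) * ‖deriv g z‖ := by
      gcongr
      linarith
    have h6 : r * ‖deriv g z‖ ≤ r * (2 * μ) := by
      calc _ ≤ _ := h5.trans h3
        _ = _ := by rw [hr]; ring
    exact le_of_mul_le_mul_left h6 hrpos
  have hsch : ∀ z ∈ Metric.ball a r, dist (deriv g z) (deriv g a) ≤ 3 * μ / r * dist z a := by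
    intro z hz
    refine Complex.dist_le_div_mul_dist_of_mapsTo_ball (hg'.mono (hin.trans hsub)) ?_ hz
    intro w hw
    rw [Metric.mem_closedBall, dist_eq_norm]
    calc _ ≤ ‖deriv g w‖ + ‖deriv g a‖ := norm_sub_le _ _
      _ ≤ 3 * μ := by have := hb w hw; linarith
  have hsub6 : Metric.closedBall a (r/6) ⊆ Metric.ball a r :=
    Metric.closedBall_subset_ball (by linarith)
  have hdiff : ∀ z ∈ Metric.closedBall a (r/6), DifferentiableAt ℂ g z := fun z hz =>
    hg.differentiableAt (Metric.isOpen_ball.mem_nhds (hsub (hin (hsub6 hz))))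
  have hmv : ∀ z ∈ Metric.closedBall a (r/6),
      ‖(g z - deriv g a * z) - (g a - deriv g a * a)‖ ≤ μ/2 * ‖z - a‖ := by
    intro z hz
    refine (convex_closedBall a (r/6)).norm_image_sub_le_of_norm_hasDerivWithin_le
      (f := fun z => g z - deriv g a * z) (f' := fun z => deriv g z - deriv g a) ?_ ?_
      (Metric.mem_closedBall_self (by linarith)) hz
    · intro w hw
      have h3 := (hdiff w hw).hasDerivAt.sub ((hasDerivAt_id w).const_mul (deriv g a))
      have h4 : HasDerivAt (fun z => g z - deriv g a * z) (deriv g w - deriv g a) w :=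
        h3.congr_deriv (by simp)
      exact h4.hasDerivWithinAt
    · intro w hw
      have h3 := hsch w (hsub6 hw)
      rw [Metric.mem_closedBall] at hw
      rw [← dist_eq_norm]
      calc _ ≤ _ := h3
        _ ≤ 3 * μ / r * (r/6) := by gcongr
        _ = μ/2 := by field_simp; norm_num
  have hsph : ∀ z ∈ Metric.sphere a (r/6), μ * r / 12 ≤ ‖g z - g a‖ := by
    intro z hz
    have h3 := hmv z (Metric.sphere_subset_closedBall hz)
    rw [Metric.mem_sphere, dist_eq_norm] at hz
    have h4 : ‖deriv g a * (z - a)‖ = μ * (r/6) := by rw [norm_mul, hz]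
    have h5 : deriv g a * (z - a) = (g z - g a) - ((g z - deriv g a * z) - (g a - deriv g a * a)) := by
      ring
    have h6 := norm_sub_le (g z - g a) ((g z - deriv g a * z) - (g a - deriv g a * a))
    rw [← h5, h4] at h6
    rw [hz] at h3
    linarith
  have hball : Metric.ball (g a) (μ * r / 12 / 2) ⊆ g '' Metric.closedBall a (r/6) := by
    refine DiffContOnCl.ball_subset_image_closedBall ?_ (by linarith) hsph ?_
    · refine DifferentiableOn.diffContOnCl ?_
      rw [closure_ball a (by linarith)]
      exact fun z hz => (hdiff z hz).differentiableWithinAt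
    · have hda : HasDerivAt g (deriv g a) a :=
        (hdiff a (Metric.mem_closedBall_self (by linarith))).hasDerivAt
      have := hda.eventually_ne (c := g a) (norm_pos_iff.mp hμpos)
      exact this.frequently.filter_mono nhdsWithin_le_nhds
  obtain ⟨v, hv, hvn⟩ := hom (g a)
  have hlt : μ * r / 12 / 2 < 2 := by
    by_contra! hge
    obtain ⟨z, hz, hzv⟩ := hball (Metric.ball_subset_ball hge hv)
    exact hvn z (hsub (hin (hsub6 hz))) hzv
  have h7 : (ρ/2 - dist a c) * μ = 2 * (μ * r) := by rw [hr]; ring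
  rw [h7] at h1
  linarith

lemma aux_net (w : ℂ) : ∃ v ∈ Metric.ball w 2, ∃ n : ℤ, cosh v ^ 2 = n := by
  -- real part
  have key : ∀ t : ℝ, 0 ≤ t → ∃ s ∈ Icc t (t+1), ∃ n : ℤ, Real.cosh s ^ 2 = n := by
    intro t ht
    have hinc : Real.cosh t ^ 2 + 1 ≤ Real.cosh (t+1) ^ 2 := by
      have e1 := Real.cosh_add t 1
      have e2 := Real.cosh_sq t
      have e3 := Real.cosh_sq 1
      have e4 : 1 ≤ Real.sinh 1 := Real.self_le_sinh_iff.mpr (by norm_num)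
      have e5 : 0 ≤ Real.sinh t := Real.sinh_nonneg_iff.mpr ht
      have e6 := Real.one_le_cosh t
      have e7 := Real.one_le_cosh 1
      rw [e1]
      have : Real.cosh t * Real.cosh 1 ≤ Real.cosh t * Real.cosh 1 + Real.sinh t * Real.sinh 1 := by
        have : 0 ≤ Real.sinh t * Real.sinh 1 := by positivity
        linarith
      have h8 : (Real.cosh t * Real.cosh 1)^2 ≤ (Real.cosh t * Real.cosh 1 + Real.sinh t * Real.sinh 1)^2 := by
        gcongr
      have h9 : (Real.cosh t * Real.cosh 1)^2 = Real.cosh t^2 * (Real.sinh 1 ^2 + 1) := by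
        rw [mul_pow, e3]
      have h10 : 1 ≤ Real.cosh t ^2 := by nlinarith
      have h11 : 1 ≤ Real.sinh 1 ^2 := by nlinarith
      nlinarith
    have hivt := intermediate_value_Icc (f := fun s => Real.cosh s ^ 2) (by linarith : t ≤ t+1)
      ((Real.continuous_cosh.pow 2).continuousOn)
    obtain ⟨s, hs, hs2⟩ := hivt (show ((⌈Real.cosh t ^ 2⌉ : ℤ) : ℝ) ∈ _ from
      ⟨Int.le_ceil _, by have := (Int.ceil_lt_add_one (Real.cosh t ^ 2)).le; linarith⟩)
    exact ⟨s, hs, _, hs2⟩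
  have key2 : ∀ t : ℝ, ∃ s : ℝ, |s - t| ≤ 1 ∧ ∃ n : ℤ, Real.cosh s ^ 2 = n := by
    intro t
    rcases le_total 0 t with h | h
    · obtain ⟨s, hs, hn⟩ := key t h
      exact ⟨s, abs_le.mpr ⟨by linarith [hs.1], by linarith [hs.2]⟩, hn⟩
    · obtain ⟨s, hs, hn⟩ := key (-t) (by linarith)
      exact ⟨-s, abs_le.mpr ⟨by linarith [hs.2], by linarith [hs.1]⟩, by simpa using hn⟩
  obtain ⟨s, hs, n, hn⟩ := key2 w.re
  obtain ⟨k, hk⟩ : ∃ k : ℤ, |(k:ℝ) * (Real.pi/2) - w.im| ≤ Real.pi / 4 := by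
    refine ⟨round (w.im / (Real.pi/2)), ?_⟩
    have h1 := abs_sub_round (w.im / (Real.pi/2))
    have hpi := Real.pi_pos
    have h2 : (round (w.im / (Real.pi/2)) : ℝ) * (Real.pi/2) - w.im =
      -((w.im / (Real.pi/2) - round (w.im / (Real.pi/2))) * (Real.pi/2)) := by field_simp; ring
    rw [h2, abs_neg, abs_mul, abs_of_pos (by positivity : 0 < Real.pi/2)]
    nlinarith
  refine ⟨(s : ℂ) + ((k:ℝ) * (Real.pi/2) : ℝ) * I, ?_, ?_⟩
  · rw [Metric.mem_ball, dist_eq_norm]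
    refine lt_of_le_of_lt (norm_le_abs_re_add_abs_im _) ?_
    simp only [sub_re, add_re, ofReal_re, mul_re, I_re, mul_zero, ofReal_im, I_im, mul_one,
      sub_self, add_zero, sub_im, add_im, mul_im, zero_add]
    have := Real.pi_lt_four
    linarith
  · rw [cosh_add, cosh_mul_I, sinh_mul_I]
    have hc2 : cosh (s:ℂ) ^ 2 = n := by exact_mod_cast congrArg (fun x : ℝ => (x:ℂ)) hn
    have hs2 : sinh (s:ℂ) ^ 2 = n - 1 := by rw [sinh_sq, hc2]
    have hsc : sin (((k:ℝ) * (Real.pi/2) : ℝ) : ℂ) * cos (((k:ℝ) * (Real.pi/2) : ℝ) : ℂ) = 0 := by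
      have h1 : sin (2 * (((k:ℝ) * (Real.pi/2) : ℝ) : ℂ)) = 0 := by
        rw [show 2 * (((k:ℝ) * (Real.pi/2) : ℝ) : ℂ) = k * (Real.pi : ℂ) by push_cast; ring]
        exact sin_int_mul_pi k
      rw [sin_two_mul] at h1
      have := mul_eq_zero.mp h1
      rcases this with h | h
      · rw [(mul_eq_zero.mp h).resolve_left two_ne_zero, zero_mul]
      · rw [h, mul_zero]
    have h1 := sin_sq_add_cos_sq (((k:ℝ) * (Real.pi/2) : ℝ) : ℂ)
    generalize sin (((k:ℝ) * (Real.pi/2) : ℝ) : ℂ) = S at *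
    generalize cos (((k:ℝ) * (Real.pi/2) : ℝ) : ℂ) = T at *
    rcases mul_eq_zero.mp hsc with h | h
    · refine ⟨n, ?_⟩
      rw [h] at h1 ⊢
      have : T^2 = 1 := by linear_combination h1
      linear_combination T^2 * hc2 + n * this
    · refine ⟨1 - n, ?_⟩
      rw [h] at h1 ⊢
      have : S^2 = 1 := by linear_combination h1
      push_cast
      have hI : Complex.I^2 = -1 := I_sq
      linear_combination S^2*Complex.I^2 * hs2 + ((n:ℂ)-1)*S^2 * hI - ((n:ℂ)-1) * this

lemma aux_landau {h : ℂ → ℂ} {c : ℂ} {ρ : ℝ} (hρ : 0 < ρ)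
    (hh : DifferentiableOn ℂ h (Metric.ball c ρ))
    (hom : ∀ z ∈ Metric.ball c ρ, ∀ n : ℤ, h z ≠ n * (2 * Real.pi * I)) :
    ρ * ‖deriv h c‖ ≤ 1536 * (1 + ‖h c‖) := by
  have hp : (2 * Real.pi * I : ℂ) ≠ 0 := two_pi_I_ne_zero
  set F : ℂ → ℂ := fun z => h z / (2 * Real.pi * I) with hF
  have hFd : DifferentiableOn ℂ F (Metric.ball c ρ) := hh.div_const _
  have hFn : ∀ z ∈ Metric.ball c ρ, ∀ n : ℤ, F z ≠ n := by
    intro z hz n hn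
    apply hom z hz n
    rw [← hn, hF]
    field_simp
  obtain ⟨a, had, ha⟩ := aux_exists_log hρ hFd (fun z hz => by simpa using hFn z hz 0)
  obtain ⟨b, hbd, hb⟩ := aux_exists_log hρ (hFd.sub_const 1)
    (fun z hz => sub_ne_zero.mpr (by simpa using hFn z hz 1))
  set A : ℂ → ℂ := fun z => exp (a z / 2)
  set B : ℂ → ℂ := fun z => exp (b z / 2)
  have hA : ∀ z ∈ Metric.ball c ρ, A z ^ 2 = F z := by
    intro z hz
    rw [← ha z hz, ← exp_nat_mul]; congr 1; push_cast; ring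
  have hB : ∀ z ∈ Metric.ball c ρ, B z ^ 2 = F z - 1 := by
    intro z hz
    rw [← hb z hz, ← exp_nat_mul]; congr 1; push_cast; ring
  have hAd : DifferentiableOn ℂ A (Metric.ball c ρ) := (had.div_const 2).cexp
  have hBd : DifferentiableOn ℂ B (Metric.ball c ρ) := (hbd.div_const 2).cexp
  have hprod : ∀ z ∈ Metric.ball c ρ, (A z + B z) * (A z - B z) = 1 := by
    intro z hz
    linear_combination hA z hz - hB z hz
  obtain ⟨g, hgd, hg⟩ := aux_exists_log hρ (hAd.add hBd)
    (fun z hz => by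
      intro h0
      have := hprod z hz
      simp only [Pi.add_apply] at h0
      rw [h0] at this
      simp at this)
  have hcosh : ∀ z ∈ Metric.ball c ρ, cosh (g z) = A z := by
    intro z hz
    have h1 := hg z hz
    simp only [Pi.add_apply] at h1
    have h2 : exp (-g z) = A z - B z := by
      rw [exp_neg, h1]
      exact (eq_inv_of_mul_eq_one_right (hprod z hz)).symm
    rw [cosh, h1, h2]; ring
  have hFg : ∀ z ∈ Metric.ball c ρ, cosh (g z) ^ 2 = F z := by
    intro z hz; rw [hcosh z hz, hA z hz]
  have hbl := aux_bloch hρ hgd (fun w => by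
    obtain ⟨v, hv, n, hn⟩ := aux_net w
    refine ⟨v, hv, fun z hz hgz => hFn z hz n ?_⟩
    rw [← hFg z hz, hgz, hn])
  have hcm : c ∈ Metric.ball c ρ := Metric.mem_ball_self hρ
  have hnh := Metric.isOpen_ball.mem_nhds hcm
  have hgc : HasDerivAt g (deriv g c) c := (hgd.differentiableAt hnh).hasDerivAt
  have hd : HasDerivAt h (2 * cosh (g c) * (sinh (g c) * deriv g c) * (2 * Real.pi * I)) c := by
    have h1 : HasDerivAt (fun z => cosh (g z) ^ 2 * (2 * Real.pi * I))
        (2 * cosh (g c) * (sinh (g c) * deriv g c) * (2 * Real.pi * I)) c := by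
      have := ((hgc.ccosh).pow 2).mul_const (2 * Real.pi * I : ℂ)
      simpa using this
    refine h1.congr_of_eventuallyEq ?_
    filter_upwards [hnh] with z hz
    rw [hFg z hz, hF]
    field_simp
  rw [hd.deriv]
  have hc1 : ‖cosh (g c)‖ ^ 2 = ‖F c‖ := by rw [← norm_pow, hFg c hcm]
  have hs1 : ‖sinh (g c)‖ ^ 2 ≤ ‖F c‖ + 1 := by
    rw [← norm_pow, sinh_sq, hFg c hcm]
    simpa using norm_sub_le (F c) 1
  have hFc : ‖F c‖ * (2 * Real.pi) = ‖h c‖ := by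
    have : F c * (2 * Real.pi * I) = h c := by rw [hF]; field_simp
    rw [← this]; simp [abs_of_pos Real.pi_pos]
  have hn : ‖(2 * Real.pi * I : ℂ)‖ = 2 * Real.pi := by simp [abs_of_pos Real.pi_pos]
  rw [norm_mul, norm_mul, norm_mul, norm_mul, hn]
  have h2 : ‖(2:ℂ)‖ = 2 := by simp
  rw [h2]
  have hpi := Real.pi_pos
  have hpi4 := Real.pi_lt_four
  have hX : 2 * ‖cosh (g c)‖ * ‖sinh (g c)‖ ≤ 2 * ‖F c‖ + 1 := by
    nlinarith [sq_nonneg (‖cosh (g c)‖ - ‖sinh (g c)‖)]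
  calc _ = (2 * ‖cosh (g c)‖ * ‖sinh (g c)‖) * (ρ * ‖deriv g c‖) * (2 * Real.pi) := by ring
    _ ≤ (2 * ‖F c‖ + 1) * 192 * (2 * Real.pi) := by gcongr
    _ = 384 * (‖F c‖ * (2 * Real.pi)) + 384 * Real.pi := by ring
    _ ≤ 1536 * (1 + ‖h c‖) := by rw [hFc]; nlinarith [norm_nonneg (h c)]

lemma aux_gronwall {u u' : ℝ → ℂ} {K T : ℝ} (hK : 0 < K) (hT : 0 ≤ T)
    (hu : ∀ t ∈ Icc 0 T, HasDerivAt u (u' t) t)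
    (hb : ∀ t ∈ Icc 0 T, ‖u' t‖ ≤ K * (1 + ‖u t‖)) :
    1 + ‖u T‖ ≤ (1 + ‖u 0‖) * Real.exp (K * T) := by
  have := norm_le_gronwallBound_of_norm_deriv_right_le (f := u) (f' := u') (δ := ‖u 0‖) (K := K)
    (ε := K) (a := 0) (b := T) (fun t ht => (hu t ht).continuousAt.continuousWithinAt)
    (fun t ht => (hu t (Ico_subset_Icc_self ht)).hasDerivWithinAt) le_rfl
    (fun t ht => by have := hb t (Ico_subset_Icc_self ht); linarith) T ⟨hT, le_rfl⟩
  rw [gronwallBound_of_K_ne_0 hK.ne'] at this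
  simp only [sub_zero, div_self hK.ne'] at this
  linarith

lemma aux_seg {h : ℂ → ℂ} {p q : ℂ} {ρ : ℝ} (hρ : 0 < ρ)
    (hd : ∀ t ∈ Icc (0:ℝ) 1, DifferentiableOn ℂ h (Metric.ball (p + t * (q - p)) ρ))
    (hom : ∀ t ∈ Icc (0:ℝ) 1, ∀ z ∈ Metric.ball (p + t * (q - p)) ρ,
      ∀ n : ℤ, h z ≠ n * (2 * Real.pi * Complex.I)) :
    1 + ‖h q‖ ≤ (1 + ‖h p‖) * Real.exp (1536 / ρ * (‖q - p‖ + 1)) := by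
  have hder : ∀ t ∈ Icc (0:ℝ) 1, HasDerivAt (fun s : ℝ => h (p + s * (q - p)))
      (deriv h (p + t * (q - p)) * (q - p)) t := by
    intro t ht
    have h1 : HasDerivAt h (deriv h (p + t * (q - p))) (p + t * (q - p)) :=
      ((hd t ht).differentiableAt (Metric.ball_mem_nhds _ hρ)).hasDerivAt
    have h2 : HasDerivAt (fun s : ℝ => p + (s:ℂ) * (q - p)) (q - p) t := by
      have := ((hasDerivAt_id t).ofReal_comp.mul_const (q - p)).const_add p
      simpa using this
    exact h1.comp t h2
  have := aux_gronwall (u := fun s : ℝ => h (p + s * (q - p))) (K := 1536 / ρ * (‖q - p‖ + 1))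
    (T := 1) (by positivity) zero_le_one hder (by
      intro t ht
      have h1 := aux_landau hρ (hd t ht) (hom t ht)
      rw [norm_mul]
      have h2 : ‖deriv h (p + t * (q - p))‖ ≤ 1536 / ρ * (1 + ‖h (p + t * (q - p))‖) := by
        rw [div_mul_eq_mul_div, le_div_iff₀ hρ]; linarith
      calc _ ≤ 1536 / ρ * (1 + ‖h (p + t * (q - p))‖) * (‖q - p‖ + 1) := by gcongr; linarith
        _ = _ := by ring)
  simpa using this

/-- `h` is holomorphic on the ball of radius 4, taking values in `2πiℤ` only on the real axis. -/
def AuxSetup (h : ℂ → ℂ) : Prop :=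
  DifferentiableOn ℂ h (Metric.ball 0 4) ∧
  ∀ z ∈ Metric.ball (0:ℂ) 4, ∀ n : ℤ, h z = n * (2 * Real.pi * Complex.I) → z.im = 0

lemma AuxSetup.mono_ball {h : ℂ → ℂ} (hs : AuxSetup h) {c : ℂ} {ρ : ℝ} (h1 : ‖c‖ + ρ ≤ 4)
    (h2 : ρ ≤ c.im) : DifferentiableOn ℂ h (Metric.ball c ρ) ∧
      ∀ z ∈ Metric.ball c ρ, ∀ n : ℤ, h z ≠ n * (2 * Real.pi * Complex.I) := by
  have hsub : Metric.ball c ρ ⊆ Metric.ball 0 4 :=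
    Metric.ball_subset_ball' (by rw [dist_zero_right]; linarith)
  refine ⟨hs.1.mono hsub, fun z hz n hn => ?_⟩
  have h3 := hs.2 z (hsub hz) n hn
  rw [Metric.mem_ball, dist_eq_norm] at hz
  have h4 := (abs_im_le_norm (z - c)).trans_lt hz
  rw [sub_im, h3, zero_sub, abs_neg] at h4
  have := le_abs_self c.im
  linarith

lemma aux_up : ∃ E : ℝ, 0 < E ∧ ∃ N : ℕ, 0 < N ∧ ∀ h : ℂ → ℂ, AuxSetup h →
    ∀ z : ℂ, ‖z‖ ≤ 1 → 0 < z.im → z.im ^ N * (1 + ‖h z‖) ≤ E * (1 + ‖h Complex.I‖) ∧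
      z.im ^ N * ‖deriv h z‖ ≤ E * (1 + ‖h Complex.I‖) := by
  obtain ⟨A, hA⟩ : ∃ A : ℕ, A = 1536 := ⟨_, rfl⟩
  have hA1 : (1:ℝ) ≤ A := by rw [hA]; norm_num
  refine ⟨A * Real.exp (A * 2), by positivity, A + 1, by omega, fun h hs z hz hzi => ?_⟩
  have hz1 : z.im ≤ 1 := (le_abs_self _).trans ((abs_im_le_norm z).trans hz)
  have hzr : |z.re| ≤ 1 := (abs_re_le_norm z).trans hz
  have hpt : ∀ t : ℝ, 0 < t → t ≤ 1 → ∀ x : ℝ, |x| ≤ 1 →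
      ‖(x:ℂ) + t * Complex.I‖ + t ≤ 4 ∧ ((x:ℂ) + t * Complex.I).im = t := by
    intro t ht0 ht1 x hx
    constructor
    · have := norm_add_le (x:ℂ) (t * Complex.I)
      simp only [norm_mul, norm_I, mul_one, norm_real, Real.norm_eq_abs, abs_of_pos ht0] at this
      linarith
    · simp
  -- horizontal
  have hhor : 1 + ‖h (z.re + Complex.I)‖ ≤ (1 + ‖h Complex.I‖) * Real.exp (A * 2) := by
    have hb : ∀ t ∈ Icc (0:ℝ) 1, DifferentiableOn ℂ h
        (Metric.ball (Complex.I + t * ((z.re + Complex.I) - Complex.I)) 1) ∧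
      ∀ w ∈ Metric.ball (Complex.I + t * ((z.re + Complex.I) - Complex.I)) 1, ∀ n : ℤ,
        h w ≠ n * (2 * Real.pi * Complex.I) := by
      intro t ht
      have habs : |t * z.re| ≤ 1 := by
        rw [abs_mul, abs_of_nonneg ht.1]
        nlinarith [ht.1, ht.2, abs_nonneg z.re]
      have h1 := hpt 1 one_pos le_rfl (t * z.re) habs
      have h2 : Complex.I + t * ((z.re + Complex.I) - Complex.I) = ((t * z.re : ℝ) : ℂ) + (1:ℝ) * Complex.I := by
        push_cast; ring
      rw [h2]
      exact hs.mono_ball h1.1 h1.2.ge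
    have h1 := aux_seg one_pos (fun t ht => (hb t ht).1) (fun t ht => (hb t ht).2)
    refine h1.trans ?_
    gcongr
    · rw [hA]; norm_num
    · have : ‖(z.re:ℂ) + Complex.I - Complex.I‖ ≤ 1 := by simpa using hzr
      linarith
  -- vertical
  set T := -Real.log z.im with hT
  have hT0 : 0 ≤ T := by rw [hT]; linarith [Real.log_nonpos hzi.le hz1]
  have hver : 1 + ‖h z‖ ≤ (1 + ‖h (z.re + Complex.I)‖) * Real.exp (A * T) := by
    have hb : ∀ t ∈ Icc (0:ℝ) T, DifferentiableOn ℂ h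
        (Metric.ball ((z.re:ℂ) + (Real.exp (-t) : ℝ) * Complex.I) (Real.exp (-t))) ∧
      ∀ w ∈ Metric.ball ((z.re:ℂ) + (Real.exp (-t) : ℝ) * Complex.I) (Real.exp (-t)), ∀ n : ℤ,
        h w ≠ n * (2 * Real.pi * Complex.I) := by
      intro t ht
      have h1 := hpt (Real.exp (-t)) (Real.exp_pos _) (Real.exp_le_one_iff.mpr (by linarith [ht.1])) z.re hzr
      exact hs.mono_ball h1.1 h1.2.ge
    have h1 := aux_gronwall (u := fun t : ℝ => h ((z.re:ℂ) + (Real.exp (-t) : ℝ) * Complex.I))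
      (u' := fun t : ℝ => deriv h ((z.re:ℂ) + (Real.exp (-t) : ℝ) * Complex.I) *
        ((-Real.exp (-t) : ℝ) * Complex.I))
      (K := A) (T := T) (by linarith) hT0 (by
        intro t ht
        have h1 : HasDerivAt h (deriv h ((z.re:ℂ) + (Real.exp (-t) : ℝ) * Complex.I))
            ((z.re:ℂ) + (Real.exp (-t) : ℝ) * Complex.I) :=
          ((hb t ht).1.differentiableAt (Metric.ball_mem_nhds _ (Real.exp_pos _))).hasDerivAt
        have h3 : HasDerivAt (fun s : ℝ => Real.exp (-s)) (-Real.exp (-t)) t := by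
          simpa using (hasDerivAt_id t).neg.exp
        have h2 : HasDerivAt (fun s : ℝ => (z.re:ℂ) + (Real.exp (-s) : ℝ) * Complex.I)
            ((-Real.exp (-t) : ℝ) * Complex.I) t :=
          (h3.ofReal_comp.mul_const Complex.I).const_add _
        exact h1.comp t h2) (by
        intro t ht
        have h1 := aux_landau (Real.exp_pos _) (hb t ht).1 (hb t ht).2
        rw [norm_mul, norm_mul, norm_I, mul_one, norm_real, norm_neg, Real.norm_eq_abs,
          abs_of_pos (Real.exp_pos _), hA, mul_comm]
        exact_mod_cast h1)
    have e0 : ((z.re:ℂ) + (Real.exp (-T) : ℝ) * Complex.I) = z := by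
      rw [hT, neg_neg, Real.exp_log hzi, re_add_im]
    have e1 : ((z.re:ℂ) + (Real.exp (-0) : ℝ) * Complex.I) = z.re + Complex.I := by simp
    simp only [e0, e1] at h1
    exact h1
  have hexp : z.im ^ A * Real.exp (A * T) = 1 := by
    rw [Real.exp_nat_mul, hT, Real.exp_neg, Real.exp_log hzi, ← mul_pow, mul_inv_cancel₀ hzi.ne', one_pow]
  have hmain : z.im ^ A * (1 + ‖h z‖) ≤ Real.exp (A * 2) * (1 + ‖h Complex.I‖) := by
    calc z.im ^ A * (1 + ‖h z‖)
        ≤ z.im ^ A * ((1 + ‖h (z.re + Complex.I)‖) * Real.exp (A * T)) := by gcongr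
      _ = (z.im ^ A * Real.exp (A * T)) * (1 + ‖h (z.re + Complex.I)‖) := by ring
      _ = 1 + ‖h (z.re + Complex.I)‖ := by rw [hexp, one_mul]
      _ ≤ _ := by rw [mul_comm]; exact hhor
  have hnn : 0 ≤ z.im ^ A * (1 + ‖h z‖) := by positivity
  have hR : 0 < Real.exp (A * 2) * (1 + ‖h Complex.I‖) := by positivity
  constructor
  · calc z.im ^ (A+1) * (1 + ‖h z‖) = z.im * (z.im ^ A * (1 + ‖h z‖)) := by ring
      _ ≤ 1 * (z.im ^ A * (1 + ‖h z‖)) := by gcongr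
      _ ≤ 1 * (Real.exp (A * 2) * (1 + ‖h Complex.I‖)) := by gcongr
      _ ≤ A * (Real.exp (A * 2) * (1 + ‖h Complex.I‖)) := by gcongr
      _ = _ := by ring
  · have h1 := hpt z.im hzi hz1 z.re hzr
    rw [re_add_im] at h1
    have h2 := hs.mono_ball h1.1 le_rfl
    have h3 := aux_landau hzi h2.1 h2.2
    have h4 : z.im * ‖deriv h z‖ ≤ A * (1 + ‖h z‖) := by rw [hA]; exact_mod_cast h3
    calc z.im ^ (A+1) * ‖deriv h z‖ = z.im ^ A * (z.im * ‖deriv h z‖) := by ring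
      _ ≤ z.im ^ A * (A * (1 + ‖h z‖)) := by gcongr
      _ = A * (z.im ^ A * (1 + ‖h z‖)) := by ring
      _ ≤ A * (Real.exp (A * 2) * (1 + ‖h Complex.I‖)) := by gcongr
      _ = _ := by ring

lemma aux_branch (w : ℂ) : ∃ k : ℤ, ‖w + k * (2 * Real.pi * Complex.I)‖ ≤ |w.re| + Real.pi := by
  refine ⟨-round (w.im / (2 * Real.pi)), ?_⟩
  refine (norm_le_abs_re_add_abs_im _).trans ?_
  have hpi := Real.pi_pos
  have h1 := abs_sub_round (w.im / (2 * Real.pi))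
  have h2 : w.im - (round (w.im / (2 * Real.pi)) : ℝ) * (2 * Real.pi) =
    ((w.im / (2 * Real.pi) - round (w.im / (2 * Real.pi))) * (2 * Real.pi)) := by field_simp
  have h3 : |w.im - (round (w.im / (2 * Real.pi)) : ℝ) * (2 * Real.pi)| ≤ Real.pi := by
    rw [h2, abs_mul, abs_of_pos (by positivity : 0 < 2 * Real.pi)]
    nlinarith
  have h4 : (w + ((-round (w.im / (2 * Real.pi)) : ℤ) : ℂ) * (2 * Real.pi * Complex.I)).re = w.re := by
    simp
  have h5 : (w + ((-round (w.im / (2 * Real.pi)) : ℤ) : ℂ) * (2 * Real.pi * Complex.I)).im =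
      w.im - (round (w.im / (2 * Real.pi)) : ℝ) * (2 * Real.pi) := by
    simp; ring
  rw [h4, h5]
  linarith

lemma AuxSetup.shift {h : ℂ → ℂ} (hs : AuxSetup h) (k : ℤ) :
    AuxSetup (fun z => h z + k * (2 * Real.pi * Complex.I)) := by
  refine ⟨hs.1.add_const _, fun z hz n hn => hs.2 z hz (n - k) ?_⟩
  push_cast
  linear_combination hn

lemma AuxSetup.refl_neg {h : ℂ → ℂ} (hs : AuxSetup h) : AuxSetup (fun z => h (-z)) := by
  have hm : ∀ z ∈ Metric.ball (0:ℂ) 4, -z ∈ Metric.ball (0:ℂ) 4 := by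
    intro z hz; simpa using hz
  refine ⟨hs.1.comp differentiable_neg.differentiableOn hm, fun z hz n hn => ?_⟩
  simpa using hs.2 (-z) (hm z hz) n hn

/-- moving from a point of the upper half-plane up to `I`. -/
lemma aux_to_I (y : ℂ) (hy : ‖y‖ ≤ 1) (hyi : 0 < y.im) : ∃ E : ℝ, 0 < E ∧ ∀ h : ℂ → ℂ,
    AuxSetup h → 1 + ‖h Complex.I‖ ≤ E * (1 + ‖h y‖) := by
  refine ⟨Real.exp (1536 / y.im * (‖Complex.I - y‖ + 1)), Real.exp_pos _, fun h hs => ?_⟩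
  rw [mul_comm]
  have hy1 : y.im ≤ 1 := (le_abs_self _).trans ((abs_im_le_norm y).trans hy)
  have hb : ∀ t ∈ Icc (0:ℝ) 1, ‖y + t * (Complex.I - y)‖ + y.im ≤ 4 ∧
      y.im ≤ (y + t * (Complex.I - y)).im := by
    intro t ht
    constructor
    · have h1 : ‖y + t * (Complex.I - y)‖ ≤ ‖y‖ + ‖(t:ℂ)‖ * ‖Complex.I - y‖ := by
        rw [← norm_mul]; exact norm_add_le _ _
      have h2 : ‖(t:ℂ)‖ ≤ 1 := by
        rw [norm_real, Real.norm_eq_abs, abs_of_nonneg ht.1]; exact ht.2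
      have h3 : ‖Complex.I - y‖ ≤ 2 := by
        have := norm_sub_le Complex.I y
        rw [norm_I] at this; linarith
      nlinarith [norm_nonneg (Complex.I - y), norm_nonneg (t:ℂ)]
    · simp
      nlinarith [ht.1, ht.2]
  exact aux_seg hyi (fun t ht => (hs.mono_ball (hb t ht).1 (hb t ht).2).1)
    (fun t ht => (hs.mono_ball (hb t ht).1 (hb t ht).2).2)

lemma aux_struct : ∃ E : ℝ, 0 < E ∧ ∃ N : ℕ, 0 < N ∧ ∀ h : ℂ → ℂ, AuxSetup h →
    (∀ z : ℂ, ‖z‖ ≤ 1 → 0 < z.im → z.im ^ N * (1 + ‖h z‖) ≤ E * (1 + ‖h Complex.I‖) ∧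
      z.im ^ N * ‖deriv h z‖ ≤ E * (1 + ‖h Complex.I‖)) ∧
    ∃ M : ℝ, M ≤ E * (1 + ‖h (-(Complex.I / 20))‖) ∧
      ∀ z : ℂ, ‖z‖ ≤ 1 → |z.im| ^ N * ‖deriv h z‖ ≤ E * max (1 + ‖h Complex.I‖) M := by
  obtain ⟨E, hE, N, hN, hup⟩ := aux_up
  obtain ⟨E', hE', hto⟩ := aux_to_I (Complex.I / 20) (by simp; norm_num) (by simp)
  refine ⟨max E (E' * (1 + Real.pi)), lt_max_of_lt_left hE, N, hN, fun h hs => ⟨?_, ?_⟩⟩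
  · intro z hz hzi
    have h1 := hup h hs z hz hzi
    constructor
    · refine h1.1.trans ?_; gcongr; exact le_max_left _ _
    · refine h1.2.trans ?_; gcongr; exact le_max_left _ _
  obtain ⟨k, hk⟩ := aux_branch (h (-(Complex.I / 20)))
  have hs2 := (hs.shift k).refl_neg
  have h1 := hto _ hs2
  have h2 := hup _ hs2
  refine ⟨1 + ‖h (-Complex.I) + k * (2 * Real.pi * Complex.I)‖, ?_, ?_⟩
  · have hre := abs_re_le_norm (h (-(Complex.I / 20)))
    have hpi := Real.pi_pos
    calc _ ≤ _ := h1
      _ ≤ E' * (1 + (‖h (-(Complex.I / 20))‖ + Real.pi)) := by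
        gcongr; linarith
      _ ≤ E' * (1 + Real.pi) * (1 + ‖h (-(Complex.I / 20))‖) := by
        have : 0 ≤ E' * (Real.pi * ‖h (-(Complex.I / 20))‖) := by positivity
        nlinarith
      _ ≤ _ := by gcongr; exact le_max_right _ _
  · intro z hz
    rcases lt_trichotomy z.im 0 with hi | hi | hi
    · have h3 := (h2 (-z) (by simpa using hz) (by simpa using hi)).2
      have h4 : deriv (fun z => h (-z) + k * (2 * Real.pi * Complex.I)) (-z) = - deriv h z := by
        rw [deriv_add_const, deriv_comp_neg]; simp
      rw [h4, norm_neg, neg_im, ← abs_of_neg hi] at h3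
      refine h3.trans ?_
      gcongr
      · exact le_max_left _ _
      · exact le_max_right _ _
    · rw [hi, abs_zero, zero_pow hN.ne', zero_mul]
      have : 0 < max (1 + ‖h Complex.I‖) (1 + ‖h (-Complex.I) + k * (2 * Real.pi * Complex.I)‖) :=
        lt_max_of_lt_left (by positivity)
      have : 0 < max E (E' * (1 + Real.pi)) := lt_max_of_lt_left hE
      positivity
    · rw [abs_of_pos hi]
      refine (hup h hs z hz hi).2.trans ?_
      gcongr
      · exact le_max_left _ _
      · exact le_max_left _ _

lemma aux_three : ∃ θ : ℝ, 0 < θ ∧ θ < 1 ∧ ∀ (g : ℂ → ℂ) (p : ℂ) (a b : ℝ),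
    DifferentiableOn ℂ g (Metric.ball p 1) → 0 < a → a ≤ b →
    (∀ z, ‖z - p‖ ≤ 1/10 → ‖g z‖ ≤ a) → (∀ z, ‖z - p‖ ≤ 3/10 → ‖g z‖ ≤ b) →
    ∀ z, ‖z - p‖ ≤ 1/4 → ‖g z‖ ≤ a * (b / a) ^ θ := by
  set l := Real.log (1/10) with hl
  set u := Real.log (3/10) with hu
  set v := Real.log (1/4) with hv
  have hlv : l < v := Real.log_lt_log (by norm_num) (by norm_num)
  have hvu : v < u := Real.log_lt_log (by norm_num) (by norm_num)
  have hlu : 0 < u - l := by linarith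
  refine ⟨(v - l) / (u - l), div_pos (by linarith) hlu, (div_lt_one hlu).mpr (by linarith), ?_⟩
  intro g p a b hg ha hab h1 h2 z hz
  have hba : 1 ≤ b / a := (one_le_div ha).mpr hab
  rcases le_or_gt ‖z - p‖ (1/10) with hz1 | hz1
  · refine (h1 z hz1).trans ?_
    have := Real.one_le_rpow hba (div_pos (by linarith : 0 < v - l) hlu).le
    nlinarith
  have hzp : z - p ≠ 0 := by
    intro h0; rw [h0, norm_zero] at hz1; linarith
  set w := Complex.log (z - p) with hw
  have hexpw : p + exp w = z := by rw [hw, exp_log hzp]; ring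
  have hwre : w.re = Real.log ‖z - p‖ := log_re _
  have hwl : l ≤ w.re := by rw [hwre]; exact Real.log_le_log (by norm_num) hz1.le
  have hwv : w.re ≤ v := by rw [hwre]; exact Real.log_le_log (by linarith) hz
  have hn : ∀ s : ℂ, s.re ≤ u → ‖(p + exp s) - p‖ ≤ 3/10 := by
    intro s hs
    rw [add_sub_cancel_left, norm_exp]
    calc _ ≤ Real.exp u := Real.exp_le_exp.mpr hs
      _ = 3/10 := Real.exp_log (by norm_num)
  have hdiff : ∀ s : ℂ, s.re ≤ u → DifferentiableAt ℂ (fun s => g (p + exp s)) s := by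
    intro s hs
    have h3 : p + exp s ∈ Metric.ball p 1 := by
      rw [Metric.mem_ball, dist_eq_norm]; linarith [hn s hs]
    have h4 := hg.differentiableAt (Metric.isOpen_ball.mem_nhds h3)
    exact h4.comp s (by fun_prop)
  have hcl : closure (HadamardThreeLines.verticalStrip l u) ⊆ {s : ℂ | s.re ≤ u} := by
    refine closure_minimal ?_ (isClosed_le continuous_re continuous_const)
    intro s hs
    exact hs.2.le
  have key := HadamardThreeLines.norm_le_interp_of_mem_verticalClosedStrip'
    (f := fun s => g (p + exp s)) (z := w) (a := a) (b := b) (l := l) (u := u) (by linarith)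
    ⟨hwl, by linarith⟩
    (DifferentiableOn.diffContOnCl fun s hs => (hdiff s (hcl hs)).differentiableWithinAt)
    (by
      refine ⟨b, ?_⟩
      rintro _ ⟨s, hs, rfl⟩
      exact h2 _ (hn s hs.2))
    (by
      intro s hs
      have hs' : s.re = l := hs
      apply h1
      rw [add_sub_cancel_left, norm_exp, hs', hl, Real.exp_log (by norm_num)])
    (by
      intro s hs
      have hs' : s.re = u := hs
      exact h2 _ (hn s hs'.le))
  simp only [hexpw] at key
  refine key.trans ?_
  have hb : 0 < b := by linarith
  rw [Real.rpow_sub ha, Real.rpow_one]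
  have : a / a ^ ((w.re - l) / (u - l)) * b ^ ((w.re - l) / (u - l)) =
      a * (b / a) ^ ((w.re - l) / (u - l)) := by
    rw [Real.div_rpow hb.le ha.le]; ring
  rw [this]
  gcongr

lemma aux_cross : ∃ C : ℝ, 0 < C ∧ ∀ h : ℂ → ℂ, AuxSetup h → ∀ z : ℂ, ‖z‖ ≤ 1/2 →
    ‖h z‖ ≤ C * (1 + ‖h Complex.I‖) := by
  obtain ⟨E, hE, N, hN, hst⟩ := aux_struct
  obtain ⟨θ, hθ0, hθ1, h3c⟩ := aux_three
  obtain ⟨E5, hE5⟩ : ∃ E5 : ℝ, E5 = 10 ^ N * E + (8/3) ^ N * E := ⟨_, rfl⟩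
  have hE5p : 0 < E5 := by rw [hE5]; positivity
  have hE5a : 10 ^ N * E ≤ E5 := by
    rw [hE5]; have : 0 < (8/3:ℝ) ^ N * E := by positivity
    linarith
  have hE5b : (8/3) ^ N * E ≤ E5 := by
    rw [hE5]; have : 0 < (10:ℝ) ^ N * E := by positivity
    linarith
  obtain ⟨E8, hE8⟩ : ∃ E8 : ℝ, E8 = 1 + E * (1 + (E5 + E5)) := ⟨_, rfl⟩
  have hE8p : 1 ≤ E8 := by rw [hE8]; have : 0 < E * (1 + (E5 + E5)) := by positivity
                           linarith
  obtain ⟨E9, hE9⟩ : ∃ E9 : ℝ, E9 = E8 ^ (1 / (1 - θ)) := ⟨_, rfl⟩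
  have hE9p : 0 < E9 := by rw [hE9]; positivity
  refine ⟨E5 + E5 * E9, by positivity, fun h hs => ?_⟩
  obtain ⟨hup, M, hM, hall⟩ := hst h hs
  set m := 1 + ‖h Complex.I‖ with hm
  have hm1 : 1 ≤ m := by rw [hm]; linarith [norm_nonneg (h Complex.I)]
  have hm0 : 0 < m := by linarith
  set W := max m M with hW
  have hmW : m ≤ W := le_max_left _ _
  have hW0 : 0 < W := by linarith
  have hdd : DifferentiableOn ℂ (deriv h) (Metric.ball 0 4) := hs.1.deriv Metric.isOpen_ball
  -- the derivative bound on the half ball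
  have hd1 : ∀ z : ℂ, ‖z‖ ≤ 1/2 → ‖deriv h z‖ ≤ E5 * W := by
    intro z hz
    have hmax := Complex.norm_le_of_forall_mem_frontier_norm_le (U := Metric.ball (0:ℂ) 1)
      (f := fun z => (z^2 - 1)^N * deriv h z) (C := 2^N * (E * W)) Metric.isBounded_ball (by
        refine DifferentiableOn.diffContOnCl ?_
        rw [closure_ball (0:ℂ) one_ne_zero]
        refine DifferentiableOn.mul (by fun_prop)
          (hdd.mono (Metric.closedBall_subset_ball (by norm_num)))) (by
        intro w hw
        rw [frontier_ball (0:ℂ) one_ne_zero, mem_sphere_zero_iff_norm] at hw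
        have h1 : w^2 - 1 = w * (2 * w.im * Complex.I) := by
          have h2 : (starRingEnd ℂ) w * w = 1 := by
            rw [mul_comm, mul_conj, normSq_eq_norm_sq, hw]; simp
          have h3 : w - (starRingEnd ℂ) w = 2 * w.im * Complex.I := by
            rw [sub_conj]; push_cast; ring
          rw [← h3]; linear_combination h2
        have h2 : ‖w^2 - 1‖ = 2 * |w.im| := by
          rw [h1, norm_mul, hw, one_mul, norm_mul, norm_I, mul_one, norm_mul, norm_real]; simp
        rw [norm_mul, norm_pow, h2, mul_pow, mul_assoc]
        exact mul_le_mul_of_nonneg_left (hall w hw.le) (by positivity)) (z := z) (subset_closure (by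
          rw [mem_ball_zero_iff]; linarith))
    simp only [norm_mul, norm_pow] at hmax
    have h1 : 3/4 ≤ ‖z^2 - 1‖ := by
      have h2 := norm_sub_norm_le (1:ℂ) (z^2)
      rw [norm_one, norm_pow, norm_sub_rev] at h2
      nlinarith [norm_nonneg z]
    have h2 : (3/4)^N * ‖deriv h z‖ ≤ 2^N * (E * W) := by
      refine le_trans ?_ hmax
      gcongr
    calc ‖deriv h z‖ = (4/3)^N * ((3/4)^N * ‖deriv h z‖) := by
          rw [← mul_assoc, ← mul_pow]; norm_num
      _ ≤ (4/3)^N * (2^N * (E * W)) := by gcongr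
      _ = (8/3)^N * E * W := by
          rw [← mul_assoc, ← mul_pow, ← mul_assoc]; norm_num
      _ ≤ E5 * W := by gcongr
  -- the point p
  obtain ⟨p, hp⟩ : ∃ p : ℂ, p = Complex.I / 5 := ⟨_, rfl⟩
  have hpn : ‖p‖ = 1/5 := by rw [hp]; simp
  have hpi : p.im = 1/5 := by rw [hp]; simp
  have hnear : ∀ z, ‖z - p‖ ≤ 1/10 → ‖z‖ ≤ 1 ∧ 1/10 ≤ z.im := by
    intro z hz
    constructor
    · have := norm_le_norm_add_norm_sub' z p
      linarith
    · have h1 := (abs_im_le_norm (z - p)).trans hz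
      rw [sub_im, hpi, abs_le] at h1
      linarith [h1.1]
  have hpow : ∀ z : ℂ, 1/10 ≤ z.im → 1 ≤ 10 ^ N * z.im ^ N := by
    intro z hz
    rw [← mul_pow]
    exact one_le_pow₀ (by linarith)
  have hin : ∀ z, ‖z - p‖ ≤ 1/10 → ‖deriv h z‖ ≤ E5 * m := by
    intro z hz
    obtain ⟨h1, h2⟩ := hnear z hz
    have h3 := (hup z h1 (by linarith)).2
    calc ‖deriv h z‖ = 1 * ‖deriv h z‖ := by ring
      _ ≤ (10^N * z.im^N) * ‖deriv h z‖ := by gcongr; exact hpow z h2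
      _ = 10^N * (z.im^N * ‖deriv h z‖) := by ring
      _ ≤ 10^N * (E * m) := by gcongr
      _ = 10^N * E * m := by ring
      _ ≤ E5 * m := by gcongr
  have hhp : ‖h p‖ ≤ E5 * m := by
    obtain ⟨h1, h2⟩ := hnear p (by simp)
    have h3 := (hup p h1 (by linarith)).1
    calc ‖h p‖ ≤ 1 * (1 + ‖h p‖) := by linarith
      _ ≤ (10^N * p.im^N) * (1 + ‖h p‖) := by gcongr; exact hpow p h2
      _ = 10^N * (p.im^N * (1 + ‖h p‖)) := by ring
      _ ≤ 10^N * (E * m) := by gcongr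
      _ = 10^N * E * m := by ring
      _ ≤ E5 * m := by gcongr
  have hdat : ∀ z : ℂ, ‖z‖ ≤ 1/2 → DifferentiableAt ℂ h z := by
    intro z hz
    exact hs.1.differentiableAt (Metric.isOpen_ball.mem_nhds (by rw [mem_ball_zero_iff]; linarith))
  have hfar : ∀ z, ‖z - p‖ ≤ 3/10 → ‖z‖ ≤ 1/2 := by
    intro z hz
    have := norm_le_norm_add_norm_sub' z p
    linarith
  obtain ⟨X, hX⟩ : ∃ X : ℝ, X = (W / m) ^ θ := ⟨_, rfl⟩
  have hWm : 1 ≤ W / m := (one_le_div hm0).mpr hmW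
  have hX1 : 1 ≤ X := by rw [hX]; exact Real.one_le_rpow hWm hθ0.le
  have hmid : ∀ z, ‖z - p‖ ≤ 1/4 → ‖deriv h z‖ ≤ E5 * m * X := by
    intro z hz
    have := h3c (deriv h) p (E5 * m) (E5 * W) (hdd.mono (Metric.ball_subset_ball' (by
      rw [dist_zero_right, hpn]; norm_num))) (by positivity) (by gcongr) hin
      (fun z hz => hd1 z (hfar z hz)) z hz
    rwa [mul_div_mul_left _ _ hE5p.ne', ← hX] at this
  have hq : ‖h (-(Complex.I / 20))‖ ≤ (E5 + E5) * (m * X) := by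
    have hqp : ‖-(Complex.I / 20) - p‖ = 1/4 := by
      rw [hp, show -(Complex.I / 20) - Complex.I / 5 = -(Complex.I / 4) by ring]; simp
    have h1 : ‖h (-(Complex.I / 20)) - h p‖ ≤ E5 * m * X * ‖-(Complex.I / 20) - p‖ := by
      refine (convex_closedBall p (1/4)).norm_image_sub_le_of_norm_hasDerivWithin_le
        (f' := deriv h) (fun w hw => ?_) (fun w hw => ?_)
        (Metric.mem_closedBall_self (by norm_num)) ?_
      · rw [Metric.mem_closedBall, dist_eq_norm] at hw
        exact (hdat w (hfar w (by linarith))).hasDerivAt.hasDerivWithinAt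
      · rw [Metric.mem_closedBall, dist_eq_norm] at hw
        exact hmid w hw
      · rw [Metric.mem_closedBall, dist_eq_norm]; exact hqp.le
    have h2 := norm_le_norm_add_norm_sub' (h (-(Complex.I / 20))) (h p)
    rw [hqp] at h1
    have h3 : E5 * m ≤ E5 * m * X := le_mul_of_one_le_right (by positivity) hX1
    have h4 : 0 < E5 * m * X := by positivity
    linarith
  have hmX : 1 ≤ m * X := by nlinarith
  have hWb : W ≤ E8 * (m * X) := by
    refine max_le ?_ ?_
    · calc m ≤ 1 * (m * X) := by rw [one_mul]; exact le_mul_of_one_le_right hm0.le hX1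
        _ ≤ _ := by gcongr
    · calc M ≤ E * (1 + ‖h (-(Complex.I / 20))‖) := hM
        _ ≤ E * (m * X + (E5 + E5) * (m * X)) := by gcongr
        _ = E * (1 + (E5 + E5)) * (m * X) := by ring
        _ ≤ E8 * (m * X) := by gcongr; rw [hE8]; linarith
  have hWf : W ≤ E9 * m := by
    have h1 : W / m ≤ E8 * X := by
      rw [div_le_iff₀ hm0]; linarith
    have hR0 : 0 < W / m := by linarith
    have h2 : (W / m) ^ (1 - θ) ≤ E8 := by
      rw [Real.rpow_sub hR0, Real.rpow_one, ← hX]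
      rwa [div_le_iff₀ (by linarith)]
    have h3 : W / m = ((W / m) ^ (1 - θ)) ^ (1 / (1 - θ)) := by
      rw [← Real.rpow_mul hR0.le, mul_one_div_cancel (by linarith), Real.rpow_one]
    have h4 : W / m ≤ E9 := by
      rw [h3, hE9]
      exact Real.rpow_le_rpow (by positivity) h2 (one_div_nonneg.mpr (by linarith))
    rwa [div_le_iff₀ hm0] at h4
  intro z hz
  have hzp : ‖z - p‖ ≤ 1 := by
    have := norm_sub_le z p
    linarith
  have h1 : ‖h z - h p‖ ≤ E5 * W * ‖z - p‖ := by
    refine (convex_closedBall (0:ℂ) (1/2)).norm_image_sub_le_of_norm_hasDerivWithin_le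
      (f' := deriv h) (fun w hw => ?_) (fun w hw => ?_) ?_ ?_
    · rw [mem_closedBall_zero_iff] at hw
      exact (hdat w hw).hasDerivAt.hasDerivWithinAt
    · rw [mem_closedBall_zero_iff] at hw
      exact hd1 w hw
    · rw [mem_closedBall_zero_iff]; linarith
    · rw [mem_closedBall_zero_iff]; exact hz
  have h2 := norm_le_norm_add_norm_sub' (h z) (h p)
  have h3 : E5 * W * ‖z - p‖ ≤ E5 * (E9 * m) * 1 := by gcongr
  calc ‖h z‖ ≤ E5 * m + E5 * (E9 * m) * 1 := by linarith
    _ = _ := by ring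

lemma aux_log_norm_exp (w : ℂ) : Real.log ‖exp w‖ = w.re := by
  rw [norm_exp, Real.log_exp]

/-- the crossing estimate near a point of the line. -/
lemma aux_local_on {D L : Set ℂ} {x c y : ℂ} (hc : c ≠ 0)
    (hball : ∀ w ∈ Metric.ball (0:ℂ) 4, x + w * c ∈ D)
    (hL : ∀ w : ℂ, x + w * c ∈ L → w.im = 0) (hy : ‖(y - x) / c‖ ≤ 1/2)
    (hyi : 0 < ((y - x) / c).im) :
    ∃ C > (0:ℝ), ∀ f : ℂ → ℂ, DifferentiableOn ℂ f D → (∀ z ∈ D, f z ≠ 0) →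
      (∀ z ∈ D, f z = 1 → z ∈ L) → ∀ z, ‖(z - x) / c‖ ≤ 1/2 →
      |Real.log ‖f z‖| ≤ C * (1 + |Real.log ‖f y‖|) := by
  obtain ⟨C, hC, hcr⟩ := aux_cross
  obtain ⟨E, hE, hto⟩ := aux_to_I ((y - x) / c) (by linarith) hyi
  refine ⟨C * E * (1 + Real.pi), by positivity, fun f hf h0 h1 z hz => ?_⟩
  obtain ⟨h, hhd, hh⟩ := aux_exists_log (f := fun w => f (x + w * c)) (c := 0) (r := 4) (by norm_num)
    (hf.comp (by fun_prop) hball) (fun w hw => h0 _ (hball w hw))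
  have hs : AuxSetup h := by
    refine ⟨hhd, fun w hw n hn => hL w (h1 _ (hball w hw) ?_)⟩
    rw [← hh w hw, hn, exp_int_mul_two_pi_mul_I]
  have hval : ∀ z, ‖(z - x) / c‖ ≤ 1/2 → (h ((z - x) / c)).re = Real.log ‖f z‖ := by
    intro z hz
    rw [← aux_log_norm_exp, hh _ (by rw [mem_ball_zero_iff]; linarith), div_mul_cancel₀ _ hc]
    congr 3; ring
  obtain ⟨k, hk⟩ := aux_branch (h ((y - x) / c))
  have hs2 := hs.shift k
  have e1 := hcr _ hs2 _ hz
  have e2 := hto _ hs2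
  rw [hval y hy] at hk
  have hpi := Real.pi_pos
  have e3 : |Real.log ‖f z‖| ≤ ‖h ((z - x) / c) + k * (2 * Real.pi * Complex.I)‖ := by
    have := abs_re_le_norm (h ((z - x) / c) + k * (2 * Real.pi * Complex.I))
    have h4 : (h ((z - x) / c) + k * (2 * Real.pi * Complex.I)).re = Real.log ‖f z‖ := by
      rw [← hval z hz]; simp
    rwa [h4] at this
  calc _ ≤ _ := e3
    _ ≤ _ := e1
    _ ≤ C * (E * (1 + (|Real.log ‖f y‖| + Real.pi))) := by
      gcongr
      refine e2.trans ?_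
      gcongr
    _ = C * E * (1 + Real.pi + |Real.log ‖f y‖|) := by ring
    _ ≤ C * E * ((1 + Real.pi) * (1 + |Real.log ‖f y‖|)) := by
      gcongr
      nlinarith [abs_nonneg (Real.log ‖f y‖)]
    _ = _ := by ring

/-- the estimate away from the line. -/
lemma aux_local_off {D L : Set ℂ} {x : ℂ} {r : ℝ} (hr : 0 < r)
    (hball : Metric.ball x (2 * r) ⊆ D) (hL : ∀ z ∈ Metric.ball x (2 * r), z ∉ L) :
    ∃ C > (0:ℝ), ∀ f : ℂ → ℂ, DifferentiableOn ℂ f D → (∀ z ∈ D, f z ≠ 0) →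
      (∀ z ∈ D, f z = 1 → z ∈ L) → ∀ y ∈ Metric.ball x r, ∀ z ∈ Metric.ball x r,
      |Real.log ‖f z‖| ≤ C * (1 + |Real.log ‖f y‖|) := by
  refine ⟨Real.exp (1536 / r * (2 * r + 1)) * (1 + Real.pi), by positivity,
    fun f hf h0 h1 y hy z hz => ?_⟩
  obtain ⟨h, hhd, hh⟩ := aux_exists_log (f := f) (c := x) (r := 2 * r) (by linarith)
    (hf.mono hball) (fun w hw => h0 _ (hball hw))
  obtain ⟨k, hk⟩ := aux_branch (h y)
  have hsub : Metric.ball x r ⊆ Metric.ball x (2 * r) := Metric.ball_subset_ball (by linarith)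
  have hval : ∀ z ∈ Metric.ball x r, (h z).re = Real.log ‖f z‖ := by
    intro z hz
    rw [← aux_log_norm_exp, hh _ (hsub hz)]
  have hseg : ∀ t ∈ Icc (0:ℝ) 1, Metric.ball (y + t * (z - y)) r ⊆ Metric.ball x (2 * r) := by
    intro t ht
    have h2 : y + t * (z - y) ∈ Metric.ball x r := by
      have := (convex_ball x r).add_smul_sub_mem hy hz ht
      simpa using this
    rw [Metric.mem_ball] at h2
    exact Metric.ball_subset_ball' (by linarith)
  have key := aux_seg (h := fun z => h z + k * (2 * Real.pi * Complex.I)) (p := y) (q := z) hr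
    (fun t ht => (hhd.add_const _).mono (hseg t ht)) (by
      intro t ht w hw n hn
      have hw' := hseg t ht hw
      refine hL w hw' (h1 w (hball hw') ?_)
      rw [← hh w hw']
      have h3 : h w = ((n - k : ℤ) : ℂ) * (2 * Real.pi * Complex.I) := by
        push_cast; linear_combination hn
      rw [h3, exp_int_mul_two_pi_mul_I])
  rw [hval y hy] at hk
  have hpi := Real.pi_pos
  have e3 : |Real.log ‖f z‖| ≤ ‖h z + k * (2 * Real.pi * Complex.I)‖ := by
    have := abs_re_le_norm (h z + k * (2 * Real.pi * Complex.I))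
    have h4 : (h z + k * (2 * Real.pi * Complex.I)).re = Real.log ‖f z‖ := by
      rw [← hval z hz]; simp
    rwa [h4] at this
  have hzy : ‖z - y‖ ≤ 2 * r := by
    rw [Metric.mem_ball] at hy hz
    rw [← dist_eq_norm]
    have := dist_triangle_right z y x
    linarith
  calc _ ≤ _ := e3
    _ ≤ 1 + ‖h z + k * (2 * Real.pi * Complex.I)‖ := by linarith
    _ ≤ _ := key
    _ ≤ (1 + (|Real.log ‖f y‖| + Real.pi)) * Real.exp (1536 / r * (2 * r + 1)) := by
      gcongr
    _ ≤ ((1 + Real.pi) * (1 + |Real.log ‖f y‖|)) * Real.exp (1536 / r * (2 * r + 1)) := by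
      gcongr
      nlinarith [abs_nonneg (Real.log ‖f y‖)]
    _ = _ := by ring

lemma aux_local {D L : Set ℂ} (hD : IsOpen D) {a b : ℂ} (hb : b ≠ 0)
    (hL : L = {z : ℂ | ((z - a) / b).im = 0}) {x : ℂ} (hx : x ∈ D) :
    ∃ r > (0:ℝ), ∀ y ∈ Metric.ball x r, y ∉ L →
    ∃ C > (0:ℝ), ∀ f : ℂ → ℂ, DifferentiableOn ℂ f D → (∀ z ∈ D, f z ≠ 0) →
      (∀ z ∈ D, f z = 1 → z ∈ L) → ∀ z ∈ Metric.ball x r,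
      |Real.log ‖f z‖| ≤ C * (1 + |Real.log ‖f y‖|) := by
  by_cases hxL : x ∈ L
  · obtain ⟨R, hR, hRD⟩ := Metric.isOpen_iff.mp hD x hx
    have hbn : 0 < ‖b‖ := norm_pos_iff.mpr hb
    refine ⟨R / 8, by positivity, fun y hy hyL => ?_⟩
    have hxi : ((x - a) / b).im = 0 := by rw [hL] at hxL; exact hxL
    have main : ∀ σ : ℝ, |σ| = R / (4 * ‖b‖) → 0 < ((y - x) / (σ * b)).im →
      ∃ C > (0:ℝ), ∀ f : ℂ → ℂ, DifferentiableOn ℂ f D → (∀ z ∈ D, f z ≠ 0) →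
      (∀ z ∈ D, f z = 1 → z ∈ L) → ∀ z ∈ Metric.ball x (R / 8),
      |Real.log ‖f z‖| ≤ C * (1 + |Real.log ‖f y‖|) := by
      intro σ hσ hyi
      have hσp : 0 < |σ| := by rw [hσ]; positivity
      have hσ0 : σ ≠ 0 := abs_pos.mp hσp
      have hcn : ‖(σ:ℂ) * b‖ = R / 4 := by
        rw [norm_mul, norm_real, Real.norm_eq_abs, hσ]; field_simp
      have hc0 : (σ:ℂ) * b ≠ 0 := mul_ne_zero (by exact_mod_cast hσ0) hb
      have hz2 : ∀ z ∈ Metric.ball x (R / 8), ‖(z - x) / (σ * b)‖ ≤ 1/2 := by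
        intro z hz
        rw [Metric.mem_ball, dist_eq_norm] at hz
        rw [norm_div, hcn, div_le_iff₀ (by positivity)]
        linarith
      obtain ⟨C, hC, h⟩ := aux_local_on (D := D) (L := L) (x := x) (y := y) hc0 (by
          intro w hw
          apply hRD
          rw [mem_ball_zero_iff] at hw
          rw [Metric.mem_ball, dist_eq_norm, add_sub_cancel_left, norm_mul, hcn]
          nlinarith) (by
          intro w hw
          rw [hL] at hw
          have hw' : ((x + w * (σ * b) - a) / b).im = 0 := hw
          have h2 : (x + w * (σ * b) - a) / b = (x - a) / b + w * σ := by field_simp; ring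
          rw [h2, add_im, hxi, zero_add, im_mul_ofReal] at hw'
          exact (mul_eq_zero.mp hw').resolve_right hσ0) (hz2 y hy) hyi
      exact ⟨C, hC, fun f h1 h2 h3 z hz => h f h1 h2 h3 z (hz2 z hz)⟩
    have hyb : ((y - x) / b).im ≠ 0 := by
      intro h0
      apply hyL
      rw [hL]
      change ((y - a) / b).im = 0
      rw [show (y - a) / b = (y - x) / b + (x - a) / b by ring, add_im, h0, hxi, add_zero]
    have hs0 : 0 < R / (4 * ‖b‖) := by positivity
    have him : ∀ σ : ℝ, ((y - x) / (σ * b)).im = ((y - x) / b).im / σ := by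
      intro σ
      rw [show (y - x) / (σ * b) = (y - x) / b / (σ:ℂ) by rw [div_div, mul_comm], div_ofReal_im]
    rcases lt_or_gt_of_ne hyb with h | h
    · refine main (-(R / (4 * ‖b‖))) (by rw [abs_neg, abs_of_pos hs0]) ?_
      rw [him]
      exact div_pos_of_neg_of_neg h (by linarith)
    · refine main (R / (4 * ‖b‖)) (abs_of_pos hs0) ?_
      rw [him]
      exact div_pos h hs0
  · have hLc : IsClosed L := by
      rw [hL]
      exact isClosed_eq (by fun_prop) continuous_const
    have hop : IsOpen (D ∩ Lᶜ) := hD.inter hLc.isOpen_compl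
    obtain ⟨R, hR, hRD⟩ := Metric.isOpen_iff.mp hop x ⟨hx, hxL⟩
    refine ⟨R / 2, by positivity, fun y hy hyL => ?_⟩
    have e : 2 * (R / 2) = R := by ring
    obtain ⟨C, hC, h⟩ := aux_local_off (D := D) (L := L) (x := x) (r := R / 2) (by positivity)
      (by rw [e]; exact fun z hz => (hRD hz).1) (by rw [e]; exact fun z hz => (hRD hz).2)
    exact ⟨C, hC, fun f h1 h2 h3 z hz => h f h1 h2 h3 y hy z hz⟩

/-- **Lemma 1.** Let `D` be a domain, `L` a straight line, `ξ ∈ D \ L` and `K ⊆ D` compact.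
Then there exists `C > 0` such that every holomorphic function `f` on `D` with `|f(ξ)| > 2`,
without zeros in `D`, and all of whose `1`-points lie on `L`, satisfies
`log |f(z)| ≤ C log |f(ξ)|` on `K`. -/
theorem log_bound_for_zero_free_functions_with_one_points_on_line
    (D : Set ℂ) (hD : IsOpen D) (hDconn : IsPreconnected D)
    (L : Set ℂ) (hL : ∃ a b : ℂ, b ≠ 0 ∧ L = {z : ℂ | ∃ t : ℝ, z = a + (t : ℂ) * b})
    (ξ : ℂ) (hξ : ξ ∈ D \ L)
    (K : Set ℂ) (hK : IsCompact K) (hKD : K ⊆ D) :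
    ∃ C > (0 : ℝ), ∀ f : ℂ → ℂ, DifferentiableOn ℂ f D → 2 < ‖f ξ‖ →
      (∀ z ∈ D, f z ≠ 0) → (∀ z ∈ D, f z = 1 → z ∈ L) →
      ∀ z ∈ K, Real.log ‖f z‖ ≤ C * Real.log ‖f ξ‖ := by
  obtain ⟨a, b, hb, hL⟩ := hL
  have hL' : L = {z : ℂ | ((z - a) / b).im = 0} := by
    rw [hL]
    ext z
    constructor
    · rintro ⟨t, rfl⟩
      change ((a + t * b - a) / b).im = 0
      rw [add_sub_cancel_left, mul_div_cancel_right₀ _ hb, ofReal_im]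
    · intro hz
      have hz' : ((z - a) / b).im = 0 := hz
      refine ⟨((z - a) / b).re, ?_⟩
      have h1 : ((((z - a) / b).re : ℝ) : ℂ) = (z - a) / b := by
        apply Complex.ext <;> simp [hz']
      rw [h1, div_mul_cancel₀ _ hb]; ring
  have hdense : ∀ U : Set ℂ, IsOpen U → U.Nonempty → ∃ y ∈ U, y ∉ L := by
    rintro U hU ⟨y, hy⟩
    by_cases hyL : y ∈ L
    · have hy0 : ((y - a) / b).im = 0 := by rw [hL'] at hyL; exact hyL
      have hcont : Tendsto (fun ε : ℝ => y + ε * (b * Complex.I)) (𝓝[>] 0) (𝓝 y) := by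
        have : Continuous (fun ε : ℝ => y + ε * (b * Complex.I)) := by fun_prop
        have h1 := this.tendsto 0
        simp only [ofReal_zero, zero_mul, add_zero] at h1
        exact h1.mono_left nhdsWithin_le_nhds
      obtain ⟨ε, hε, hε0⟩ := ((hcont.eventually (hU.mem_nhds hy)).and
        (self_mem_nhdsWithin : Ioi (0:ℝ) ∈ 𝓝[>] 0)).exists
      refine ⟨_, hε, fun hmem => ?_⟩
      rw [hL'] at hmem
      have h2 : ((y + ε * (b * Complex.I) - a) / b).im = 0 := hmem
      rw [show (y + ε * (b * Complex.I) - a) / b = (y - a) / b + ε * Complex.I by field_simp; ring,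
        add_im, hy0] at h2
      simp at h2
      exact (ne_of_gt hε0) h2
    · exact ⟨y, hy, hyL⟩
  obtain ⟨hξD, hξL⟩ := hξ
  set G : Set ℂ := {x | ∃ r > (0:ℝ), ∃ C > (0:ℝ), ∀ f : ℂ → ℂ, DifferentiableOn ℂ f D →
      (∀ z ∈ D, f z ≠ 0) → (∀ z ∈ D, f z = 1 → z ∈ L) → ∀ z ∈ Metric.ball x r,
      |Real.log ‖f z‖| ≤ C * (1 + |Real.log ‖f ξ‖|)} with hG
  have hGo : IsOpen G := by
    rw [Metric.isOpen_iff]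
    rintro x ⟨r, hr, C, hC, h⟩
    refine ⟨r, hr, fun x' hx' => ?_⟩
    rw [Metric.mem_ball] at hx'
    refine ⟨r - dist x' x, by linarith, C, hC, fun f h1 h2 h3 z hz => h f h1 h2 h3 z ?_⟩
    exact Metric.ball_subset_ball' (by linarith) hz
  have hξG : ξ ∈ G := by
    obtain ⟨r, hr, h⟩ := aux_local hD hb hL' hξD
    obtain ⟨C, hC, h⟩ := h ξ (Metric.mem_ball_self hr) hξL
    exact ⟨r, hr, C, hC, h⟩
  have hDG : D ⊆ G := by
    refine hDconn.subset_of_closure_inter_subset hGo ⟨ξ, hξD, hξG⟩ ?_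
    rintro x ⟨hxG, hxD⟩
    obtain ⟨r, hr, h⟩ := aux_local hD hb hL' hxD
    obtain ⟨y0, hy0⟩ := mem_closure_iff.mp hxG (Metric.ball x r) Metric.isOpen_ball
      (Metric.mem_ball_self hr)
    obtain ⟨y, hy, hyL⟩ := hdense _ (Metric.isOpen_ball.inter hGo) ⟨y0, hy0⟩
    obtain ⟨C, hC, h⟩ := h y hy.1 hyL
    obtain ⟨r', hr', C', hC', h'⟩ := hy.2
    refine ⟨r, hr, C * (1 + C'), by positivity, fun f h1 h2 h3 z hz => ?_⟩
    have e1 := h f h1 h2 h3 z hz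
    have e2 := h' f h1 h2 h3 y (Metric.mem_ball_self hr')
    calc _ ≤ _ := e1
      _ ≤ C * (1 + C' * (1 + |Real.log ‖f ξ‖|)) := by gcongr
      _ ≤ C * ((1 + C') * (1 + |Real.log ‖f ξ‖|)) := by
        gcongr
        nlinarith [abs_nonneg (Real.log ‖f ξ‖)]
      _ = _ := by ring
  have hKb : ∃ C > (0:ℝ), ∀ f : ℂ → ℂ, DifferentiableOn ℂ f D →
      (∀ z ∈ D, f z ≠ 0) → (∀ z ∈ D, f z = 1 → z ∈ L) → ∀ z ∈ K,
      |Real.log ‖f z‖| ≤ C * (1 + |Real.log ‖f ξ‖|) := by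
    refine hK.induction_on (p := fun S => ∃ C > (0:ℝ), ∀ f : ℂ → ℂ, DifferentiableOn ℂ f D →
      (∀ z ∈ D, f z ≠ 0) → (∀ z ∈ D, f z = 1 → z ∈ L) → ∀ z ∈ S,
      |Real.log ‖f z‖| ≤ C * (1 + |Real.log ‖f ξ‖|)) ?_ ?_ ?_ ?_
    · exact ⟨1, one_pos, fun f _ _ _ z hz => absurd hz (Set.notMem_empty z)⟩
    · rintro s t hst ⟨C, hC, h⟩
      exact ⟨C, hC, fun f h1 h2 h3 z hz => h f h1 h2 h3 z (hst hz)⟩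
    · rintro s t ⟨C, hC, h⟩ ⟨C', hC', h'⟩
      refine ⟨C + C', by positivity, fun f h1 h2 h3 z hz => ?_⟩
      have hnn : 0 ≤ 1 + |Real.log ‖f ξ‖| := by positivity
      rcases hz with hz | hz
      · refine (h f h1 h2 h3 z hz).trans ?_
        gcongr; linarith
      · refine (h' f h1 h2 h3 z hz).trans ?_
        gcongr; linarith
    · intro x hx
      obtain ⟨r, hr, C, hC, h⟩ := hDG (hKD hx)
      exact ⟨Metric.ball x r, mem_nhdsWithin_of_mem_nhds (Metric.ball_mem_nhds x hr), C, hC, h⟩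
  obtain ⟨C, hC, h⟩ := hKb
  refine ⟨3 * C, by positivity, fun f hf h2 h0 h1 z hz => ?_⟩
  have e1 := h f hf h0 h1 z hz
  have e2 : Real.log 2 ≤ Real.log ‖f ξ‖ := Real.log_le_log (by norm_num) h2.le
  have e3 := Real.log_two_gt_d9
  rw [abs_of_nonneg (by linarith : 0 ≤ Real.log ‖f ξ‖)] at e1
  calc _ ≤ _ := le_abs_self _
    _ ≤ _ := e1
    _ ≤ C * (3 * Real.log ‖f ξ‖) := by gcongr; linarith
    _ = _ := by ring
end

section
/- Let F, G and H be transcendental entire functions whose Taylor coefficients at 0 are nonzero for all sufficiently large indices and whose arguments tend to 0; that is, writing F(z) = Σ α_n z^n, G(z) = Σ β_n z^n, H(z) = Σ γ_n z^n, one has α_n, β_n, γ_n ≠ 0 for all large n and arg α_n → 0, arg β_n → 0, arg γ_n → 0 as n → ∞. Let p, q, r be pairwise distinct complex numbers of modulus 1. Then the three functions z ↦ F(pz), z ↦ G(qz), z ↦ H(rz) are linearly independent over ℂ: if a F(pz) + b G(qz) + c H(rz) = 0 for all z ∈ ℂ with a, b, c ∈ ℂ, then a = b = c = 0. -/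
open Complex Filter

lemma aux_decomp (a : ℂ) : ∃ (A : ℂ) (s : ℝ), 0 < s ∧ a = s * A ∧ (A = 0 ∨ ‖A‖ = 1) ∧ (A = 0 → a = 0) := by
  by_cases h : a = 0
  · exact ⟨0, 1, one_pos, by simp [h], Or.inl rfl, fun _ => h⟩
  · have hn : (‖a‖ : ℂ) ≠ 0 := by simpa using h
    refine ⟨a / ‖a‖, ‖a‖, norm_pos_iff.2 h, by field_simp, Or.inr ?_, ?_⟩
    · rw [norm_div]; simp [h]
    · intro h2; rcases div_eq_zero_iff.1 h2 with h3 | h3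
      · exact h3
      · exact absurd h3 hn

/-- two vectors -/
lemma aux_two (Y Z : ℂ) (t u : ℝ) (ht : 0 < t) (hu : 0 < u)
    (hY : Y = 0 ∨ ‖Y‖ = 1) (hZ : Z = 0 ∨ ‖Z‖ = 1) (h : (t : ℂ) * Y + u * Z = 0)
    (hne : ¬ (Y = 0 ∧ Z = 0)) :
    ‖Y + Z‖ ^ 2 ≤ ‖Y‖ ^ 2 + ‖Z‖ ^ 2 - 1 := by
  have htc : (t : ℂ) ≠ 0 := by exact_mod_cast ht.ne'
  have huc : (u : ℂ) ≠ 0 := by exact_mod_cast hu.ne'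
  rcases hY with rfl | hY
  · simp [huc] at h; simp [h] at hne
  rcases hZ with rfl | hZ
  · simp [htc] at h; simp [h] at hne
  have h1 : (t : ℂ) * Y = - (u * Z) := by linear_combination h
  have h2 := congrArg norm h1
  rw [norm_neg, norm_mul, norm_mul, hY, hZ] at h2
  simp [abs_of_pos ht, abs_of_pos hu] at h2
  subst h2
  have : Y + Z = 0 := by
    apply mul_left_cancel₀ htc; linear_combination h
  rw [this, hY, hZ]; norm_num

lemma aux_three_max (X Y Z : ℂ) (s t u : ℝ) (hu : 0 < u)
    (hsu : s ≤ u) (htu : t ≤ u) (hs : 0 < s) (ht : 0 < t)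
    (hX : ‖X‖ = 1) (hY : ‖Y‖ = 1) (hZ : ‖Z‖ = 1)
    (h : (s : ℂ) * X + t * Y + u * Z = 0) : ‖X + Y + Z‖ ≤ 1 := by
  have h1 : (u : ℂ) * Z = - (s * X + t * Y) := by linear_combination h
  have h2 : u ≤ s + t := by
    have := congrArg norm h1
    rw [norm_neg, norm_mul, hZ] at this
    have h3 := norm_add_le ((s : ℂ) * X) (t * Y)
    rw [← this, norm_mul, norm_mul, hX, hY] at h3
    simpa [abs_of_pos hs, abs_of_pos ht, abs_of_pos hu] using h3
  have h4 : (u : ℂ) * (X + Y + Z) = ((u - s : ℝ) : ℂ) * X + ((u - t : ℝ) : ℂ) * Y := by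
    push_cast; linear_combination h1
  have h5 := congrArg norm h4
  have h6 := norm_add_le (((u - s : ℝ) : ℂ) * X) (((u - t : ℝ) : ℂ) * Y)
  rw [← h5, norm_mul, norm_mul, norm_mul, hX, hY, Complex.norm_real, Complex.norm_real,
    Complex.norm_real, Real.norm_of_nonneg hu.le, Real.norm_of_nonneg (by linarith),
    Real.norm_of_nonneg (by linarith)] at h6
  by_contra hc
  push Not at hc
  nlinarith

lemma aux_three_s10 (X Y Z : ℂ) (s t u : ℝ) (hs : 0 < s) (ht : 0 < t) (hu : 0 < u)
    (hX : X = 0 ∨ ‖X‖ = 1) (hY : Y = 0 ∨ ‖Y‖ = 1) (hZ : Z = 0 ∨ ‖Z‖ = 1)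
    (h : (s : ℂ) * X + t * Y + u * Z = 0)
    (hne : ¬ (X = 0 ∧ Y = 0 ∧ Z = 0)) :
    ‖X + Y + Z‖ ^ 2 ≤ ‖X‖ ^ 2 + ‖Y‖ ^ 2 + ‖Z‖ ^ 2 - 1 := by
  rcases hX with rfl | hX'
  · have := aux_two Y Z t u ht hu hY hZ (by simpa using h) (by simpa using hne)
    simpa using this
  rcases hY with rfl | hY'
  · have := aux_two X Z s u hs hu (Or.inr hX') hZ (by simpa using h) (by simpa using hne)
    simpa using this
  rcases hZ with rfl | hZ'
  · have := aux_two X Y s t hs ht (Or.inr hX') (Or.inr hY') (by simpa using h) (by simpa using hne)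
    simpa using this
  have key : ‖X + Y + Z‖ ≤ 1 := by
    rcases le_total s t with h1 | h1
    · rcases le_total t u with h2 | h2
      · exact aux_three_max X Y Z s t u hu (h1.trans h2) h2 hs ht hX' hY' hZ' h
      · have := aux_three_max X Z Y s u t ht h1 h2 hs hu hX' hZ' hY' (by linear_combination h)
        rwa [show X + Y + Z = X + Z + Y by ring]
    · rcases le_total s u with h2 | h2
      · exact aux_three_max X Y Z s t u hu h2 (h1.trans h2) hs ht hX' hY' hZ' h
      · have := aux_three_max Z Y X u t s hs h2 h1 hu ht hZ' hY' hX' (by linear_combination h)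
        rwa [show X + Y + Z = Z + Y + X by ring]
  rw [hX', hY', hZ']
  nlinarith [norm_nonneg (X + Y + Z)]

lemma aux_geom (D p q : ℂ) (hp : ‖p‖ = 1) (hq : ‖q‖ = 1) (hpq : p ≠ q) :
    ∃ K : ℝ, ∀ M : ℕ, |∑ n ∈ Finset.range M,
      (D * (p ^ n * (starRingEnd ℂ) (q ^ n))).re| ≤ K := by
  set l := p * (starRingEnd ℂ) q with hl
  have hqq : q * (starRingEnd ℂ) q = 1 := by rw [Complex.mul_conj', hq]; simp
  have hl1 : l ≠ 1 := by
    intro h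
    apply hpq
    have : l * q = q := by rw [h, one_mul]
    calc p = p * (q * (starRingEnd ℂ) q) := by rw [hqq, mul_one]
      _ = l * q := by rw [hl]; ring
      _ = q := this
  have hln : ‖l‖ = 1 := by rw [hl, norm_mul, RCLike.norm_conj, hp, hq, one_mul]
  refine ⟨‖D‖ * (2 / ‖l - 1‖), fun M => ?_⟩
  have e : ∑ n ∈ Finset.range M, (D * (p ^ n * (starRingEnd ℂ) (q ^ n))).re
      = (D * ∑ n ∈ Finset.range M, l ^ n).re := by
    rw [Finset.mul_sum, Complex.re_sum]
    refine Finset.sum_congr rfl fun n _ => ?_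
    rw [hl, mul_pow, map_pow]
  rw [e]
  refine (Complex.abs_re_le_norm _).trans ?_
  rw [norm_mul, geom_sum_eq hl1, norm_div]
  gcongr
  refine (norm_sub_le _ _).trans ?_
  simp [hln]; norm_num

lemma aux_expand (x y z : ℂ) : ‖x + y + z‖ ^ 2 = ‖x‖ ^ 2 + ‖y‖ ^ 2 + ‖z‖ ^ 2 +
    2 * ((x * (starRingEnd ℂ) y).re + (x * (starRingEnd ℂ) z).re + (y * (starRingEnd ℂ) z).re) := by
  simp only [← Complex.normSq_eq_norm_sq, Complex.normSq_apply, Complex.add_re, Complex.add_im,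
    Complex.mul_re, Complex.conj_re, Complex.conj_im]
  ring

lemma aux_mean (A B C p q r : ℂ) (hp : ‖p‖ = 1) (hq : ‖q‖ = 1) (hr : ‖r‖ = 1)
    (hpq : p ≠ q) (hpr : p ≠ r) (hqr : q ≠ r)
    (h : ∀ n : ℕ, ‖A * p ^ n + B * q ^ n + C * r ^ n‖ ^ 2
      ≤ ‖A‖ ^ 2 + ‖B‖ ^ 2 + ‖C‖ ^ 2 - 1 / 2) : False := by
  obtain ⟨K1, h1⟩ := aux_geom (A * (starRingEnd ℂ) B) p q hp hq hpq
  obtain ⟨K2, h2⟩ := aux_geom (A * (starRingEnd ℂ) C) p r hp hr hpr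
  obtain ⟨K3, h3⟩ := aux_geom (B * (starRingEnd ℂ) C) q r hq hr hqr
  obtain ⟨M, hM⟩ := exists_nat_gt (4 * (K1 + K2 + K3))
  have hterm : ∀ n : ℕ, (A * (starRingEnd ℂ) B * (p ^ n * (starRingEnd ℂ) (q ^ n))).re
      + (A * (starRingEnd ℂ) C * (p ^ n * (starRingEnd ℂ) (r ^ n))).re
      + (B * (starRingEnd ℂ) C * (q ^ n * (starRingEnd ℂ) (r ^ n))).re ≤ - (1 / 4) := by
    intro n
    have := h n
    rw [aux_expand] at this
    simp only [norm_mul, norm_pow, hp, hq, hr, one_pow, mul_one] at this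
    have e : ∀ a b x y : ℂ, a * x * (starRingEnd ℂ) (b * y)
        = a * (starRingEnd ℂ) b * (x * (starRingEnd ℂ) y) := by
      intro a b x y; rw [map_mul]; ring
    rw [e, e, e] at this
    linarith
  have hs := Finset.sum_le_sum (s := Finset.range M) (fun n _ => hterm n)
  rw [Finset.sum_add_distrib, Finset.sum_add_distrib] at hs
  simp only [Finset.sum_const, Finset.card_range, nsmul_eq_mul] at hs
  have a1 := (abs_le.1 (h1 M)).1
  have a2 := (abs_le.1 (h2 M)).1
  have a3 := (abs_le.1 (h3 M)).1
  linarith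

lemma aux_unit (f : ℕ → ℂ) (hne : ∀ᶠ n in atTop, f n ≠ 0)
    (harg : Tendsto (fun n : ℕ => (f n / (n.factorial : ℂ)).arg) atTop (nhds 0)) :
    ∀ᶠ n in atTop, ∃ (s : ℝ) (u : ℂ), 0 < s ∧ ‖u‖ = 1 ∧ ‖u - 1‖ ≤ 1 / 48 ∧ f n = s * u := by
  have h1 : Tendsto (fun n : ℕ => Complex.exp ((f n / (n.factorial : ℂ)).arg * I)) atTop
      (nhds 1) := by
    have hc : Continuous fun x : ℝ => Complex.exp (x * I) := by fun_prop
    have := (hc.tendsto 0).comp harg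
    simpa [Function.comp_def] using this
  have h2 := (Metric.tendsto_nhds.1 h1) (1 / 48) (by norm_num)
  filter_upwards [hne, h2] with n hn hd
  have hf : (n.factorial : ℂ) ≠ 0 := by exact_mod_cast n.factorial_ne_zero
  refine ⟨n.factorial * ‖f n / (n.factorial : ℂ)‖, _, ?_, Complex.norm_exp_ofReal_mul_I _,
    (dist_eq_norm _ (1 : ℂ) ▸ hd).le, ?_⟩
  · have : 0 < ‖f n / (n.factorial : ℂ)‖ := norm_pos_iff.2 (div_ne_zero hn hf)
    have := n.factorial_pos
    positivity
  · rw [Complex.ofReal_mul, mul_assoc, Complex.norm_mul_exp_arg_mul_I, Complex.ofReal_natCast]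
    field_simp

lemma aux_coeff (F G H : ℂ → ℂ)
    (hF : Differentiable ℂ F) (hG : Differentiable ℂ G) (hH : Differentiable ℂ H)
    (p q r a b c : ℂ)
    (hlin : ∀ z : ℂ, a * F (p * z) + b * G (q * z) + c * H (r * z) = 0) (n : ℕ) :
    a * (p ^ n * iteratedDeriv n F 0) + b * (q ^ n * iteratedDeriv n G 0)
      + c * (r ^ n * iteratedDeriv n H 0) = 0 := by
  have key : ∀ (K : ℂ → ℂ), Differentiable ℂ K → ∀ s d : ℂ,
      ContDiff ℂ n (fun z => d * K (s * z)) ∧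
      iteratedDeriv n (fun z => d * K (s * z)) 0 = d * (s ^ n * iteratedDeriv n K 0) := by
    intro K hK s d
    have hc : ContDiff ℂ n K := hK.contDiff
    have hc2 : ContDiff ℂ n (fun z => K (s * z)) := hc.comp (contDiff_const.mul contDiff_id)
    refine ⟨contDiff_const.mul hc2, ?_⟩
    rw [iteratedDeriv_const_mul_field, iteratedDeriv_comp_const_mul hc]
    simp
  obtain ⟨f1, f2⟩ := key F hF p a
  obtain ⟨g1, g2⟩ := key G hG q b
  obtain ⟨h1, h2⟩ := key H hH r c
  have e : ((fun z => a * F (p * z)) + (fun z => b * G (q * z))) + (fun z => c * H (r * z))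
      = fun _ => (0 : ℂ) := by
    funext z; exact hlin z
  have e2 := congrArg (fun K => iteratedDeriv n K 0) e
  have fg : ContDiff ℂ n ((fun z => a * F (p * z)) + (fun z => b * G (q * z))) := f1.add g1
  rw [iteratedDeriv_add fg.contDiffAt h1.contDiffAt,
    iteratedDeriv_add f1.contDiffAt g1.contDiffAt, f2, g2, h2] at e2
  rw [e2]; simp


/-- **Lemma 13.** Let `F`, `G`, `H` be transcendental entire functions whose Taylor
coefficients are eventually nonzero with arguments tending to `0`, and let `p`, `q`, `r` be
pairwise distinct unimodular complex numbers. Then `F(pz)`, `G(qz)`, `H(rz)` are linearly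
independent over `ℂ`. -/
theorem linear_independence_of_rotated_entire_functions
    (F G H : ℂ → ℂ)
    (hF : Differentiable ℂ F) (hG : Differentiable ℂ G) (hH : Differentiable ℂ H)
    (hFt : ¬ ∃ p : Polynomial ℂ, ∀ z, F z = p.eval z)
    (hGt : ¬ ∃ p : Polynomial ℂ, ∀ z, G z = p.eval z)
    (hHt : ¬ ∃ p : Polynomial ℂ, ∀ z, H z = p.eval z)
    (hFne : ∀ᶠ n in atTop, iteratedDeriv n F 0 ≠ 0)
    (hGne : ∀ᶠ n in atTop, iteratedDeriv n G 0 ≠ 0)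
    (hHne : ∀ᶠ n in atTop, iteratedDeriv n H 0 ≠ 0)
    (hFarg : Tendsto (fun n : ℕ => (iteratedDeriv n F 0 / (n.factorial : ℂ)).arg) atTop (nhds 0))
    (hGarg : Tendsto (fun n : ℕ => (iteratedDeriv n G 0 / (n.factorial : ℂ)).arg) atTop (nhds 0))
    (hHarg : Tendsto (fun n : ℕ => (iteratedDeriv n H 0 / (n.factorial : ℂ)).arg) atTop (nhds 0))
    (p q r : ℂ) (hpu : ‖p‖ = 1) (hqu : ‖q‖ = 1) (hru : ‖r‖ = 1)
    (hpq : p ≠ q) (hpr : p ≠ r) (hqr : q ≠ r)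
    (a b c : ℂ)
    (hlin : ∀ z : ℂ, a * F (p * z) + b * G (q * z) + c * H (r * z) = 0) :
    a = 0 ∧ b = 0 ∧ c = 0 := by
  obtain ⟨A, sa, hsa, haA, hA, hA0⟩ := aux_decomp a
  obtain ⟨B, sb, hsb, hbB, hB, hB0⟩ := aux_decomp b
  obtain ⟨C, sc, hsc, hcC, hC, hC0⟩ := aux_decomp c
  by_contra hcon
  have hne : ¬ (A = 0 ∧ B = 0 ∧ C = 0) := fun h => hcon ⟨hA0 h.1, hB0 h.2.1, hC0 h.2.2⟩
  have hle : ∀ D : ℂ, (D = 0 ∨ ‖D‖ = 1) → ‖D‖ ≤ 1 := by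
    rintro D (rfl | h)
    · simp
    · exact h.le
  have hpow : ∀ D x u : ℂ, ∀ n : ℕ, ‖x‖ = 1 → ‖u‖ = 1 → ‖D * x ^ n * u‖ = ‖D‖ := by
    intro D x u n hx hu; simp [hx, hu]
  have hev : ∀ᶠ n : ℕ in atTop, ‖A * p ^ n + B * q ^ n + C * r ^ n‖ ^ 2
      ≤ ‖A‖ ^ 2 + ‖B‖ ^ 2 + ‖C‖ ^ 2 - 1 / 2 := by
    filter_upwards [aux_unit _ hFne hFarg, aux_unit _ hGne hGarg, aux_unit _ hHne hHarg]
      with n ⟨s, u, hs, hu, hu1, hf⟩ ⟨t, v, ht, hv, hv1, hg⟩ ⟨m, w, hm, hw, hw1, hh⟩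
    have hco := aux_coeff F G H hF hG hH p q r a b c hlin n
    rw [hf, hg, hh, haA, hbB, hcC] at hco
    have nX := hpow A p u n hpu hu
    have nY := hpow B q v n hqu hv
    have nZ := hpow C r w n hru hw
    have h01 : ∀ D X : ℂ, ‖X‖ = ‖D‖ → (D = 0 ∨ ‖D‖ = 1) → (X = 0 ∨ ‖X‖ = 1) := by
      intro D X h h'
      rw [h, ← norm_eq_zero, h, norm_eq_zero]; exact h'
    have h0 : ∀ D X : ℂ, ‖X‖ = ‖D‖ → X = 0 → D = 0 := by
      intro D X h h'
      rw [← norm_eq_zero, ← h, h', norm_zero]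
    have h3 := aux_three_s10 (A * p ^ n * u) (B * q ^ n * v) (C * r ^ n * w)
      (sa * s) (sb * t) (sc * m) (mul_pos hsa hs) (mul_pos hsb ht) (mul_pos hsc hm)
      (h01 _ _ nX hA) (h01 _ _ nY hB) (h01 _ _ nZ hC)
      (by push_cast; linear_combination hco)
      (fun h => hne ⟨h0 _ _ nX h.1, h0 _ _ nY h.2.1, h0 _ _ nZ h.2.2⟩)
    rw [nX, nY, nZ] at h3
    set S := A * p ^ n * u + B * q ^ n * v + C * r ^ n * w with hS
    have e : A * p ^ n + B * q ^ n + C * r ^ n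
        = S - (A * p ^ n * (u - 1) + B * q ^ n * (v - 1) + C * r ^ n * (w - 1)) := by
      rw [hS]; ring
    have hd : ∀ D x y : ℂ, ‖x‖ = 1 → (D = 0 ∨ ‖D‖ = 1) → ‖y‖ ≤ 1 / 48 →
        ‖D * x ^ n * y‖ ≤ 1 / 48 := by
      intro D x y hx hD hy
      rw [norm_mul, norm_mul, norm_pow, hx, one_pow, mul_one]
      have := hle D hD
      nlinarith [norm_nonneg y, norm_nonneg D]
    have hS3 : ‖S‖ ≤ 3 := by
      refine (norm_add₃_le).trans ?_
      rw [nX, nY, nZ]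
      linarith [hle A hA, hle B hB, hle C hC]
    have hT : ‖A * p ^ n * (u - 1) + B * q ^ n * (v - 1) + C * r ^ n * (w - 1)‖ ≤ 1 / 16 := by
      refine (norm_add₃_le).trans ?_
      linarith [hd A p _ hpu hA hu1, hd B q _ hqu hB hv1, hd C r _ hru hC hw1]
    have hfin : ‖A * p ^ n + B * q ^ n + C * r ^ n‖ ≤ ‖S‖ + 1 / 16 := by
      rw [e]; exact (norm_sub_le _ _).trans (by linarith)
    nlinarith [norm_nonneg (A * p ^ n + B * q ^ n + C * r ^ n), norm_nonneg S]
  obtain ⟨N, hN⟩ := eventually_atTop.1 hev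
  refine aux_mean (A * p ^ N) (B * q ^ N) (C * r ^ N) p q r hpu hqu hru hpq hpr hqr fun n => ?_
  have := hN (N + n) (by omega)
  simp only [norm_mul, norm_pow, hpu, hqu, hru, one_pow, mul_one]
  simpa only [pow_add, ← mul_assoc] using this
end

section
/- Let r > 0, γ > −2 and 0 < α < π with (2 + γ)α < π, and let S = {z ∈ ℂ : |z| > r, |arg z| < α}. Let u and A be holomorphic in S with u not identically zero, suppose u'' + A u = 0 in S, suppose u and A take real values on the interval (r, ∞), and suppose there exists c > 0 such that A(z)/(c z^γ) → 1 as z → ∞ in S, where z^γ = exp(γ log z) with the principal branch of log. Then there exists x_1 > r such that every zero of u in the sector {z : |arg(z − x_1)| < α} is real. -/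
open Complex Filter Set Topology

lemma core_segment (X T : ℝ) (hT : T ≠ 0) (v v1 Q : ℂ → ℂ)
    (h1 : ∀ t ∈ Icc (0:ℝ) 1, HasDerivAt v (v1 (X + t * T * I)) (X + t * T * I))
    (h2 : ∀ t ∈ Icc (0:ℝ) 1, HasDerivAt v1 (-(Q (X + t * T * I)) * v (X + t * T * I))
      (X + t * T * I))
    (hQ : ∀ t ∈ Icc (0:ℝ) 1, 0 < (Q (X + t * T * I)).re)
    (hv : (v X).im = 0) (hv1 : (v1 X).im = 0) (hz : v (X + T * I) = 0) :
    ∀ t ∈ Ioo (0:ℝ) 1, v (X + t * T * I) = 0 := by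
  have hp : ∀ t : ℝ, HasDerivAt (fun t : ℝ => (X + t * T * I : ℂ)) (T * I) t := by
    intro t
    have := (((Complex.ofRealCLM.hasDerivAt (x := t)).mul_const (T:ℂ)).mul_const I).const_add (X:ℂ)
    simpa using this
  have hV : ∀ t ∈ Icc (0:ℝ) 1, HasDerivAt (fun t : ℝ => v (X + t * T * I))
      (v1 (X + t * T * I) * (T * I)) t := fun t ht =>
    HasDerivAt.comp (h₂ := v) t (h1 t ht) (hp t)
  have hV1 : ∀ t ∈ Icc (0:ℝ) 1, HasDerivAt (fun t : ℝ => v1 (X + t * T * I))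
      (-(Q (X + t * T * I)) * v (X + t * T * I) * (T * I)) t := fun t ht =>
    HasDerivAt.comp (h₂ := v1) t (h2 t ht) (hp t)
  set g : ℝ → ℝ := fun t => ((starRingEnd ℂ (v (X + t * T * I)) * v1 (X + t * T * I)) / T).im with hg
  have hgd : ∀ t ∈ Icc (0:ℝ) 1, HasDerivAt g
      (-(normSq (v1 (X + t * T * I)) + (Q (X + t * T * I)).re * normSq (v (X + t * T * I)))) t := by
    intro t ht
    have h3 := (((hV t ht).star.mul (hV1 t ht)).div_const (T:ℂ))
    have h4 := (Complex.imCLM.hasFDerivAt.comp_hasDerivAt t h3)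
    have hT' : (T:ℂ) ≠ 0 := by exact_mod_cast hT
    refine h4.congr_deriv ?_
    generalize v (X + t * T * I) = a
    generalize v1 (X + t * T * I) = b
    generalize Q (X + t * T * I) = q
    simp only [Complex.imCLM_apply, Complex.div_ofReal_im, normSq_apply, Complex.star_def]
    simp
    field_simp
    ring
  have hanti : AntitoneOn g (Icc 0 1) := by
    apply antitoneOn_of_deriv_nonpos (convex_Icc 0 1)
    · exact fun t ht => (hgd t ht).continuousAt.continuousWithinAt
    · intro t ht
      rw [interior_Icc] at ht
      exact (hgd t (Ioo_subset_Icc_self ht)).differentiableAt.differentiableWithinAt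
    · intro t ht
      rw [interior_Icc] at ht
      have ht' := Ioo_subset_Icc_self ht
      rw [(hgd t ht').deriv]
      have := mul_nonneg (hQ t ht').le (normSq_nonneg (v (X + t * T * I)))
      have := normSq_nonneg (v1 (X + t * T * I))
      linarith
  have g0 : g 0 = 0 := by
    have : (v X * 1).im = 0 := by simpa using hv
    simp [hg, hv, hv1, Complex.div_ofReal_im]
  have g1 : g 1 = 0 := by
    simp [hg, hz]
  have gz : ∀ t ∈ Icc (0:ℝ) 1, g t = 0 := by
    intro t ht
    have a := hanti (left_mem_Icc.2 zero_le_one) ht ht.1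
    have b := hanti ht (right_mem_Icc.2 zero_le_one) ht.2
    linarith
  intro t ht
  have ht' := Ioo_subset_Icc_self ht
  have e : g =ᶠ[𝓝 t] fun _ => 0 := by
    filter_upwards [Icc_mem_nhds ht.1 ht.2] with s hs using gz s hs
  have d0 : deriv g t = 0 := by rw [e.deriv_eq]; simp
  rw [(hgd t ht').deriv] at d0
  have q := hQ t ht'
  have n1 := normSq_nonneg (v1 (X + t * T * I))
  have n2 := normSq_nonneg (v (X + t * T * I))
  have : normSq (v (X + t * T * I)) = 0 := by
    by_contra hne
    have : 0 < normSq (v (X + t * T * I)) := lt_of_le_of_ne n2 (Ne.symm hne)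
    have := mul_pos q this
    linarith
  exact normSq_eq_zero.1 this

lemma norm_lower (z : ℂ) (x α : ℝ) (hx : 0 < x) (h0 : 0 < α) (hπ : α < Real.pi)
    (h : |arg (z - x)| < α) : x * Real.sin α ≤ ‖z‖ := by
  set w := z - (x:ℂ) with hw
  have hzw : z = x + w := by simp [hw]
  have hc : Real.cos α < Real.cos (arg w) := by
    rw [← Real.cos_abs (arg w)]
    exact Real.cos_lt_cos_of_nonneg_of_le_pi (abs_nonneg _) hπ.le h
  have hs := Real.sin_pos_of_pos_of_lt_pi h0 hπ
  have hre : w.re = ‖w‖ * Real.cos (arg w) := (Complex.norm_mul_cos_arg w).symm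
  have him : w.im = ‖w‖ * Real.sin (arg w) := (Complex.norm_mul_sin_arg w).symm
  have e1 := Real.sin_sq_add_cos_sq α
  have e2 := Real.sin_sq_add_cos_sq (arg w)
  have hn : ‖z‖^2 = x^2 + 2 * x * ‖w‖ * Real.cos (arg w) + ‖w‖^2 := by
    rw [← Complex.normSq_eq_norm_sq, Complex.normSq_apply, hzw]
    simp only [add_re, ofReal_re, add_im, ofReal_im, hre, him]
    linear_combination ‖w‖^2 * e2
  refine le_of_sq_le_sq ?_ (norm_nonneg z)
  rw [hn]
  by_cases hcc : 0 ≤ Real.cos (arg w)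
  · have : 0 ≤ 2 * x * ‖w‖ * Real.cos (arg w) := by positivity
    have : x^2 * Real.sin α ^2 ≤ x^2 := by nlinarith [sq_nonneg (Real.cos α), sq_nonneg x, mul_nonneg (sq_nonneg x) (sq_nonneg (Real.cos α))]
    nlinarith [sq_nonneg ‖w‖]
  · push Not at hcc
    have : Real.cos (arg w) ^2 ≤ Real.cos α ^ 2 := by nlinarith
    have h3 : Real.sin α ^2 ≤ 1 - Real.cos (arg w) ^2 := by linarith
    have := mul_le_mul_of_nonneg_left h3 (sq_nonneg x)
    nlinarith [sq_nonneg (‖w‖ + x * Real.cos (arg w))]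

lemma sector_preconn (r α : ℝ) (hr : 0 < r) (hπ : α < Real.pi) :
    IsPreconnected {z : ℂ | r < ‖z‖ ∧ |Complex.arg z| < α} := by
  have : {z : ℂ | r < ‖z‖ ∧ |Complex.arg z| < α} =
      Complex.exp '' (Complex.reCLM ⁻¹' (Ioi (Real.log r)) ∩ Complex.imCLM ⁻¹' (Ioo (-α) α)) := by
    ext z
    constructor
    · rintro ⟨h1, h2⟩
      have hz : z ≠ 0 := norm_pos_iff.1 (hr.trans h1)
      refine ⟨log z, ⟨?_, ?_⟩, exp_log hz⟩
      · simpa [log_re] using Real.log_lt_log hr h1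
      · simpa [log_im] using abs_lt.1 h2
    · rintro ⟨s, ⟨h1, h2⟩, rfl⟩
      simp only [mem_preimage, reCLM_apply, mem_Ioi, imCLM_apply, mem_Ioo] at h1 h2
      constructor
      · rw [norm_exp]; exact (Real.log_lt_iff_lt_exp hr).1 h1
      · rw [← log_im, log_exp (by linarith) (by linarith)]
        exact abs_lt.2 h2
  rw [this]
  refine IsPreconnected.image ?_ _ continuous_exp.continuousOn
  refine (Convex.inter ?_ ?_).isPreconnected
  · exact (convex_Ioi _).linear_preimage Complex.reCLM.toLinearMap
  · exact (convex_Ioo _ _).linear_preimage Complex.imCLM.toLinearMap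

lemma sector_open (r α : ℝ) (hr : 0 < r) (hπ : α < Real.pi) :
    IsOpen {z : ℂ | r < ‖z‖ ∧ |Complex.arg z| < α} := by
  have hsub : ∀ z : ℂ, r < ‖z‖ → |arg z| < α → z ∈ slitPlane := by
    intro z h1 h2
    rw [mem_slitPlane_iff_arg]
    refine ⟨?_, norm_pos_iff.1 (hr.trans h1)⟩
    intro h
    rw [h, abs_of_pos Real.pi_pos] at h2
    linarith
  rw [isOpen_iff_mem_nhds]
  rintro z ⟨h1, h2⟩
  have c := (continuousAt_arg (hsub z h1 h2)).abs
  filter_upwards [c.eventually (gt_mem_nhds h2), continuous_norm.continuousAt.eventually (lt_mem_nhds h1)] with w a b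
  exact ⟨b, a⟩


lemma arg_seg (X T t : ℝ) (hX : 0 < X) (ht : t ∈ Icc (0:ℝ) 1) :
    |arg (X + t * T * I)| ≤ |arg (X + T * I)| := by
  have key : ∀ s : ℝ, arg (X + s * I) = Real.arctan (s / X) := by
    intro s
    have h := tan_arg (X + s * I)
    have h2 : |arg (X + s * I)| < Real.pi / 2 := abs_arg_lt_pi_div_two_iff.2 (by simp [hX])
    rw [abs_lt] at h2
    rw [← Real.arctan_tan h2.1 h2.2, h]
    simp
  have h1 := key (t * T)
  push_cast at h1
  rw [h1, key T]
  rcases le_total 0 T with h | h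
  · have a : 0 ≤ t * T / X := div_nonneg (mul_nonneg ht.1 h) hX.le
    have b : t * T / X ≤ T / X := by gcongr; nlinarith [ht.2]
    exact abs_le_abs_of_nonneg (Real.arctan_nonneg.2 a) (Real.arctan_strictMono.monotone b)
  · have a : t * T / X ≤ 0 := div_nonpos_of_nonpos_of_nonneg (mul_nonpos_of_nonneg_of_nonpos ht.1 h) hX.le
    have b : T / X ≤ t * T / X := by gcongr; nlinarith [ht.2]
    exact abs_le_abs_of_nonpos (by rw [← Real.arctan_zero]; exact Real.arctan_strictMono.monotone a) (Real.arctan_strictMono.monotone b)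

lemma pow_facts (ζ : ℂ) (p α : ℝ) (hζ : ζ ≠ 0) (hαπ : α < Real.pi) (hp : 0 < p)
    (h : p * |arg ζ| < α) :
    log (ζ ^ (p:ℂ)) = log ζ * p ∧ arg (ζ ^ (p:ℂ)) = p * arg ζ ∧
      ∀ γ : ℂ, ζ ^ (p * γ) = (ζ ^ (p:ℂ)) ^ γ := by
  have him : (log ζ * p).im = p * arg ζ := by
    rw [Complex.im_mul_ofReal, log_im, mul_comm]
  have hb : |p * arg ζ| < α := by rwa [abs_mul, abs_of_pos hp]
  rw [abs_lt] at hb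
  have h1 : log (ζ ^ (p:ℂ)) = log ζ * p := by
    rw [cpow_def_of_ne_zero hζ, log_exp] <;> rw [him] <;> linarith
  refine ⟨h1, ?_, fun γ => ?_⟩
  · rw [← log_im, h1, him]
  · apply cpow_mul <;> rw [him] <;> linarith

lemma deriv_v (u : ℂ → ℂ) (ζ a p u1 u2 q : ℂ) (u' : ℂ → ℂ) (hs : ζ ∈ slitPlane)
    (hap : p = 1 - 2 * a)
    (hu : HasDerivAt u u1 (ζ ^ p)) (h1 : u' (ζ ^ p) = u1)
    (hu' : HasDerivAt u' u2 (ζ ^ p)) (hq : u2 = - q * u (ζ ^ p)) :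
    HasDerivAt (fun ζ => ζ ^ a * u (ζ ^ p))
      (a * ζ ^ (a - 1) * u (ζ ^ p) + p * ζ ^ (-a) * u' (ζ ^ p)) ζ ∧
    HasDerivAt (fun ζ => a * ζ ^ (a - 1) * u (ζ ^ p) + p * ζ ^ (-a) * u' (ζ ^ p))
      (-(p ^ 2 * q / (ζ ^ a) ^ 4 - a * (a - 1) / ζ ^ 2) * (ζ ^ a * u (ζ ^ p))) ζ := by
  have h0 : ζ ≠ 0 := slitPlane_ne_zero hs
  have ha0 : ζ ^ a ≠ 0 := by simp [cpow_eq_zero_iff, h0]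
  have hpow : ∀ b : ℂ, HasDerivAt (fun ζ : ℂ => ζ ^ b) (b * ζ ^ (b - 1)) ζ := fun b => by
    simpa using (hasDerivAt_id ζ).cpow_const (c := b) hs
  have hU : HasDerivAt (fun ζ => u (ζ ^ p)) (u1 * (p * ζ ^ (p - 1))) ζ :=
    HasDerivAt.comp (h₂ := u) ζ hu (hpow p)
  have hU' : HasDerivAt (fun ζ => u' (ζ ^ p)) (u2 * (p * ζ ^ (p - 1))) ζ :=
    HasDerivAt.comp (h₂ := u') ζ hu' (hpow p)
  have e1 : ζ ^ (a - 1) = ζ ^ a / ζ := by rw [cpow_sub _ _ h0, cpow_one]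
  have e2 : ζ ^ (a - 1 - 1) = ζ ^ a / ζ / ζ := by
    rw [cpow_sub _ _ h0, cpow_one, e1]
  have e3 : ζ ^ (-a) = (ζ ^ a)⁻¹ := cpow_neg _ _
  have e4 : ζ ^ (-a - 1) = (ζ ^ a)⁻¹ / ζ := by rw [cpow_sub _ _ h0, cpow_one, e3]
  have e5 : ζ ^ (p - 1) = (ζ ^ a)⁻¹ * (ζ ^ a)⁻¹ := by
    rw [← e3, ← cpow_add _ _ h0, hap]; congr 1; ring
  constructor
  · refine ((hpow a).mul hU).congr_deriv ?_
    rw [h1, e3, e5]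
    field_simp
  · refine ((((hpow (a - 1)).const_mul a).mul hU).add
      (((hpow (-a)).const_mul p).mul hU')).congr_deriv ?_
    rw [h1, hq, e1, e2, e3, e4, e5]
    field_simp
    ring

lemma deriv_real (u : ℂ → ℂ) (r x : ℝ) (hx : r < x) (hu : DifferentiableAt ℂ u x)
    (hureal : ∀ x : ℝ, r < x → (u (x : ℂ)).im = 0) : (deriv u x).im = 0 := by
  have h := hu.hasDerivAt.comp_ofReal
  have h2 := Complex.imCLM.hasFDerivAt.comp_hasDerivAt x h
  have e : (Complex.imCLM ∘ fun y : ℝ => u y) =ᶠ[𝓝 x] fun _ => 0 := by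
    filter_upwards [lt_mem_nhds hx] with y hy using hureal y hy
  have := h2.deriv
  rw [e.deriv_eq] at this
  simpa using this.symm

/-- **Lemma 14.** Let `r > 0`, `γ > -2`, `0 < α < π` with `(2 + γ)α < π`, and let
`S = {z : |z| > r, |arg z| < α}`. Let `u` and `A` be holomorphic in `S`, `u` not identically
zero, with `u'' + A u = 0`, both real on `(r, ∞)`, and `A(z) ~ c z^γ` as `z → ∞` in `S` for
some `c > 0`. Then there is `x₁ > r` such that all zeros of `u` in
`{z : |arg (z - x₁)| < α}` are real. -/
theorem zeros_real_in_shifted_sector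
    (r γ α : ℝ) (hr : 0 < r) (hγ : -2 < γ) (hα0 : 0 < α) (hαπ : α < Real.pi)
    (hsec : (2 + γ) * α < Real.pi)
    (S : Set ℂ) (hS : S = {z : ℂ | r < ‖z‖ ∧ |Complex.arg z| < α})
    (u A : ℂ → ℂ) (hu : DifferentiableOn ℂ u S) (hA : DifferentiableOn ℂ A S)
    (hune : ∃ z ∈ S, u z ≠ 0)
    (hode : ∀ z ∈ S, deriv (deriv u) z + A z * u z = 0)
    (hureal : ∀ x : ℝ, r < x → (u (x : ℂ)).im = 0)
    (hAreal : ∀ x : ℝ, r < x → (A (x : ℂ)).im = 0)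
    (c : ℝ) (hc : 0 < c)
    (hasymp : Tendsto (fun z : ℂ => A z / ((c : ℂ) * z ^ (γ : ℂ)))
      ((Filter.comap (fun z : ℂ => ‖z‖) Filter.atTop) ⊓ Filter.principal S) (nhds 1)) :
    ∃ x₁ : ℝ, r < x₁ ∧
      ∀ z ∈ S, |Complex.arg (z - (x₁ : ℂ))| < α → u z = 0 → z.im = 0 := by
  have hSo : IsOpen S := hS ▸ sector_open r α hr hαπ
  have hSc : IsPreconnected S := hS ▸ sector_preconn r α hr hαπ
  have hmem : ∀ z, z ∈ S ↔ r < ‖z‖ ∧ |Complex.arg z| < α := fun z => by rw [hS]; rfl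
  have hdu : DifferentiableOn ℂ (deriv u) S := hu.deriv hSo
  obtain ⟨R0, hR0⟩ : ∃ R0 : ℝ, ∀ z ∈ S, R0 ≤ ‖z‖ →
      1 / 2 < (A z / ((c : ℂ) * z ^ (γ : ℂ))).re := by
    have h1 := (Complex.continuous_re.tendsto 1).comp hasymp
    have h2 : ∀ᶠ x : ℝ in 𝓝 (re 1), 1 / 2 < x := lt_mem_nhds (by norm_num)
    have h3 := h1.eventually h2
    rw [eventually_inf_principal, eventually_comap] at h3
    obtain ⟨R0, hR0⟩ := eventually_atTop.1 h3
    exact ⟨R0, fun z hz hR => hR0 _ hR z rfl hz⟩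
  obtain ⟨m, hm⟩ : ∃ m : ℝ, m = (2 + γ) / 2 := ⟨_, rfl⟩
  obtain ⟨p, hp⟩ : ∃ p : ℝ, p = 1 / m := ⟨_, rfl⟩
  obtain ⟨a, ha⟩ : ∃ a : ℝ, a = (1 - p) / 2 := ⟨_, rfl⟩
  have hm0 : 0 < m := by rw [hm]; linarith
  have hp0 : 0 < p := by rw [hp]; positivity
  have hpm : p * m = 1 := by rw [hp]; field_simp
  have hmα : m * α < Real.pi / 2 := by rw [hm]; linarith
  have hmα0 : 0 < m * α := by positivity
  have hpγ : p * γ = 4 * a := by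
    have : γ = 2 * m - 2 := by rw [hm]; ring
    rw [this, ha]; linear_combination 2 * hpm
  have hcos : 0 < Real.cos (m * α) := Real.cos_pos_of_mem_Ioo ⟨by linarith, hmα⟩
  -- threshold in the transformed plane
  obtain ⟨K, hK0, hKR, hKr, hKQ⟩ : ∃ K : ℝ, 0 < K ∧ (∀ y, K ≤ y → R0 ≤ y ^ p) ∧
      (∀ y, K ≤ y → r < y ^ p) ∧ (∀ y, K ≤ y → |a * (a - 1)| / y ^ 2 < p ^ 2 * c / 2) := by
    have t1 : Tendsto (fun y : ℝ => y ^ p) atTop atTop := tendsto_rpow_atTop hp0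
    have t2 : Tendsto (fun y : ℝ => |a * (a - 1)| / y ^ 2) atTop (𝓝 0) :=
      (tendsto_pow_atTop (two_ne_zero)).const_div_atTop _
    have e := ((t1.eventually_ge_atTop R0).and ((t1.eventually_gt_atTop r).and
      (t2.eventually (gt_mem_nhds (show (0:ℝ) < p ^ 2 * c / 2 by positivity)))))
    obtain ⟨K, hK⟩ := eventually_atTop.1 e
    refine ⟨max K 1, by positivity, ?_, ?_, ?_⟩ <;> intro y hy <;>
      have := hK y ((le_max_left _ _).trans hy)
    · exact this.1
    · exact this.2.1
    · exact this.2.2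
  have hsin := Real.sin_pos_of_pos_of_lt_pi hα0 hαπ
  obtain ⟨x₁, hx1r, hx1K⟩ : ∃ x₁ : ℝ, r < x₁ ∧ K ≤ (x₁ * Real.sin α) ^ m * Real.cos (m * α) := by
    have t1 : Tendsto (fun x : ℝ => (x * Real.sin α) ^ m * Real.cos (m * α)) atTop atTop :=
      ((tendsto_rpow_atTop hm0).comp (tendsto_id.atTop_mul_const hsin)).atTop_mul_const hcos
    exact ((eventually_gt_atTop r).and (t1.eventually_ge_atTop K)).exists
  refine ⟨x₁, hx1r, fun z hzS hzarg hz0 => ?_⟩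
  by_contra him
  have hx0 : 0 < x₁ := hr.trans hx1r
  have hnz := norm_lower z x₁ α hx0 hα0 hαπ hzarg
  have hzne : z ≠ 0 := norm_pos_iff.1 (hr.trans ((hmem z).1 hzS).1)
  have hzα := ((hmem z).1 hzS).2
  -- the transformed zero
  obtain ⟨w, hw⟩ : ∃ w : ℂ, w = z ^ (m : ℂ) := ⟨_, rfl⟩
  have hmz : m * |arg z| < m * α := by gcongr
  obtain ⟨-, hwarg, hwpow⟩ := pow_facts z m (m * α) hzne (by linarith [Real.pi_pos]) hm0 hmz
  rw [← hw] at hwarg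
  have hwp : w ^ (p : ℂ) = z := by
    rw [hw, ← hwpow]
    have : (m : ℂ) * p = 1 := by rw [mul_comm]; exact_mod_cast hpm
    rw [this, cpow_one]
  have hwn : ‖w‖ = ‖z‖ ^ m := by rw [hw, norm_cpow_real]
  have hwabs : |arg w| < m * α := by
    rw [hwarg, abs_mul, abs_of_pos hm0]; exact hmz
  have hwre : K ≤ w.re := by
    rw [← norm_mul_cos_arg w, hwn]
    refine hx1K.trans ?_
    have hc1 : Real.cos (m * α) ≤ Real.cos (arg w) := by
      rw [← Real.cos_abs (arg w)]
      exact Real.cos_le_cos_of_nonneg_of_le_pi (abs_nonneg _) (by linarith [Real.pi_pos]) hwabs.le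
    have hc2 : (x₁ * Real.sin α) ^ m ≤ ‖z‖ ^ m :=
      Real.rpow_le_rpow (by positivity) hnz hm0.le
    exact mul_le_mul hc2 hc1 hcos.le (by positivity)
  have hwre0 : 0 < w.re := hK0.trans_le hwre
  have hwim : w.im ≠ 0 := by
    intro h
    have h1 : arg w = 0 := arg_eq_zero_iff.2 ⟨hwre0.le, h⟩
    rw [hwarg] at h1
    rcases mul_eq_zero.1 h1 with h2 | h2
    · exact hm0.ne' h2
    · exact him (arg_eq_zero_iff.1 h2).2
  obtain ⟨X, hX⟩ : ∃ X : ℝ, X = w.re := ⟨_, rfl⟩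
  obtain ⟨T, hT⟩ : ∃ T : ℝ, T = w.im := ⟨_, rfl⟩
  have hwXT : w = X + T * I := by rw [hX, hT, re_add_im]
  rw [← hX] at hwre hwre0
  rw [← hT] at hwim
  have hX0 : 0 < X := hwre0
  -- facts along the segment
  have hseg : ∀ t ∈ Icc (0:ℝ) 1, (X + t * T * I : ℂ) ∈ slitPlane ∧
      (X + t * T * I : ℂ) ^ (p:ℂ) ∈ S ∧ R0 ≤ ‖(X + t * T * I : ℂ) ^ (p:ℂ)‖ ∧
      K ≤ ‖(X + t * T * I : ℂ)‖ ∧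
      ((X + t * T * I : ℂ) ^ (p:ℂ)) ^ (γ:ℂ) = ((X + t * T * I : ℂ) ^ (a:ℂ)) ^ 4 := by
    intro t ht
    have h1 : |arg (X + t * T * I)| < m * α :=
      (arg_seg X T t hX0 ht).trans_lt (by rw [← hwXT]; exact hwabs)
    have hre : (X + t * T * I : ℂ).re = X := by simp
    generalize (X + t * T * I : ℂ) = ζ at *
    have hsl : ζ ∈ slitPlane := Or.inl (by rw [hre]; exact hX0)
    have hpα : p * |arg ζ| < α := by
      calc p * |arg ζ| < p * (m * α) := by gcongr
        _ = α := by rw [← mul_assoc, hpm, one_mul]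
    obtain ⟨-, f1, f2⟩ := pow_facts ζ p α (slitPlane_ne_zero hsl) hαπ hp0 hpα
    have hn : K ≤ ‖ζ‖ := by
      have := Complex.re_le_norm ζ
      linarith
    refine ⟨hsl, ?_, ?_, hn, ?_⟩
    · rw [hmem, norm_cpow_real, f1, abs_mul, abs_of_pos hp0]
      exact ⟨hKr _ hn, hpα⟩
    · rw [norm_cpow_real]; exact hKR _ hn
    · rw [← f2, ← cpow_nat_mul]
      congr 1
      exact_mod_cast hpγ
  have hpa : (p:ℂ) = 1 - 2 * (a:ℂ) := by
    have : p = 1 - 2 * a := by rw [ha]; ring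
    exact_mod_cast this
  have hder := fun (t : ℝ) (ht : t ∈ Icc (0:ℝ) 1) => deriv_v u (X + t * T * I) a p _ _ (A ((X + t * T * I : ℂ) ^ (p:ℂ)))
    (deriv u) (hseg t ht).1 hpa
    (hu.differentiableAt (hSo.mem_nhds (hseg t ht).2.1)).hasDerivAt rfl
    (hdu.differentiableAt (hSo.mem_nhds (hseg t ht).2.1)).hasDerivAt
    (by linear_combination hode _ (hseg t ht).2.1)
  have hXs := hseg 0 ⟨le_rfl, zero_le_one⟩
  simp only [ofReal_zero, zero_mul, add_zero] at hXs
  have hXp : ((X:ℂ) ^ (p:ℂ)) = ((X ^ p : ℝ) : ℂ) := (ofReal_cpow hX0.le p).symm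
  have hXr : r < X ^ p := hKr X hwre
  have huim := hureal _ hXr
  have hu'im : (deriv u ((X ^ p : ℝ) : ℂ)).im = 0 := by
    refine deriv_real u r _ hXr (hu.differentiableAt (hSo.mem_nhds ?_)) hureal
    rw [← hXp]; exact hXs.2.1
  have hseg0 := core_segment X T hwim (fun ζ => ζ ^ (a:ℂ) * u (ζ ^ (p:ℂ)))
    (fun ζ => a * ζ ^ ((a:ℂ) - 1) * u (ζ ^ (p:ℂ)) + p * ζ ^ (-(a:ℂ)) * deriv u (ζ ^ (p:ℂ)))
    (fun ζ => p ^ 2 * A (ζ ^ (p:ℂ)) / (ζ ^ (a:ℂ)) ^ 4 - a * (a - 1) / ζ ^ 2)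
    (fun t ht => (hder t ht).1) (fun t ht => (hder t ht).2)
    (by
      intro t ht
      obtain ⟨hsl, hzS', hzR, hzK, hzg⟩ := hseg t ht
      generalize (X + t * T * I : ℂ) = ζ at *
      have hA' := hR0 _ hzS' hzR
      rw [hzg] at hA'
      have hc' : (c:ℂ) ≠ 0 := by exact_mod_cast hc.ne'
      have e1 : (p:ℂ) ^ 2 * A (ζ ^ (p:ℂ)) / (ζ ^ (a:ℂ)) ^ 4 =
          ((p ^ 2 * c : ℝ) : ℂ) * (A (ζ ^ (p:ℂ)) / (c * (ζ ^ (a:ℂ)) ^ 4)) := by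
        push_cast
        field_simp
      have e2 : ((a:ℂ) * (a - 1) / ζ ^ 2).re ≤ |a * (a - 1)| / ‖ζ‖ ^ 2 := by
        refine (Complex.re_le_norm _).trans ?_
        have : (a:ℂ) * (a - 1) = ((a * (a - 1) : ℝ) : ℂ) := by push_cast; ring
        rw [this, norm_div, norm_pow, norm_real, Real.norm_eq_abs]
      have e3 := hKQ _ hzK
      have e4 : 0 < p ^ 2 * c := by positivity
      have e5 := mul_lt_mul_of_pos_left hA' e4
      show 0 < ((p:ℂ) ^ 2 * A (ζ ^ (p:ℂ)) / (ζ ^ (a:ℂ)) ^ 4 - a * (a - 1) / ζ ^ 2).re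
      rw [sub_re, e1, re_ofReal_mul]
      linarith)
    (by
      show ((X:ℂ) ^ (a:ℂ) * u ((X:ℂ) ^ (p:ℂ))).im = 0
      rw [hXp, ← ofReal_cpow hX0.le, im_ofReal_mul, huim, mul_zero])
    (by
      show ((a:ℂ) * (X:ℂ) ^ ((a:ℂ) - 1) * u ((X:ℂ) ^ (p:ℂ)) +
        p * (X:ℂ) ^ (-(a:ℂ)) * deriv u ((X:ℂ) ^ (p:ℂ))).im = 0
      have g1 : (X:ℂ) ^ ((a:ℂ) - 1) = ((X ^ (a - 1) : ℝ) : ℂ) := by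
        rw [ofReal_cpow hX0.le]; push_cast; rfl
      have g2 : (X:ℂ) ^ (-(a:ℂ)) = ((X ^ (-a) : ℝ) : ℂ) := by
        rw [ofReal_cpow hX0.le]; push_cast; rfl
      rw [hXp, g1, g2, ← ofReal_mul, ← ofReal_mul, add_im, im_ofReal_mul, im_ofReal_mul, huim, hu'im]
      simp)
    (by
      show (X + T * I : ℂ) ^ (a:ℂ) * u ((X + T * I : ℂ) ^ (p:ℂ)) = 0
      rw [← hwXT, hwp, hz0, mul_zero])
  -- identity theorem
  have hhalf : (1/2 : ℝ) ∈ Ioo (0:ℝ) 1 := by norm_num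
  obtain ⟨hsl, hzS', -, -, -⟩ := hseg (1/2) (Ioo_subset_Icc_self hhalf)
  have hpath : HasDerivAt (fun t : ℝ => (X + t * T * I : ℂ)) (T * I) (1/2) := by
    have := (((Complex.ofRealCLM.hasDerivAt (x := (1/2:ℝ))).mul_const (T:ℂ)).mul_const
      I).const_add (X:ℂ)
    simpa using this
  have hpath2 := (((hasDerivAt_id _).cpow_const (c := (p:ℂ)) hsl)).comp (1/2 : ℝ) hpath
  have htend := hpath2.tendsto_nhdsNE (by
    have h0 := slitPlane_ne_zero hsl
    have hT' : (T:ℂ) ≠ 0 := by exact_mod_cast hwim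
    have hp' : (p:ℂ) ≠ 0 := by exact_mod_cast hp0.ne'
    have : (id (X + ((1/2:ℝ):ℂ) * T * I : ℂ)) ^ ((p:ℂ) - 1) ≠ 0 := by
      rw [id, Ne, cpow_eq_zero_iff]; tauto
    simp only [mul_one]
    exact mul_ne_zero (mul_ne_zero hp' this) (mul_ne_zero hT' I_ne_zero))
  have hAn : AnalyticOnNhd ℂ u S := hu.analyticOnNhd hSo
  obtain ⟨z2, hz2S, hz2⟩ := hune
  rcases (hAn _ hzS').eventually_eq_zero_or_eventually_ne_zero with h | h
  · exact hz2 (hAn.eqOn_zero_of_preconnected_of_eventuallyEq_zero hSc hzS' h hz2S)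
  · have h1 := htend.eventually h
    have h2 : ∀ᶠ t : ℝ in 𝓝[≠] (1/2), t ∈ Ioo (0:ℝ) 1 :=
      nhdsWithin_le_nhds (Ioo_mem_nhds hhalf.1 hhalf.2)
    obtain ⟨t, ht1, ht2⟩ := (h1.and h2).exists
    rcases mul_eq_zero.1 (hseg0 t ht2) with h3 | h3
    · exact slitPlane_ne_zero (hseg t (Ioo_subset_Icc_self ht2)).1 ((cpow_eq_zero_iff _ _).1 h3).1
    · exact ht1 h3
end
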